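/- For every A > 0 there exist B > 0 and a constant C = C(A) such that for all real x ≥ 3 the following holds with Q = x (log x)^{−B}: for every choice of functions assigning to each positive integer q ≤ Q an integer a(q) coprime to q, a complex number 𝔞(q), and a real number y(q), one has ∑_{q ≤ Q} | ∑∑_{ℓ₁, ℓ₂ ≤ x, |ℓ₁ − 𝔞(q)ℓ₂| ≤ y(q), ℓ₁ ≡ a(q)·ℓ₂ (mod q)} γ_{ℓ₁} γ_{ℓ₂} − φ(q)^{−1} ∑∑_{ℓ₁, ℓ₂ ≤ x, |ℓ₁ − 𝔞(q)ℓ₂| ≤ y(q)} γ_{ℓ₁} γ_{ℓ₂} | ≤ C x² (log x)^{−A}. -/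

import Mathlib

open Classical

/-- `γ_ℓ = log ℓ` if `ℓ` is a prime greater than `2`, and `0` otherwise. -/
noncomputable def gam : ℤ → ℝ := fun ℓ => if 2 < ℓ ∧ Prime ℓ then Real.log ℓ else 0

open Complex in
lemma norm_cpow_neg_sub_cpow_neg_le' {x : ℝ} (hx : 0 < x) {s : ℂ} (hs : 0 < s.re)
    {v : ℝ} (hv : v ∈ Set.Icc x (x + 1)) :
    ‖(x : ℂ) ^ (-s) - (v : ℂ) ^ (-s)‖ ≤ ‖s‖ * x ^ (-s.re - 1) := by
  have hs0 : -s ≠ 0 := by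
    intro h
    have : s = 0 := by simpa using h
    simp [this] at hs
  have key := Convex.norm_image_sub_le_of_norm_hasDerivWithin_le (𝕜 := ℝ)
    (f := fun u : ℝ => (u : ℂ) ^ (-s)) (f' := fun u : ℝ => -s * (u : ℂ) ^ (-s - 1))
    (s := Set.Icc x (x + 1)) (C := ‖s‖ * x ^ (-s.re - 1)) (x := v) (y := x)
    ?_ ?_ (convex_Icc _ _) hv (by simp)
  · refine key.trans (mul_le_of_le_one_right (by positivity) ?_)
    rw [Real.norm_eq_abs, abs_le]
    constructor <;> linarith [hv.1, hv.2]
  · intro u hu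
    have hu0 : (0 : ℝ) < u := hx.trans_le hu.1
    exact (hasDerivAt_ofReal_cpow_const hu0.ne' hs0).hasDerivWithinAt
  · intro u hu
    have hu0 : (0 : ℝ) < u := hx.trans_le hu.1
    rw [norm_mul, norm_neg, norm_cpow_eq_rpow_re_of_pos hu0]
    refine mul_le_mul_of_nonneg_left ?_ (norm_nonneg _)
    have : (-s - 1).re = -s.re - 1 := by simp
    rw [this]
    exact Real.rpow_le_rpow_of_nonpos hx hu.1 (by linarith)

lemma norm_cpow_neg_sub_cpow_neg_le {x : ℝ} (hx : 0 < x) {s : ℂ} (hs : 0 < s.re) :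
    ‖(x : ℂ) ^ (-s) - ((x + 1 : ℝ) : ℂ) ^ (-s)‖ ≤ ‖s‖ * x ^ (-s.re - 1) :=
  norm_cpow_neg_sub_cpow_neg_le' hx hs (by simp)

lemma sum_range_abelTail_term {q : ℕ} (χ : DirichletCharacter ℂ q) (N M : ℕ) (s : ℂ) :
    ∑ n ∈ Finset.range M, (∑ k ∈ Finset.range (n + 1), χ ((N + 1 + k : ℕ) : ZMod q)) *
      ((((N + n + 1 : ℕ) : ℝ) : ℂ) ^ (-s) - (((N + n + 1 : ℕ) + 1 : ℝ) : ℂ) ^ (-s)) =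
    ∑ n ∈ Finset.range M, χ ((N + n + 1 : ℕ) : ZMod q) * (((N + n + 1 : ℕ) : ℝ) : ℂ) ^ (-s)
      - (∑ k ∈ Finset.range M, χ ((N + 1 + k : ℕ) : ZMod q)) * (((N + M + 1 : ℕ) : ℝ) : ℂ) ^ (-s)
    := by
  induction M with
  | zero => simp
  | succ M ih =>
    rw [Finset.sum_range_succ, ih, Finset.sum_range_succ _ M, Finset.sum_range_succ _ M]
    have h1 : N + 1 + M = N + M + 1 := by ring
    have h2 : (((N + M + 1 : ℕ) + 1 : ℝ) : ℂ) = (((N + (M + 1) + 1 : ℕ) : ℝ) : ℂ) := by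
      push_cast; ring
    rw [h1, h2]
    ring

section
variable {q : ℕ} [NeZero q]

lemma sum_range_dirichletCharacter_eq_zero {χ : DirichletCharacter ℂ q} (hχ : χ ≠ 1) (a : ℕ) :
    ∑ k ∈ Finset.range q, χ ((a + k : ℕ) : ZMod q) = 0 := by
  have h := MulChar.sum_eq_zero_of_ne_one hχ
  rw [← h]
  refine Finset.sum_bij (fun k _ => ((a + k : ℕ) : ZMod q)) (by simp) ?_ ?_ (by simp)
  · intro i hi j hj hij
    rw [ZMod.natCast_eq_natCast_iff] at hij
    have := Nat.ModEq.add_left_cancel' a hij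
    exact Nat.ModEq.eq_of_lt_of_lt this (Finset.mem_range.1 hi) (Finset.mem_range.1 hj)
  · intro b _
    refine ⟨(b - a : ZMod q).val, Finset.mem_range.2 (ZMod.val_lt _), ?_⟩
    simp

lemma norm_sum_range_dirichletCharacter_le {χ : DirichletCharacter ℂ q} (hχ : χ ≠ 1) (n a : ℕ) :
    ‖∑ k ∈ Finset.range n, χ ((a + k : ℕ) : ZMod q)‖ ≤ q := by
  induction n using Nat.strong_induction_on generalizing a with
  | _ n ih =>
    rcases lt_or_ge n q with h | h
    · refine (norm_sum_le _ _).trans ?_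
      refine (Finset.sum_le_sum (g := fun _ => (1 : ℝ)) fun i _ => χ.norm_le_one _).trans ?_
      simpa using h.le
    · obtain ⟨m, rfl⟩ := Nat.exists_eq_add_of_le h
      rw [Finset.sum_range_add, sum_range_dirichletCharacter_eq_zero hχ, zero_add]
      have := ih m (by have := NeZero.pos q; omega) (a + q)
      simpa [add_assoc] using this

/-- The tail, summed by parts, of the Dirichlet series of `χ` after its first `N` terms. -/
noncomputable def abelTail (χ : DirichletCharacter ℂ q) (N : ℕ) (s : ℂ) : ℂ :=
  ∑' n : ℕ, (∑ k ∈ Finset.range (n + 1), χ ((N + 1 + k : ℕ) : ZMod q)) *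
    ((((N + n + 1 : ℕ) : ℝ) : ℂ) ^ (-s) - (((N + n + 1 : ℕ) + 1 : ℝ) : ℂ) ^ (-s))

lemma norm_abelTail_term_le {χ : DirichletCharacter ℂ q} (hχ : χ ≠ 1) (N n : ℕ) {s : ℂ}
    (hs : 0 < s.re) :
    ‖(∑ k ∈ Finset.range (n + 1), χ ((N + 1 + k : ℕ) : ZMod q)) *
      ((((N + n + 1 : ℕ) : ℝ) : ℂ) ^ (-s) - (((N + n + 1 : ℕ) + 1 : ℝ) : ℂ) ^ (-s))‖ ≤
      q * (‖s‖ * ((N + n + 1 : ℕ) : ℝ) ^ (-s.re - 1)) := by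
  rw [norm_mul]
  refine mul_le_mul (norm_sum_range_dirichletCharacter_le hχ _ _) ?_ (norm_nonneg _) (by positivity)
  exact norm_cpow_neg_sub_cpow_neg_le (by positivity) hs

lemma summable_shift_rpow (N : ℕ) {σ : ℝ} (hσ : 0 < σ) :
    Summable fun n : ℕ => ((N + n + 1 : ℕ) : ℝ) ^ (-σ - 1) := by
  have := (Real.summable_nat_rpow (p := -σ - 1)).2 (by linarith)
  refine ((summable_nat_add_iff (N + 1)).2 this).congr fun n => ?_
  congr 2
  omega

lemma differentiableOn_abelTail {χ : DirichletCharacter ℂ q} (hχ : χ ≠ 1) (N : ℕ) :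
    DifferentiableOn ℂ (abelTail χ N) {s | 0 < s.re} := by
  intro s hs
  have hs' : 0 < s.re := hs
  set U : Set ℂ := {z | s.re / 2 < z.re} ∩ Metric.ball 0 (‖s‖ + 1)
  have hU : IsOpen U := by
    refine IsOpen.inter ?_ Metric.isOpen_ball
    exact isOpen_lt continuous_const Complex.continuous_re
  have hsU : s ∈ U := ⟨by simp only [Set.mem_ofPred_eq]; linarith, by simp⟩
  have : DifferentiableOn ℂ (abelTail χ N) U := by
    refine Complex.differentiableOn_tsum_of_summable_norm
      (u := fun n => q * ((‖s‖ + 1) * ((N + n + 1 : ℕ) : ℝ) ^ (-(s.re / 2) - 1))) ?_ ?_ hU ?_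
    · exact ((summable_shift_rpow N (by linarith)).mul_left _).mul_left _
    · intro n
      refine DifferentiableOn.const_mul (DifferentiableOn.sub ?_ ?_) _
      · intro z _
        refine (DifferentiableAt.const_cpow (by fun_prop) (Or.inl ?_)).differentiableWithinAt
        norm_cast
      · intro z _
        refine (DifferentiableAt.const_cpow (by fun_prop) (Or.inl ?_)).differentiableWithinAt
        norm_cast
    · intro n z hz
      have hz1 : s.re / 2 < z.re := hz.1
      have hz2 : ‖z‖ < ‖s‖ + 1 := by simpa using hz.2
      refine (norm_abelTail_term_le hχ N n (by linarith)).trans ?_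
      gcongr
      simp only [Nat.cast_add, Nat.cast_one, le_add_iff_nonneg_left]
      positivity
  exact (this.differentiableAt (hU.mem_nhds hsU)).differentiableWithinAt

open Filter Topology in
lemma LFunction_eq_sum_add_abelTail_of_one_lt {χ : DirichletCharacter ℂ q} (hχ : χ ≠ 1) (N : ℕ)
    {s : ℂ} (hs : 1 < s.re) :
    χ.LFunction s =
      ∑ n ∈ Finset.range N, χ ((n + 1 : ℕ) : ZMod q) * (((n + 1 : ℕ) : ℝ) : ℂ) ^ (-s) +
        abelTail χ N s := by
  have h1 : HasSum (fun n : ℕ => χ ((n + 1 : ℕ) : ZMod q) * (((n + 1 : ℕ) : ℝ) : ℂ) ^ (-s))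
      (χ.LFunction s) := by
    rw [χ.LFunction_eq_LSeries hs]
    have h := (ZMod.LSeriesSummable_of_one_lt_re χ hs).hasSum
    rw [← hasSum_nat_add_iff' 1] at h
    simp only [Finset.range_one, Finset.sum_singleton, LSeries.term_zero, sub_zero] at h
    refine h.congr_fun ?_ |> fun h => h
    intro n
    rw [LSeries.term_of_ne_zero (by omega), div_eq_mul_inv, Complex.cpow_neg]
    simp
  have h2 : Tendsto (fun M : ℕ => ∑ n ∈ Finset.range M,
      χ ((N + n + 1 : ℕ) : ZMod q) * (((N + n + 1 : ℕ) : ℝ) : ℂ) ^ (-s)) atTop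
      (𝓝 (χ.LFunction s - ∑ n ∈ Finset.range N,
        χ ((n + 1 : ℕ) : ZMod q) * (((n + 1 : ℕ) : ℝ) : ℂ) ^ (-s))) := by
    rw [← hasSum_nat_add_iff' N] at h1
    refine h1.tendsto_sum_nat.congr fun M => ?_
    refine Finset.sum_congr rfl fun n _ => ?_
    rw [show n + N + 1 = N + n + 1 by ring]
  have hsum : Summable fun n : ℕ => (∑ k ∈ Finset.range (n + 1), χ ((N + 1 + k : ℕ) : ZMod q)) *
      ((((N + n + 1 : ℕ) : ℝ) : ℂ) ^ (-s) - (((N + n + 1 : ℕ) + 1 : ℝ) : ℂ) ^ (-s)) := by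
    refine Summable.of_norm_bounded (g := fun n => q * (‖s‖ * ((N + n + 1 : ℕ) : ℝ) ^ (-s.re - 1)))
      (((summable_shift_rpow N (by linarith)).mul_left _).mul_left _) fun n => ?_
    exact norm_abelTail_term_le hχ N n (by linarith)
  have h3 := hsum.hasSum.tendsto_sum_nat
  have h4 : Tendsto (fun M : ℕ => (∑ k ∈ Finset.range M, χ ((N + 1 + k : ℕ) : ZMod q)) *
      (((N + M + 1 : ℕ) : ℝ) : ℂ) ^ (-s)) atTop (𝓝 0) := by
    rw [tendsto_zero_iff_norm_tendsto_zero]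
    have h5 : Tendsto (fun M : ℕ => (q : ℝ) * ((N + M + 1 : ℕ) : ℝ) ^ (-s.re)) atTop
        (𝓝 ((q : ℝ) * 0)) := by
      refine Tendsto.const_mul _ ?_
      refine (tendsto_rpow_neg_atTop (show 0 < s.re by linarith)).comp ?_
      refine tendsto_natCast_atTop_atTop.comp ?_
      exact tendsto_atTop_mono (fun n => by simp only [id]; omega) tendsto_id
    rw [mul_zero] at h5
    refine squeeze_zero (fun _ => norm_nonneg _) (fun M => ?_) h5
    rw [norm_mul, Complex.norm_cpow_eq_rpow_re_of_pos (by positivity), Complex.neg_re]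
    gcongr
    exact norm_sum_range_dirichletCharacter_le hχ _ _
  have h6 := h2.sub h4
  rw [sub_zero] at h6
  have h7 := tendsto_nhds_unique h3
    (h6.congr fun M => (sum_range_abelTail_term χ N M s).symm)
  rw [abelTail, h7]
  ring

lemma LFunction_eq_sum_add_abelTail {χ : DirichletCharacter ℂ q} (hχ : χ ≠ 1) (N : ℕ)
    {s : ℂ} (hs : 0 < s.re) :
    χ.LFunction s =
      ∑ n ∈ Finset.range N, χ ((n + 1 : ℕ) : ZMod q) * (((n + 1 : ℕ) : ℝ) : ℂ) ^ (-s) +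
        abelTail χ N s := by
  have hopen : IsOpen {s : ℂ | 0 < s.re} := isOpen_lt continuous_const Complex.continuous_re
  have hA : AnalyticOnNhd ℂ χ.LFunction {s : ℂ | 0 < s.re} :=
    (DirichletCharacter.differentiable_LFunction hχ).differentiableOn.analyticOnNhd hopen
  have hB : AnalyticOnNhd ℂ (fun s : ℂ => ∑ n ∈ Finset.range N,
      χ ((n + 1 : ℕ) : ZMod q) * (((n + 1 : ℕ) : ℝ) : ℂ) ^ (-s) + abelTail χ N s)
      {s : ℂ | 0 < s.re} := by
    refine DifferentiableOn.analyticOnNhd ?_ hopen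
    refine DifferentiableOn.add ?_ (differentiableOn_abelTail hχ N)
    refine DifferentiableOn.fun_sum fun n _ => DifferentiableOn.const_mul ?_ _
    intro z _
    refine (DifferentiableAt.const_cpow (by fun_prop) (Or.inl ?_)).differentiableWithinAt
    norm_cast
  refine hA.eqOn_of_preconnected_of_eventuallyEq hB ?_ (z₀ := 2) (by simp) ?_ hs
  · exact (convex_halfSpace_re_gt 0).isPreconnected
  · have : {s : ℂ | 1 < s.re} ∈ nhds (2 : ℂ) :=
      (isOpen_lt continuous_const Complex.continuous_re).mem_nhds (by simp)
    filter_upwards [this] with z hz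
    exact LFunction_eq_sum_add_abelTail_of_one_lt hχ N hz

end

lemma tsum_shift_rpow_le (N : ℕ) {σ : ℝ} (hσ : 1 / 2 ≤ σ) :
    ∑' n : ℕ, ((N + n + 1 : ℕ) : ℝ) ^ (-σ - 1) ≤
      ((N : ℝ) + 1) ^ (-(σ - 1 / 2)) * ∑' n : ℕ, ((0 + n + 1 : ℕ) : ℝ) ^ (-(1 / 2 : ℝ) - 1) := by
  rw [← tsum_mul_left]
  refine Summable.tsum_le_tsum (fun n => ?_) (summable_shift_rpow N (by linarith))
    ((summable_shift_rpow 0 (by norm_num)).mul_left _)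
  rw [show -σ - 1 = -(σ - 1 / 2) + (-(1 / 2 : ℝ) - 1) by ring, Real.rpow_add (by positivity)]
  refine mul_le_mul ?_ ?_ (by positivity) (by positivity)
  · refine Real.rpow_le_rpow_of_nonpos (by positivity) ?_ (by linarith)
    push_cast
    have : (0 : ℝ) ≤ n := by positivity
    linarith
  · refine Real.rpow_le_rpow_of_nonpos (by positivity) ?_ (by norm_num)
    push_cast
    have : (0 : ℝ) ≤ N := by positivity
    linarith

lemma sum_range_rpow_le {δ : ℝ} (hδ : 0 < δ) {σ : ℝ} (hσ : 1 - δ ≤ σ) (N : ℕ) :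
    ∑ n ∈ Finset.range N, ((n + 1 : ℕ) : ℝ) ^ (-σ) ≤
      (N : ℝ) ^ (2 * δ) * ∑' n : ℕ, ((0 + n + 1 : ℕ) : ℝ) ^ (-δ - 1) := by
  refine le_trans ?_ (mul_le_mul_of_nonneg_left ((summable_shift_rpow 0 hδ).sum_le_tsum
    (Finset.range N) (fun _ _ => by positivity)) (by positivity))
  rw [Finset.mul_sum]
  refine Finset.sum_le_sum fun n hn => ?_
  have hn' : n + 1 ≤ N := Finset.mem_range.1 hn
  calc ((n + 1 : ℕ) : ℝ) ^ (-σ) ≤ ((n + 1 : ℕ) : ℝ) ^ (2 * δ + (-δ - 1)) := by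
        refine Real.rpow_le_rpow_of_exponent_le (by simp) (by linarith)
    _ = ((n + 1 : ℕ) : ℝ) ^ (2 * δ) * ((n + 1 : ℕ) : ℝ) ^ (-δ - 1) :=
        Real.rpow_add (by positivity) _ _
    _ ≤ (N : ℝ) ^ (2 * δ) * ((0 + n + 1 : ℕ) : ℝ) ^ (-δ - 1) := by
        rw [zero_add]
        gcongr

lemma norm_sum_range_mul_cpow_le {a : ℕ → ℂ} (ha : ∀ n, ‖a n‖ ≤ 1) {δ : ℝ} (hδ : 0 < δ) {s : ℂ}
    (hs : 1 - δ ≤ s.re) (N : ℕ) :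
    ‖∑ n ∈ Finset.range N, a n * (((n + 1 : ℕ) : ℝ) : ℂ) ^ (-s)‖ ≤
      (N : ℝ) ^ (2 * δ) * ∑' n : ℕ, ((0 + n + 1 : ℕ) : ℝ) ^ (-δ - 1) := by
  refine (norm_sum_le _ _).trans (le_trans ?_ (sum_range_rpow_le hδ hs N))
  refine Finset.sum_le_sum fun n _ => ?_
  rw [norm_mul, Complex.norm_cpow_eq_rpow_re_of_pos (by positivity), Complex.neg_re]
  exact mul_le_of_le_one_left (by positivity) (ha n)

lemma norm_abelTail_le {q : ℕ} [NeZero q] {χ : DirichletCharacter ℂ q} (hχ : χ ≠ 1) (N : ℕ)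
    {s : ℂ} (hs : 1 / 2 ≤ s.re) :
    ‖abelTail χ N s‖ ≤ q * (‖s‖ * (((N : ℝ) + 1) ^ (-(s.re - 1 / 2)) *
      ∑' n : ℕ, ((0 + n + 1 : ℕ) : ℝ) ^ (-(1 / 2 : ℝ) - 1))) := by
  have h := summable_shift_rpow N (σ := s.re) (by linarith)
  refine (tsum_of_norm_bounded ((h.mul_left ‖s‖).mul_left (q : ℝ)).hasSum
    (fun n => norm_abelTail_term_le hχ N n (by linarith))).trans ?_
  rw [tsum_mul_left, tsum_mul_left]
  gcongr
  exact tsum_shift_rpow_le N hs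

lemma exists_norm_LFunction_le_mul : ∃ C : ℝ, 0 < C ∧ ∀ (q : ℕ) [NeZero q]
    (χ : DirichletCharacter ℂ q), χ ≠ 1 → ∀ s : ℂ, 1 / 2 ≤ s.re →
      ‖χ.LFunction s‖ ≤ C * q * ‖s‖ := by
  refine ⟨∑' n : ℕ, ((0 + n + 1 : ℕ) : ℝ) ^ (-(1 / 2 : ℝ) - 1), ?_, ?_⟩
  · exact (summable_shift_rpow 0 (by norm_num)).tsum_pos (fun _ => by positivity) 0 (by positivity)
  · intro q _ χ hχ s hs
    rw [LFunction_eq_sum_add_abelTail hχ 0 (by linarith)]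
    simp only [Finset.range_zero, Finset.sum_empty, zero_add]
    refine (norm_abelTail_le hχ 0 hs).trans (le_of_eq ?_)
    simp only [Nat.cast_zero, zero_add, Real.one_rpow, one_mul]
    ring

lemma norm_le_two_mul_abs_im_add_two {s : ℂ} (h0 : 0 ≤ s.re) (h : s.re ≤ 3) :
    ‖s‖ ≤ 2 * (|s.im| + 2) := by
  refine (Complex.norm_le_abs_re_add_abs_im s).trans ?_
  rw [abs_of_nonneg h0]
  have := abs_nonneg s.im
  linarith

lemma exists_norm_LFunction_le_rpow {ε : ℝ} (hε : 0 < ε) (hε1 : ε ≤ 1) :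
    ∃ C : ℝ, 0 < C ∧ ∀ (q : ℕ) [NeZero q] (χ : DirichletCharacter ℂ q), χ ≠ 1 → ∀ s : ℂ,
      1 - ε / 4 ≤ s.re → s.re ≤ 3 →
      ‖χ.LFunction s‖ ≤ C * (q * (|s.im| + 2)) ^ ε := by
  set C0 : ℝ := ∑' n : ℕ, ((0 + n + 1 : ℕ) : ℝ) ^ (-(1 / 2 : ℝ) - 1) with hC0
  set C1 : ℝ := ∑' n : ℕ, ((0 + n + 1 : ℕ) : ℝ) ^ (-(ε / 4) - 1) with hC1
  have hC0' : 0 < C0 :=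
    (summable_shift_rpow 0 (by norm_num)).tsum_pos (fun _ => by positivity) 0 (by positivity)
  have hC1' : 0 < C1 :=
    (summable_shift_rpow 0 (by linarith)).tsum_pos (fun _ => by positivity) 0 (by positivity)
  refine ⟨2 * C0 + C1, by positivity, ?_⟩
  intro q _ χ hχ s hs hs3
  set X : ℝ := q * (|s.im| + 2) with hX
  have hq : (1 : ℝ) ≤ q := by exact_mod_cast NeZero.pos q
  have hX1 : 1 ≤ X := by nlinarith [abs_nonneg s.im]
  have hX0 : 0 < X := by linarith
  rw [LFunction_eq_sum_add_abelTail hχ ⌊X ^ 2⌋₊ (by linarith)]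
  refine (norm_add_le _ _).trans ?_
  have h1 := norm_sum_range_mul_cpow_le (a := fun n => χ ((n + 1 : ℕ) : ZMod q))
    (fun n => χ.norm_le_one _) (δ := ε / 4) (by linarith) hs ⌊X ^ 2⌋₊
  have h2 := norm_abelTail_le hχ ⌊X ^ 2⌋₊ (s := s) (by linarith)
  have h3 : ((⌊X ^ 2⌋₊ : ℕ) : ℝ) ^ (2 * (ε / 4)) ≤ X ^ ε := by
    calc ((⌊X ^ 2⌋₊ : ℕ) : ℝ) ^ (2 * (ε / 4)) ≤ (X ^ 2) ^ (2 * (ε / 4)) := by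
          gcongr
          exact Nat.floor_le (by positivity)
      _ = X ^ ε := by
          rw [← Real.rpow_natCast, ← Real.rpow_mul hX0.le]
          congr 1; push_cast; ring
  have h4 : (((⌊X ^ 2⌋₊ : ℕ) : ℝ) + 1) ^ (-(s.re - 1 / 2)) ≤ X ^ (ε - 1) := by
    calc (((⌊X ^ 2⌋₊ : ℕ) : ℝ) + 1) ^ (-(s.re - 1 / 2))
        ≤ (X ^ 2) ^ (-(s.re - 1 / 2)) :=
          Real.rpow_le_rpow_of_nonpos (by positivity) (Nat.lt_floor_add_one _).le (by linarith)
      _ = X ^ (2 * (-(s.re - 1 / 2))) := by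
          rw [← Real.rpow_natCast, ← Real.rpow_mul hX0.le]; norm_num
      _ ≤ X ^ (ε - 1) := Real.rpow_le_rpow_of_exponent_le hX1 (by linarith)
  have h5 : q * (‖s‖ * (((⌊X ^ 2⌋₊ : ℕ) + 1 : ℝ) ^ (-(s.re - 1 / 2)) * C0)) ≤
      2 * C0 * X ^ ε := by
    calc q * (‖s‖ * (((⌊X ^ 2⌋₊ : ℕ) + 1 : ℝ) ^ (-(s.re - 1 / 2)) * C0))
        ≤ q * ((2 * (|s.im| + 2)) * (X ^ (ε - 1) * C0)) := by
          gcongr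
          exact norm_le_two_mul_abs_im_add_two (by linarith) hs3
      _ = 2 * C0 * (X ^ (ε - 1) * X) := by rw [hX]; ring
      _ = 2 * C0 * X ^ ε := by
          rw [← Real.rpow_add_one hX0.ne']; congr 2; ring
  have h6 : ((⌊X ^ 2⌋₊ : ℕ) : ℝ) ^ (2 * (ε / 4)) * C1 ≤ C1 * X ^ ε := by
    rw [mul_comm]; gcongr
  rw [← hC1] at h1
  rw [← hC0] at h2
  have h7 := h1.trans h6
  have h8 := h2.trans h5
  linarith

lemma exists_norm_deriv_LFunction_le_rpow {ε : ℝ} (hε : 0 < ε) (hε1 : ε ≤ 1) :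
    ∃ C : ℝ, 0 < C ∧ ∀ (q : ℕ) [NeZero q] (χ : DirichletCharacter ℂ q), χ ≠ 1 → ∀ s : ℂ,
      1 - ε / 8 ≤ s.re → s.re ≤ 2 →
      ‖deriv χ.LFunction s‖ ≤ C * (q * (|s.im| + 2)) ^ ε := by
  obtain ⟨C, hC, h⟩ := exists_norm_LFunction_le_rpow hε hε1
  refine ⟨C * 2 / (ε / 8), by positivity, ?_⟩
  intro q _ χ hχ s hs hs2
  have hq : (1 : ℝ) ≤ q := by exact_mod_cast NeZero.pos q
  have := Complex.norm_deriv_le_of_forall_mem_sphere_norm_le (c := s) (R := ε / 8)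
    (C := C * 2 * (q * (|s.im| + 2)) ^ ε) (f := χ.LFunction) (by positivity)
    (DirichletCharacter.differentiable_LFunction hχ).diffContOnCl ?_
  · refine this.trans (le_of_eq ?_)
    ring
  · intro z hz
    have hz' : ‖z - s‖ = ε / 8 := by simpa using hz
    have h1 := (Complex.abs_re_le_norm (z - s)).trans hz'.le
    have h2 := (Complex.abs_im_le_norm (z - s)).trans hz'.le
    rw [Complex.sub_re, abs_le] at h1
    have h3 : |z.im| ≤ |s.im| + ε / 8 := by
      have := abs_sub_abs_le_abs_sub z.im s.im
      rw [Complex.sub_im] at h2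
      linarith
    refine (h q χ hχ z (by linarith) (by linarith)).trans ?_
    rw [mul_assoc]
    refine mul_le_mul_of_nonneg_left ?_ hC.le
    have h4 : (q : ℝ) * (|z.im| + 2) ≤ 2 * (q * (|s.im| + 2)) := by
      nlinarith [abs_nonneg s.im]
    calc ((q : ℝ) * (|z.im| + 2)) ^ ε ≤ (2 * (q * (|s.im| + 2))) ^ ε := by gcongr
      _ = 2 ^ ε * (q * (|s.im| + 2)) ^ ε := Real.mul_rpow (by norm_num) (by positivity)
      _ ≤ 2 * (q * (|s.im| + 2)) ^ ε := by
          gcongr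
          calc (2 : ℝ) ^ ε ≤ 2 ^ (1 : ℝ) := Real.rpow_le_rpow_of_exponent_le (by norm_num) hε1
            _ = 2 := by norm_num

lemma prod_one_add_inv_le_card (S : Finset ℕ) (hS : ∀ p ∈ S, 2 ≤ p) :
    ∏ p ∈ S, (1 + 1 / ((p : ℝ) - 1)) ≤ S.card + 1 := by
  induction S using Finset.induction_on_max with
  | empty => simp
  | insert a s h ih =>
    have has : a ∉ s := fun h' => lt_irrefl _ (h a h')
    rw [Finset.prod_insert has, Finset.card_insert_of_notMem has]
    have ih' := ih fun p hp => hS p (Finset.mem_insert_of_mem hp)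
    have ha : s.card + 2 ≤ a := by
      have hsub : s ⊆ Finset.Ico 2 a := fun p hp =>
        Finset.mem_Ico.2 ⟨hS p (Finset.mem_insert_of_mem hp), h p hp⟩
      have := Finset.card_le_card hsub
      rw [Nat.card_Ico] at this
      have := hS a (Finset.mem_insert_self _ _)
      omega
    have ha' : (s.card : ℝ) + 1 ≤ a - 1 := by
      have : ((s.card + 2 : ℕ) : ℝ) ≤ a := by exact_mod_cast ha
      push_cast at this; linarith
    have hc : (0 : ℝ) < (s.card : ℝ) + 1 := by positivity
    calc (1 + 1 / ((a : ℝ) - 1)) * ∏ p ∈ s, (1 + 1 / ((p : ℝ) - 1))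
        ≤ (1 + 1 / ((s.card : ℝ) + 1)) * (s.card + 1) := by
          refine mul_le_mul ?_ ih' ?_ (by positivity)
          · gcongr
          · refine Finset.prod_nonneg fun p hp => ?_
            have : (2 : ℝ) ≤ p := by exact_mod_cast hS p (Finset.mem_insert_of_mem hp)
            have : (0 : ℝ) < (p : ℝ) - 1 := by linarith
            positivity
      _ = _ := by field_simp; push_cast; ring

lemma card_primeFactors_le_log {q : ℕ} (hq : q ≠ 0) :
    (q.primeFactors.card : ℝ) ≤ 2 * Real.log q := by
  have h1 : 2 ^ q.primeFactors.card ≤ q := by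
    calc 2 ^ q.primeFactors.card ≤ ∏ p ∈ q.primeFactors, p :=
          Finset.pow_card_le_prod _ _ _ fun p hp => (Nat.prime_of_mem_primeFactors hp).two_le
      _ ≤ q := Nat.le_of_dvd (Nat.pos_of_ne_zero hq) (Nat.prod_primeFactors_dvd q)
  have h2 : (q.primeFactors.card : ℝ) * Real.log 2 ≤ Real.log q := by
    rw [← Real.log_pow]
    refine Real.log_le_log (by positivity) ?_
    exact_mod_cast h1
  have := Real.log_two_gt_d9
  nlinarith [Nat.cast_nonneg (α := ℝ) q.primeFactors.card]

lemma prod_primeFactors_one_add_inv_le {q : ℕ} (hq : q ≠ 0) :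
    ∏ p ∈ q.primeFactors, (1 + 1 / ((p : ℝ) - 1)) ≤ 2 * Real.log q + 1 := by
  refine (prod_one_add_inv_le_card _ fun p hp => (Nat.prime_of_mem_primeFactors hp).two_le).trans ?_
  linarith [card_primeFactors_le_log hq]

lemma inv_totient_le {q : ℕ} (hq : q ≠ 0) :
    ((Nat.totient q : ℝ))⁻¹ ≤ (2 * Real.log q + 1) / q := by
  have h1 := Nat.totient_eq_mul_prod_factors q
  have h2 : (Nat.totient q : ℝ) = q * ∏ p ∈ q.primeFactors, (1 - (p : ℝ)⁻¹) := by
    have := congrArg (fun x : ℚ => (x : ℝ)) h1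
    push_cast at this
    exact this
  have h3 : (∏ p ∈ q.primeFactors, (1 - (p : ℝ)⁻¹))⁻¹ =
      ∏ p ∈ q.primeFactors, (1 + 1 / ((p : ℝ) - 1)) := by
    rw [← Finset.prod_inv_distrib]
    refine Finset.prod_congr rfl fun p hp => ?_
    have : (2 : ℝ) ≤ p := by exact_mod_cast (Nat.prime_of_mem_primeFactors hp).two_le
    have h4 : (p : ℝ) - 1 ≠ 0 := by linarith
    have h5 : (p : ℝ) ≠ 0 := by linarith
    have h6 : 1 - (p : ℝ)⁻¹ ≠ 0 := by
      have : 1 - (p : ℝ)⁻¹ = (p - 1) / p := by field_simp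
      rw [this]; positivity
    field_simp
    ring
  rw [h2, mul_inv, h3, mul_comm, div_eq_mul_inv]
  gcongr
  exact prod_primeFactors_one_add_inv_le hq

open Complex in
lemma norm_cpow_sub_integral_le {x : ℝ} (hx : 0 < x) {s : ℂ} (hs : 0 < s.re) (hs1 : s ≠ 1) :
    ‖(x : ℂ) ^ (-s) - ((x : ℂ) ^ (1 - s) - ((x + 1 : ℝ) : ℂ) ^ (1 - s)) / (s - 1)‖ ≤
      ‖s‖ * x ^ (-s.re - 1) := by
  have hs0 : -s ≠ 0 := by
    intro h
    have : s = 0 := by simpa using h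
    simp [this] at hs
  have hs1' : s - 1 ≠ 0 := sub_ne_zero.2 hs1
  have hs2 : 1 - s ≠ 0 := by rw [← neg_sub]; exact neg_ne_zero.2 hs1'
  have key := Convex.norm_image_sub_le_of_norm_hasDerivWithin_le (𝕜 := ℝ)
    (f := fun u : ℝ => (x : ℂ) ^ (-s) * (u : ℂ) + (u : ℂ) ^ (1 - s) / (s - 1))
    (f' := fun u : ℝ => (x : ℂ) ^ (-s) * 1 + ((1 - s) * (u : ℂ) ^ (1 - s - 1)) / (s - 1))
    (s := Set.Icc x (x + 1)) (C := ‖s‖ * x ^ (-s.re - 1)) (x := x) (y := x + 1)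
    ?_ ?_ (convex_Icc _ _) (by simp) (by simp)
  · simp only [add_sub_cancel_left, norm_one, mul_one] at key
    refine le_trans (le_of_eq ?_) key
    congr 1
    push_cast
    field_simp
    ring
  · intro u hu
    have hu0 : (0 : ℝ) < u := hx.trans_le hu.1
    refine HasDerivAt.hasDerivWithinAt ?_
    refine HasDerivAt.add (HasDerivAt.const_mul _ ?_) (HasDerivAt.div_const ?_ _)
    · exact (hasDerivAt_id u).ofReal_comp
    · exact hasDerivAt_ofReal_cpow_const hu0.ne' hs2
  · intro u hu
    have hu0 : (0 : ℝ) < u := hx.trans_le hu.1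
    have h1 : (x : ℂ) ^ (-s) * 1 + ((1 - s) * (u : ℂ) ^ (1 - s - 1)) / (s - 1) =
        (x : ℂ) ^ (-s) - (u : ℂ) ^ (-s) := by
      rw [show 1 - s - 1 = -s by ring]
      field_simp
      ring
    rw [h1]
    exact norm_cpow_neg_sub_cpow_neg_le' hx hs hu

open Complex in
lemma norm_sum_range_cpow_le {s : ℂ} (hs : 1 < s.re) (N M : ℕ) :
    ‖∑ n ∈ Finset.range M, (((N + n + 1 : ℕ) : ℝ) : ℂ) ^ (-s)‖ ≤
      ‖s‖ * ∑' n : ℕ, ((N + n + 1 : ℕ) : ℝ) ^ (-s.re - 1) + 2 / ‖s - 1‖ := by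
  have hs1 : s ≠ 1 := fun h => by simp [h] at hs
  have hs1' : s - 1 ≠ 0 := sub_ne_zero.2 hs1
  have hle : ∀ n : ℕ, ‖(((n + 1 : ℕ) : ℝ) : ℂ) ^ (1 - s)‖ ≤ 1 := fun n => by
    rw [norm_cpow_eq_rpow_re_of_pos (by positivity)]
    exact Real.rpow_le_one_of_one_le_of_nonpos (by simp) (by simp; linarith)
  obtain ⟨F, hF⟩ : ∃ F : ℕ → ℂ, ∀ n, F n = (((N + n + 1 : ℕ) : ℝ) : ℂ) ^ (1 - s) / (s - 1) :=
    ⟨_, fun _ => rfl⟩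
  have key : ∑ n ∈ Finset.range M, (((N + n + 1 : ℕ) : ℝ) : ℂ) ^ (-s) =
      ∑ n ∈ Finset.range M, ((((N + n + 1 : ℕ) : ℝ) : ℂ) ^ (-s) - (F n - F (n + 1))) +
        (F 0 - F M) := by
    rw [← Finset.sum_range_sub' F M, ← Finset.sum_add_distrib]
    exact Finset.sum_congr rfl fun n _ => (sub_add_cancel _ _).symm
  rw [key]
  refine (norm_add_le _ _).trans (add_le_add ?_ ?_)
  · refine (norm_sum_le _ _).trans ?_
    rw [← tsum_mul_left]
    have hsum := (summable_shift_rpow N (show 0 < s.re by linarith)).mul_left ‖s‖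
    have hle2 := hsum.sum_le_tsum (Finset.range M) fun n _ => by positivity
    refine le_trans (Finset.sum_le_sum fun n _ => ?_) hle2
    have := norm_cpow_sub_integral_le (x := ((N + n + 1 : ℕ) : ℝ)) (by positivity)
      (s := s) (by linarith) hs1
    refine le_trans (le_of_eq ?_) this
    congr 1
    simp only [hF]
    push_cast
    ring_nf
  · refine (norm_sub_le _ _).trans ?_
    have h : ∀ n, ‖F n‖ ≤ 1 / ‖s - 1‖ := fun n => by
      rw [hF, norm_div]
      exact div_le_div_of_nonneg_right (hle _) (norm_nonneg _)
    calc ‖F 0‖ + ‖F M‖ ≤ 1 / ‖s - 1‖ + 1 / ‖s - 1‖ := add_le_add (h _) (h _)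
      _ = _ := by ring

lemma exists_norm_riemannZeta_le_rpow {ε : ℝ} (hε : 0 < ε) :
    ∃ C : ℝ, 0 < C ∧ ∀ s : ℂ, 1 < s.re → s.re ≤ 3 →
      ‖riemannZeta s‖ ≤ C * (|s.im| + 2) ^ ε + 2 / ‖s - 1‖ := by
  set C0 : ℝ := ∑' n : ℕ, ((0 + n + 1 : ℕ) : ℝ) ^ (-(1 / 2 : ℝ) - 1) with hC0
  set C1 : ℝ := ∑' n : ℕ, ((0 + n + 1 : ℕ) : ℝ) ^ (-(ε / 4) - 1) with hC1
  have hC0' : 0 < C0 :=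
    (summable_shift_rpow 0 (by norm_num)).tsum_pos (fun _ => by positivity) 0 (by positivity)
  have hC1' : 0 < C1 :=
    (summable_shift_rpow 0 (by linarith)).tsum_pos (fun _ => by positivity) 0 (by positivity)
  refine ⟨2 * C0 + C1, by positivity, ?_⟩
  intro s hs hs3
  set X : ℝ := |s.im| + 2 with hX
  have hX1 : 1 ≤ X := by linarith [abs_nonneg s.im]
  have hX0 : 0 < X := by linarith
  have h1 := norm_sum_range_mul_cpow_le (a := fun n => 1)
    (fun n => by simp) (δ := ε / 4) (by linarith) (s := s) (by linarith) ⌊X ^ 2⌋₊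
  have h2 := norm_sum_range_cpow_le hs ⌊X ^ 2⌋₊
  have h3 : ((⌊X ^ 2⌋₊ : ℕ) : ℝ) ^ (2 * (ε / 4)) ≤ X ^ ε := by
    calc ((⌊X ^ 2⌋₊ : ℕ) : ℝ) ^ (2 * (ε / 4)) ≤ (X ^ 2) ^ (2 * (ε / 4)) := by
          gcongr
          exact Nat.floor_le (by positivity)
      _ = X ^ ε := by
          rw [← Real.rpow_natCast, ← Real.rpow_mul hX0.le]
          congr 1; push_cast; ring
  have h4 : (((⌊X ^ 2⌋₊ : ℕ) : ℝ) + 1) ^ (-(s.re - 1 / 2)) ≤ X⁻¹ := by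
    calc (((⌊X ^ 2⌋₊ : ℕ) : ℝ) + 1) ^ (-(s.re - 1 / 2))
        ≤ (X ^ 2) ^ (-(s.re - 1 / 2)) :=
          Real.rpow_le_rpow_of_nonpos (by positivity) (Nat.lt_floor_add_one _).le (by linarith)
      _ = X ^ (2 * (-(s.re - 1 / 2))) := by
          rw [← Real.rpow_natCast, ← Real.rpow_mul hX0.le]; norm_num
      _ ≤ X ^ (-1 : ℝ) := Real.rpow_le_rpow_of_exponent_le hX1 (by linarith)
      _ = X⁻¹ := Real.rpow_neg_one X
  have h5 : ‖s‖ * ∑' n : ℕ, ((⌊X ^ 2⌋₊ + n + 1 : ℕ) : ℝ) ^ (-s.re - 1) ≤ 2 * C0 := by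
    calc ‖s‖ * ∑' n : ℕ, ((⌊X ^ 2⌋₊ + n + 1 : ℕ) : ℝ) ^ (-s.re - 1)
        ≤ (2 * X) * (X⁻¹ * C0) := by
          gcongr
          · exact norm_le_two_mul_abs_im_add_two (by linarith) hs3
          · refine (tsum_shift_rpow_le _ (by linarith)).trans ?_
            rw [← hC0]
            gcongr
      _ = 2 * C0 := by field_simp
  have h6 : ((⌊X ^ 2⌋₊ : ℕ) : ℝ) ^ (2 * (ε / 4)) * C1 ≤ C1 * X ^ ε := by
    rw [mul_comm]; gcongr
  have h7 : (1 : ℝ) ≤ X ^ ε := Real.one_le_rpow hX1 hε.le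
  have hsum : Summable fun n : ℕ => 1 / ((n : ℂ) + 1) ^ s := by
    have := (summable_nat_add_iff 1).2 (Complex.summable_one_div_nat_cpow.2 hs)
    exact_mod_cast this
  rw [zeta_eq_tsum_one_div_nat_add_one_cpow hs]
  refine le_of_tendsto hsum.hasSum.tendsto_sum_nat.norm ?_
  filter_upwards [Filter.eventually_ge_atTop ⌊X ^ 2⌋₊] with M hM
  obtain ⟨k, rfl⟩ := Nat.exists_eq_add_of_le hM
  rw [Finset.sum_range_add]
  have e : ∀ n : ℕ, 1 / ((n : ℂ) + 1) ^ s = (((n + 1 : ℕ) : ℝ) : ℂ) ^ (-s) := fun n => by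
    rw [Complex.cpow_neg, one_div]; push_cast; rfl
  simp only [e]
  simp only [one_mul] at h1
  rw [← hC1] at h1
  have h8 := h2 k
  refine (norm_add_le _ _).trans ?_
  nlinarith

lemma exists_norm_LFunctionTrivChar_le_rpow {ε : ℝ} (hε : 0 < ε) :
    ∃ C : ℝ, 0 < C ∧ ∀ (q : ℕ) [NeZero q] (s : ℂ), 1 < s.re → s.re ≤ 3 →
      ‖DirichletCharacter.LFunctionTrivChar q s‖ ≤
        C * (q * (|s.im| + 2)) ^ ε * (1 + 1 / ‖s - 1‖) := by
  obtain ⟨C, hC, h⟩ := exists_norm_riemannZeta_le_rpow hε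
  refine ⟨(C + 2) * (2 / ε + 1), by positivity, ?_⟩
  intro q _ s hs hs3
  have hs1 : s ≠ 1 := fun h => by simp [h] at hs
  have hs1' : 0 < ‖s - 1‖ := norm_pos_iff.2 (sub_ne_zero.2 hs1)
  rw [DirichletCharacter.LFunctionTrivChar_eq_mul_riemannZeta hs1, norm_mul, norm_prod]
  have hq : (1 : ℝ) ≤ q := by exact_mod_cast NeZero.pos q
  have h1 : ∏ p ∈ q.primeFactors, ‖1 - (p : ℂ) ^ (-s)‖ ≤ 2 * Real.log q + 1 := by
    refine le_trans (Finset.prod_le_prod (fun _ _ => norm_nonneg _) fun p hp => ?_)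
      (prod_primeFactors_one_add_inv_le (NeZero.ne q))
    have hp2 : (2 : ℝ) ≤ p := by exact_mod_cast (Nat.prime_of_mem_primeFactors hp).two_le
    refine (norm_sub_le _ _).trans ?_
    rw [norm_one]
    gcongr
    have : ‖((p : ℝ) : ℂ) ^ (-s)‖ = (p : ℝ) ^ (-s.re) := by
      rw [Complex.norm_cpow_eq_rpow_re_of_pos (by linarith), Complex.neg_re]
    rw [Complex.ofReal_natCast] at this
    rw [this]
    calc (p : ℝ) ^ (-s.re) ≤ (p : ℝ) ^ (-1 : ℝ) :=
          Real.rpow_le_rpow_of_exponent_le (by linarith) (by linarith)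
      _ = 1 / (p : ℝ) := by rw [Real.rpow_neg_one, one_div]
      _ ≤ _ := by
          apply one_div_le_one_div_of_le <;> linarith
  have h2 : 2 * Real.log q + 1 ≤ (2 / ε + 1) * (q : ℝ) ^ ε := by
    have := Real.log_le_rpow_div (by linarith : (0 : ℝ) ≤ q) hε
    have h1 : (1 : ℝ) ≤ (q : ℝ) ^ ε := Real.one_le_rpow hq hε.le
    calc 2 * Real.log q + 1 ≤ 2 * ((q : ℝ) ^ ε / ε) + (q : ℝ) ^ ε := by linarith
      _ = _ := by ring
  have h3 : ‖riemannZeta s‖ ≤ (C + 2) * (|s.im| + 2) ^ ε * (1 + 1 / ‖s - 1‖) := by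
    have h1 : (1 : ℝ) ≤ (|s.im| + 2) ^ ε :=
      Real.one_le_rpow (by linarith [abs_nonneg s.im]) hε.le
    have h0 : 0 < 1 / ‖s - 1‖ := by positivity
    refine (h s hs hs3).trans ?_
    rw [show 2 / ‖s - 1‖ = 2 * (1 / ‖s - 1‖) by ring]
    nlinarith [mul_pos hC h0, mul_pos (mul_pos hC h0) (zero_lt_one.trans_le h1),
      mul_le_mul_of_nonneg_right h1 h0.le]
  rw [Real.mul_rpow (by linarith) (by positivity)]
  calc _ ≤ ((2 / ε + 1) * (q : ℝ) ^ ε) * ((C + 2) * (|s.im| + 2) ^ ε * (1 + 1 / ‖s - 1‖)) :=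
        mul_le_mul (h1.trans h2) h3 (norm_nonneg _) (by positivity)
    _ = _ := by ring

open scoped ComplexOrder in
lemma iteratedDeriv_alternating_of_deriv_eq {f G : ℂ → ℂ} {c : ℂ} (hf : AnalyticAt ℂ f c)
    (hG : AnalyticAt ℂ G c) (hd : deriv f =ᶠ[nhds c] fun s => -(f s * G s)) (h0 : 0 ≤ f c)
    (hpos : ∀ n : ℕ, 0 ≤ (-1) ^ n * iteratedDeriv n G c) (n : ℕ) :
    0 ≤ (-1) ^ n * iteratedDeriv n f c := by
  induction n using Nat.strong_induction_on with
  | _ n ih =>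
    rcases n with _ | n
    · simpa using h0
    · rw [iteratedDeriv_succ', hd.iteratedDeriv_eq, iteratedDeriv_fun_neg,
        iteratedDeriv_fun_mul hf.contDiffAt hG.contDiffAt, pow_succ, mul_assoc, neg_one_mul, neg_neg,
        Finset.mul_sum]
      refine Finset.sum_nonneg fun i hi => ?_
      have hi' : i ≤ n := Nat.lt_succ_iff.1 (Finset.mem_range.1 hi)
      have e : (-1 : ℂ) ^ n * (n.choose i * iteratedDeriv i f c * iteratedDeriv (n - i) G c) =
          n.choose i * (((-1) ^ i * iteratedDeriv i f c) *
            ((-1) ^ (n - i) * iteratedDeriv (n - i) G c)) := by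
        have : (-1 : ℂ) ^ n = (-1) ^ i * (-1) ^ (n - i) := by
          rw [← pow_add, Nat.add_sub_cancel' hi']
        rw [this]; ring
      rw [e]
      exact mul_nonneg (Nat.cast_nonneg _) (mul_nonneg (ih i (by omega)) (hpos _))

lemma iteratedDeriv_inv_sub_one_two (m : ℕ) :
    iteratedDeriv m (fun s : ℂ => (s - 1)⁻¹) 2 = (-1) ^ m * (m.factorial : ℂ) := by
  have := congrFun (iter_deriv_inv_linear_sub (𝕜 := ℂ) m 1 1) 2
  simp only [one_mul] at this
  rw [iteratedDeriv_eq_iterate, this]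
  norm_num

/-- Landau's device: comparison of a function with nonnegative alternating derivatives at `2` and a
simple pole at `1` with its value at a real point slightly to the left of `1`. -/
lemma re_apply_two_le {F H : ℂ → ℂ} {lam : ℂ} (hH : Differentiable ℂ H)
    (hF : ∀ s, s ≠ 1 → F s = H s + lam * (s - 1)⁻¹)
    (hpos : ∀ m : ℕ, 0 ≤ ((-1) ^ m * iteratedDeriv m F 2).re) {K : ℝ}
    (hK : ∀ s ∈ Metric.sphere (2 : ℂ) (3 / 2), ‖H s‖ ≤ K) {β : ℝ} (hβ : 7 / 8 < β) (hβ1 : β < 1)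
    {M : ℕ} (hM : 1 ≤ M) :
    (F 2).re ≤ (F β).re + ‖lam‖ * ((2 - β) ^ M / (1 - β)) + 4 * K * (3 / 4) ^ M := by
  have hK0 : 0 ≤ K := (norm_nonneg _).trans (hK (2 + (3 / 2 : ℝ)) (by simp))
  have hb1 : (1 - β) ≠ 0 := by linarith
  set h : ℕ → ℂ := fun m => (-1) ^ m * iteratedDeriv m H 2 / m.factorial with hh
  set b : ℕ → ℂ := fun m => (-1) ^ m * iteratedDeriv m F 2 / m.factorial with hb
  have hbh : ∀ m, b m = h m + lam := by
    intro m
    have e : F =ᶠ[nhds 2] fun s => H s + lam * (s - 1)⁻¹ := by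
      filter_upwards [isOpen_ne.mem_nhds (show (2 : ℂ) ≠ 1 by norm_num)] with s hs using hF s hs
    have hc : ContDiffAt ℂ m (fun s : ℂ => (s - 1)⁻¹) 2 :=
      (contDiffAt_id.sub contDiffAt_const).inv (by norm_num)
    simp only [hb, hh]
    rw [e.iteratedDeriv_eq, iteratedDeriv_fun_add hH.contDiff.contDiffAt (contDiffAt_const.mul hc),
      iteratedDeriv_const_mul_field, iteratedDeriv_inv_sub_one_two]
    have hf : (m.factorial : ℂ) ≠ 0 := by exact_mod_cast m.factorial_ne_zero
    have h2 : ((-1 : ℂ) ^ m) * (-1) ^ m = 1 := by rw [← mul_pow]; simp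
    field_simp
    linear_combination lam * (m.factorial : ℂ) * h2
  have hbre : ∀ m, 0 ≤ (b m).re := by
    intro m
    simp only [hb]
    rw [Complex.div_natCast_re]
    exact div_nonneg (hpos m) (by positivity)
  have hhn : ∀ m, ‖h m‖ ≤ K * (2 / 3) ^ m := by
    intro m
    have := Complex.norm_iteratedDeriv_le_of_forall_mem_sphere_norm_le m
      (show (0 : ℝ) < 3 / 2 by norm_num) (hH.diffContOnCl) hK
    simp only [hh]
    rw [norm_div, norm_mul, norm_pow, norm_neg, norm_one, one_pow, one_mul, Complex.norm_natCast,
      div_le_iff₀ (by positivity)]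
    refine this.trans (le_of_eq ?_)
    rw [div_eq_mul_inv, ← inv_pow]
    norm_num
    ring
  set r : ℝ := 2 - β with hr
  have hs : HasSum (fun m => h m * (r : ℂ) ^ m) (H β) := by
    have := Complex.hasSum_taylorSeries_of_entire hH 2 (β : ℂ)
    refine this.congr_fun fun m => ?_
    simp only [hh, hr, smul_eq_mul]
    rw [show (((2 - β : ℝ)) : ℂ) = (-1) * ((β : ℂ) - 2) by push_cast; ring, mul_pow]
    have h2 : ((-1 : ℂ) ^ m) * (-1) ^ m = 1 := by rw [← mul_pow]; simp
    rw [div_eq_mul_inv]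
    linear_combination (((β : ℂ) - 2) ^ m * iteratedDeriv m H 2 * (m.factorial : ℂ)⁻¹) * h2
  have hr0 : 0 < r := by linarith
  have hr1 : r ≤ 9 / 8 := by linarith
  have htail : ‖H β - ∑ m ∈ Finset.range M, h m * (r : ℂ) ^ m‖ ≤ 4 * K * (3 / 4) ^ M := by
    have hs' := (hasSum_nat_add_iff' M).2 hs
    have hg : HasSum (fun m : ℕ => K * (3 / 4) ^ M * (3 / 4 : ℝ) ^ m)
        (K * (3 / 4) ^ M * (1 - 3 / 4)⁻¹) :=
      (hasSum_geometric_of_lt_one (by norm_num) (by norm_num)).mul_left _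
    rw [← hs'.tsum_eq]
    refine (tsum_of_norm_bounded hg fun m => ?_).trans (le_of_eq (by ring))
    rw [norm_mul, norm_pow, Complex.norm_of_nonneg hr0.le]
    calc ‖h (m + M)‖ * r ^ (m + M) ≤ (K * (2 / 3) ^ (m + M)) * (9 / 8) ^ (m + M) := by
          gcongr
          exact hhn _
      _ = K * (2 / 3 * (9 / 8)) ^ (m + M) := by rw [mul_pow]; ring
      _ = K * (3 / 4) ^ M * (3 / 4) ^ m := by
          rw [show (2 / 3 * (9 / 8) : ℝ) = 3 / 4 by norm_num, pow_add]; ring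
  have hgeom : ∑ m ∈ Finset.range M, (r : ℂ) ^ m = ((r : ℂ) ^ M - 1) / (1 - β) := by
    rw [geom_sum_eq]
    · rw [hr]; push_cast; ring
    · intro h'
      have : r = 1 := by exact_mod_cast h'
      exact hb1 (by linarith)
  have hFβ : F β = ∑ m ∈ Finset.range M, b m * (r : ℂ) ^ m - lam * ((r : ℂ) ^ M / (1 - β)) +
      (H β - ∑ m ∈ Finset.range M, h m * (r : ℂ) ^ m) := by
    have hb1' : (1 : ℂ) - β ≠ 0 := by exact_mod_cast hb1
    have hb1'' : (β : ℂ) - 1 ≠ 0 := by rw [← neg_sub]; exact neg_ne_zero.2 hb1'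
    rw [hF β (by intro h'; exact hb1'' (by rw [h']; ring))]
    simp only [hbh, add_mul, Finset.sum_add_distrib, ← Finset.mul_sum]
    rw [hgeom]
    field_simp
    ring
  have hbsum : (F 2).re ≤ (∑ m ∈ Finset.range M, b m * (r : ℂ) ^ m).re := by
    have hterm : ∀ m, (b m * (r : ℂ) ^ m).re = (b m).re * r ^ m := fun m => by
      rw [← Complex.ofReal_pow, Complex.re_mul_ofReal]
    rw [Complex.re_sum]
    have h0 : (F 2).re = (b 0 * (r : ℂ) ^ 0).re := by simp [hb]
    rw [h0]
    refine Finset.single_le_sum (f := fun m => (b m * (r : ℂ) ^ m).re) (fun m _ => ?_)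
      (Finset.mem_range.2 hM)
    rw [hterm]
    exact mul_nonneg (hbre m) (by positivity)
  have h1 := congrArg Complex.re hFβ
  rw [Complex.add_re, Complex.sub_re] at h1
  have h2 : (lam * ((r : ℂ) ^ M / (1 - β))).re ≤ ‖lam‖ * (r ^ M / (1 - β)) := by
    refine (Complex.re_le_norm _).trans (le_of_eq ?_)
    rw [norm_mul, norm_div, norm_pow, Complex.norm_of_nonneg hr0.le]
    congr 2
    rw [← Complex.ofReal_one, ← Complex.ofReal_sub, Complex.norm_of_nonneg (by linarith)]
  have h3 := (abs_le.1 ((Complex.abs_re_le_norm _).trans htail)).1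
  linarith

/-- `g` is the coefficient sequence of `-f'/f` in the half-plane `re s > 1`. -/
def HasNegLogDerivCoeff (f : ℂ → ℂ) (g : ℕ → ℂ) : Prop :=
  ∀ s : ℂ, 1 < s.re → HasDerivAt f (-(f s * LSeries g s)) s ∧ LSeriesSummable g s

lemma HasNegLogDerivCoeff.mul {f₁ f₂ : ℂ → ℂ} {g₁ g₂ : ℕ → ℂ} (h₁ : HasNegLogDerivCoeff f₁ g₁)
    (h₂ : HasNegLogDerivCoeff f₂ g₂) :
    HasNegLogDerivCoeff (fun s => f₁ s * f₂ s) (g₁ + g₂) := by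
  intro s hs
  refine ⟨?_, (h₁ s hs).2.add (h₂ s hs).2⟩
  rw [LSeries_add (h₁ s hs).2 (h₂ s hs).2]
  refine ((h₁ s hs).1.mul (h₂ s hs).1).congr_deriv ?_
  ring

lemma hasNegLogDerivCoeff_LFunction {q : ℕ} [NeZero q] (χ : DirichletCharacter ℂ q) :
    HasNegLogDerivCoeff χ.LFunction
      (fun n => χ n * (ArithmeticFunction.vonMangoldt n : ℂ)) := by
  intro s hs
  have hs1 : s ≠ 1 := fun h => by simp [h] at hs
  refine ⟨?_, DirichletCharacter.LSeriesSummable_twist_vonMangoldt χ hs⟩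
  have h1 := DirichletCharacter.LSeries_twist_vonMangoldt_eq χ hs
  have h2 : χ.LFunction s ≠ 0 :=
    DirichletCharacter.LFunction_ne_zero_of_one_le_re χ (Or.inr hs1) hs.le
  have h3 : HasDerivAt χ.LFunction (deriv χ.LFunction s) s :=
    (DirichletCharacter.differentiableAt_LFunction χ s (Or.inl hs1)).hasDerivAt
  refine h3.congr_deriv ?_
  rw [← DirichletCharacter.deriv_LFunction_eq_deriv_LSeries χ hs,
    ← DirichletCharacter.LFunction_eq_LSeries χ hs] at h1
  have h4 : LSeries (fun n => χ n * (ArithmeticFunction.vonMangoldt n : ℂ)) s =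
    -deriv χ.LFunction s / χ.LFunction s := h1
  rw [h4]
  field_simp

open scoped ComplexOrder in
lemma HasNegLogDerivCoeff.iteratedDeriv_alternating {f : ℂ → ℂ} {g : ℕ → ℂ}
    (h : HasNegLogDerivCoeff f g) (hg : 0 ≤ g) (h2 : 0 ≤ f 2) (n : ℕ) :
    0 ≤ (-1) ^ n * iteratedDeriv n f 2 := by
  have habs : LSeries.abscissaOfAbsConv g ≤ (1 : ℝ) :=
    LSeries.abscissaOfAbsConv_le_of_forall_lt_LSeriesSummable fun y hy => (h y (by simpa using hy)).2
  have habs' : LSeries.abscissaOfAbsConv g < ((2 : ℝ) : EReal) :=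
    habs.trans_lt (by exact_mod_cast one_lt_two)
  have hopen : {s : ℂ | 1 < s.re} ∈ nhds (2 : ℂ) :=
    (isOpen_lt continuous_const Complex.continuous_re).mem_nhds (by simp)
  refine iteratedDeriv_alternating_of_deriv_eq (G := LSeries g) ?_ ?_ ?_ h2 ?_ n
  · rw [Complex.analyticAt_iff_eventually_differentiableAt]
    filter_upwards [hopen] with s hs using (h s hs).1.differentiableAt
  · exact LSeries_analyticOnNhd g 2 (by simpa using habs')
  · filter_upwards [hopen] with s hs using (h s hs).1.deriv
  · intro m
    have := LSeries.iteratedDeriv_alternating hg habs' m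
    simpa using this

lemma LFunctionTrivChar_one_two_re :
    (DirichletCharacter.LFunctionTrivChar 1 2) = ((Real.pi ^ 2 / 6 : ℝ) : ℂ) := by
  rw [DirichletCharacter.LFunctionTrivChar, DirichletCharacter.LFunction_modOne_eq,
    riemannZeta_two]
  push_cast; rfl

open scoped ComplexOrder in
/-- Landau–Estermann lower bound for the residue at `1`. -/
lemma exists_le_norm_apply_one : ∃ c : ℝ, 0 < c ∧ ∀ (P : ℂ → ℂ) (g : ℕ → ℂ) (K β : ℝ),
    Differentiable ℂ P → HasNegLogDerivCoeff P g →
    (∀ n : ℕ, 0 ≤ (ArithmeticFunction.vonMangoldt n : ℂ) + g n) →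
    ((1 / 64 : ℝ) : ℂ) ≤ P 2 → 1 ≤ K →
    (∀ s : ℂ, 1 / 2 ≤ s.re → ‖s‖ ≤ 4 → ‖P s‖ ≤ K) → 7 / 8 < β → β < 1 →
    (DirichletCharacter.LFunctionTrivChar 1 β * P β).re ≤ 0 →
    c * (1 - β) * K ^ (-(4 * (1 - β))) ≤ ‖P 1‖ := by
  obtain ⟨Z, hZ⟩ := (isCompact_sphere (2 : ℂ) (3 / 2)).exists_bound_of_continuousOn
    (DirichletCharacter.differentiable_LFunctionTrivChar₁ 1).continuous.continuousOn
  have hZ0 : 0 ≤ Z := (norm_nonneg _).trans (hZ (2 + (3 / 2 : ℝ)) (by simp))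
  set C0 : ℝ := 8 * (Z + 1) with hC0
  refine ⟨Real.exp (-2) * (128 * C0) ^ (-(1 / 2) : ℝ) / 128, by positivity, ?_⟩
  intro P g K β hP hLD hpos hP2 hK hPK hβ hβ1 hre
  set E : ℂ → ℂ := fun s => DirichletCharacter.LFunctionTrivChar₁ 1 s * P s with hE
  have hEd : Differentiable ℂ E := (DirichletCharacter.differentiable_LFunctionTrivChar₁ 1).mul hP
  have hE1 : E 1 = P 1 := by simp [hE]
  have hH : Differentiable ℂ (dslope E 1) := by
    rw [← differentiableOn_univ, Complex.differentiableOn_dslope Filter.univ_mem]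
    exact hEd.differentiableOn
  have hF : ∀ s, s ≠ 1 → DirichletCharacter.LFunctionTrivChar 1 s * P s =
      dslope E 1 s + P 1 * (s - 1)⁻¹ := by
    intro s hs
    have hs' : s - 1 ≠ 0 := sub_ne_zero.2 hs
    rw [dslope_of_ne _ hs, slope_def_field, hE1]
    simp only [hE, DirichletCharacter.LFunctionTrivChar₁, Function.update_of_ne hs]
    field_simp
    ring
  have hLD' : HasNegLogDerivCoeff (fun s => DirichletCharacter.LFunctionTrivChar 1 s * P s)
      ((fun n => (ArithmeticFunction.vonMangoldt n : ℂ)) + g) := by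
    have h1 := hasNegLogDerivCoeff_LFunction (1 : DirichletCharacter ℂ 1)
    have h2 : (fun n : ℕ => (1 : DirichletCharacter ℂ 1) n *
        (ArithmeticFunction.vonMangoldt n : ℂ)) =
        fun n : ℕ => (ArithmeticFunction.vonMangoldt n : ℂ) := by
      ext n
      have : (1 : DirichletCharacter ℂ 1) (n : ZMod 1) = 1 :=
        MulChar.one_apply (isUnit_of_subsingleton _)
      rw [this, one_mul]
    rw [h2] at h1
    exact h1.mul hLD
  have hpi : 1 ≤ Real.pi ^ 2 / 6 := by nlinarith [Real.pi_gt_three]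
  have hP2re : (1 / 64 : ℝ) ≤ (P 2).re ∧ (P 2).im = 0 := by
    rw [Complex.le_def] at hP2
    exact ⟨by simpa using hP2.1, by simpa using hP2.2.symm⟩
  have hF2 : (1 / 64 : ℝ) ≤ (DirichletCharacter.LFunctionTrivChar 1 2 * P 2).re := by
    rw [LFunctionTrivChar_one_two_re, Complex.re_ofReal_mul]
    nlinarith [hP2re.1]
  have halt := hLD'.iteratedDeriv_alternating (fun n => hpos n) (by
    rw [LFunctionTrivChar_one_two_re, Complex.le_def, Complex.re_ofReal_mul, Complex.im_ofReal_mul,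
      hP2re.2]
    simp only [Complex.zero_re, Complex.zero_im, mul_zero, and_true]
    nlinarith [hP2re.1])
  have hKH : ∀ s ∈ Metric.sphere (2 : ℂ) (3 / 2), ‖dslope E 1 s‖ ≤ 2 * (Z + 1) * K := by
    intro s hs
    have hs2 : ‖s - 2‖ = 3 / 2 := by simpa [dist_eq_norm] using hs
    have hn : 1 / 2 ≤ ‖s - 1‖ := by
      have := norm_sub_le (s - 1) 1
      rw [norm_one, show s - 1 - 1 = s - 2 by ring] at this
      linarith
    have hs1 : s ≠ 1 := fun h => by rw [h] at hn; norm_num at hn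
    have hsre : 1 / 2 ≤ s.re := by
      have := (abs_le.1 (Complex.abs_re_le_norm (s - 2))).1
      simp at this
      linarith
    have hs4 : ‖s‖ ≤ 4 := by
      have := norm_add_le (s - 2) 2
      rw [sub_add_cancel, hs2] at this
      norm_num at this
      linarith
    rw [dslope_of_ne _ hs1, slope_def_field, norm_div, div_le_iff₀ (by linarith), hE1]
    calc ‖E s - P 1‖ ≤ ‖E s‖ + ‖P 1‖ := norm_sub_le _ _
      _ ≤ Z * K + K := by
          refine add_le_add ?_ (hPK 1 (by norm_num) (by norm_num))
          simp only [hE]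
          rw [norm_mul]
          exact mul_le_mul (hZ s hs) (hPK s hsre hs4) (norm_nonneg _) hZ0
      _ = 2 * (Z + 1) * K * (1 / 2) := by ring
      _ ≤ _ := by gcongr
  set L : ℝ := Real.log (128 * C0 * K) with hL
  have hC0' : 8 ≤ C0 := by rw [hC0]; linarith
  have hCK : 1 ≤ 128 * C0 * K := by nlinarith
  have hL0 : 0 ≤ L := Real.log_nonneg hCK
  set M : ℕ := ⌈4 * L⌉₊ + 1 with hM
  have hM4 : 4 * L ≤ M := by
    rw [hM]; push_cast; linarith [Nat.le_ceil (4 * L)]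
  have hM5 : (M : ℝ) ≤ 4 * L + 2 := by
    rw [hM]; push_cast; linarith [Nat.ceil_lt_add_one (show 0 ≤ 4 * L by positivity)]
  have main := re_apply_two_le hH hF
    (fun m => by have := (Complex.le_def.1 (halt m)).1; simpa using this) hKH hβ hβ1
    (show 1 ≤ M by omega)
  have h34 : (3 / 4 : ℝ) ^ M ≤ (128 * C0 * K)⁻¹ := by
    have h1 : (3 / 4 : ℝ) ≤ Real.exp (-(1 / 4)) := by
      have := Real.add_one_le_exp (-(1 / 4) : ℝ)
      linarith
    calc (3 / 4 : ℝ) ^ M ≤ Real.exp (-(1 / 4)) ^ M := by gcongr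
      _ = Real.exp (M * (-(1 / 4))) := by rw [← Real.exp_nat_mul]
      _ ≤ Real.exp (-L) := Real.exp_le_exp.2 (by linarith)
      _ = _ := by rw [Real.exp_neg, hL, Real.exp_log (by linarith)]
  have h5 : 4 * (2 * (Z + 1) * K) * (3 / 4) ^ M ≤ 1 / 128 := by
    calc 4 * (2 * (Z + 1) * K) * (3 / 4) ^ M = C0 * K * (3 / 4) ^ M := by rw [hC0]; ring
      _ ≤ C0 * K * (128 * C0 * K)⁻¹ := by gcongr
      _ = 1 / 128 := by field_simp
  have h6 : 1 / 128 ≤ ‖P 1‖ * ((2 - β) ^ M / (1 - β)) := by linarith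
  have h7 : (2 - β) ^ M ≤ Real.exp 2 * ((128 * C0) ^ (1 / 2 : ℝ) * K ^ (4 * (1 - β))) := by
    have h1 : 2 - β ≤ Real.exp (1 - β) := by
      have := Real.add_one_le_exp (1 - β)
      linarith
    calc (2 - β) ^ M ≤ Real.exp (1 - β) ^ M := pow_le_pow_left₀ (by linarith) h1 _
      _ = Real.exp (M * (1 - β)) := by rw [← Real.exp_nat_mul]
      _ ≤ Real.exp (2 + L * (4 * (1 - β))) := Real.exp_le_exp.2 (by nlinarith)
      _ = Real.exp 2 * (128 * C0 * K) ^ (4 * (1 - β)) := by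
          rw [Real.exp_add, Real.rpow_def_of_pos (by linarith)]
      _ = Real.exp 2 * ((128 * C0) ^ (4 * (1 - β)) * K ^ (4 * (1 - β))) := by
          rw [Real.mul_rpow (by linarith) (by linarith)]
      _ ≤ _ := by
          gcongr
          · linarith
          · linarith
  rw [← mul_div_assoc, le_div_iff₀ (by linarith)] at h6
  have h8 := mul_le_mul_of_nonneg_left h7 (norm_nonneg (P 1))
  have hC0p : 0 < 128 * C0 := by linarith
  have hK0 : 0 < K := by linarith
  rw [Real.rpow_neg hC0p.le, Real.rpow_neg hK0.le, Real.exp_neg]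
  have e1 : 0 < (128 * C0) ^ (1 / 2 : ℝ) := by positivity
  have e2 : 0 < K ^ (4 * (1 - β)) := by positivity
  have e3 := Real.exp_pos 2
  rw [show (Real.exp 2)⁻¹ * ((128 * C0) ^ (1 / 2 : ℝ))⁻¹ / 128 * (1 - β) * (K ^ (4 * (1 - β)))⁻¹ =
    (1 / 128 * (1 - β)) / (Real.exp 2 * ((128 * C0) ^ (1 / 2 : ℝ) * K ^ (4 * (1 - β)))) by
    field_simp]
  rw [div_le_iff₀ (by positivity)]
  linarith

lemma eq_zero_or_one_or_neg_one_of_sq_eq_one {q : ℕ} {χ : DirichletCharacter ℂ q} (h : χ ^ 2 = 1)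
    (a : ZMod q) : χ a = 0 ∨ χ a = 1 ∨ χ a = -1 :=
  MulChar.isQuadratic_iff_sq_eq_one.2 h a

lemma conj_apply_of_sq_eq_one {q : ℕ} {χ : DirichletCharacter ℂ q} (h : χ ^ 2 = 1)
    (a : ZMod q) : (starRingEnd ℂ) (χ a) = χ a := by
  rcases eq_zero_or_one_or_neg_one_of_sq_eq_one h a with h | h | h <;> simp [h]

lemma conj_ofReal_cpow_ofReal {x : ℝ} (hx : 0 ≤ x) (y : ℝ) :
    (starRingEnd ℂ) ((x : ℂ) ^ (-(y : ℂ))) = (x : ℂ) ^ (-(y : ℂ)) := by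
  rw [← Complex.ofReal_neg, ← Complex.ofReal_cpow hx, Complex.conj_ofReal]

lemma im_LFunction_ofReal {q : ℕ} [NeZero q] {χ : DirichletCharacter ℂ q} (h : χ ^ 2 = 1)
    (hχ : χ ≠ 1) {σ : ℝ} (hσ : 0 < σ) : (χ.LFunction σ).im = 0 := by
  rw [← Complex.conj_eq_iff_im, LFunction_eq_sum_add_abelTail hχ 0 (by simpa using hσ)]
  simp only [Finset.range_zero, Finset.sum_empty, zero_add, abelTail]
  rw [Complex.conj_tsum]
  refine tsum_congr fun n => ?_
  rw [map_mul, map_sum, map_sub, conj_ofReal_cpow_ofReal (by positivity),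
    conj_ofReal_cpow_ofReal (by positivity)]
  simp only [conj_apply_of_sq_eq_one h]

lemma norm_LFunction_two_sub_one_le {q : ℕ} [NeZero q] (χ : DirichletCharacter ℂ q) :
    ‖χ.LFunction 2 - 1‖ ≤ 3 / 4 := by
  have hs := (χ.LSeriesSummable_of_one_lt_re (s := 2) (by simp)).hasSum
  have h1 := (hasSum_nat_add_iff' 2).2 hs
  have h2 := (hasSum_nat_add_iff' 2).2 hasSum_zeta_two
  rw [DirichletCharacter.LFunction_eq_LSeries χ (by simp), LSeries]
  have e : ∑ i ∈ Finset.range 2, LSeries.term (fun n => χ n) 2 i = 1 := by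
    simp [Finset.sum_range_succ, LSeries.term]
  rw [e] at h1
  rw [← h1.tsum_eq]
  refine (tsum_of_norm_bounded h2 fun n => ?_).trans ?_
  · rw [LSeries.term_of_ne_zero (by omega), norm_div]
    have : ‖((n + 2 : ℕ) : ℂ) ^ (2 : ℂ)‖ = ((n + 2 : ℕ) : ℝ) ^ 2 := by
      rw [show (2 : ℂ) = ((2 : ℕ) : ℂ) by norm_num, Complex.cpow_natCast, norm_pow,
        Complex.norm_natCast]
    rw [this]
    gcongr
    exact χ.norm_le_one _
  · simp [Finset.sum_range_succ]
    have := Real.pi_lt_d2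
    have := Real.pi_pos
    nlinarith

lemma re_LFunction_two {q : ℕ} [NeZero q] (χ : DirichletCharacter ℂ q) :
    1 / 4 ≤ (χ.LFunction 2).re := by
  have := (abs_le.1 ((Complex.abs_re_le_norm _).trans (norm_LFunction_two_sub_one_le χ))).1
  simp at this
  linarith

open scoped ComplexOrder in
lemma le_LFunction_two {q : ℕ} [NeZero q] {χ : DirichletCharacter ℂ q} (h : χ ^ 2 = 1)
    (hχ : χ ≠ 1) : ((1 / 4 : ℝ) : ℂ) ≤ χ.LFunction 2 := by
  rw [Complex.le_def]
  refine ⟨by simpa using re_LFunction_two χ, ?_⟩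
  have := im_LFunction_ofReal h hχ (σ := 2) (by norm_num)
  simpa using this.symm

lemma re_LFunction_pos {q : ℕ} [NeZero q] {χ : DirichletCharacter ℂ q} (h : χ ^ 2 = 1)
    (hχ : χ ≠ 1) {β : ℝ} (hβ : 0 < β) (hβ1 : β < 1)
    (hz : ∀ σ : ℝ, β ≤ σ → σ < 1 → χ.LFunction σ ≠ 0) : 0 < (χ.LFunction β).re := by
  by_contra! hcon
  have hc : ContinuousOn (fun σ : ℝ => (χ.LFunction σ).re) (Set.Icc β 2) :=
    (Complex.continuous_re.comp ((DirichletCharacter.differentiable_LFunction hχ).continuous.comp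
      Complex.continuous_ofReal)).continuousOn
  have h2 : 0 ≤ (χ.LFunction (2 : ℝ)).re := by
    have := re_LFunction_two χ
    push_cast; linarith
  obtain ⟨σ, hσ, h0⟩ := intermediate_value_Icc (by linarith) hc ⟨hcon, h2⟩
  have h00 : χ.LFunction σ = 0 := by
    apply Complex.ext
    · simpa using h0
    · simpa using im_LFunction_ofReal h hχ (hβ.trans_le hσ.1)
  rcases lt_or_ge σ 1 with h1 | h1
  · exact hz σ hσ.1 h1 h00
  · exact DirichletCharacter.LFunction_ne_zero_of_one_le_re χ (Or.inl hχ) (by simpa using h1) h00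

/-- The product of two characters of different moduli, as a character of the product modulus. -/
noncomputable def mulCharacter {q r : ℕ} (χ : DirichletCharacter ℂ q)
    (χ' : DirichletCharacter ℂ r) : DirichletCharacter ℂ (q * r) :=
  DirichletCharacter.changeLevel (dvd_mul_right q r) χ *
    DirichletCharacter.changeLevel (dvd_mul_left r q) χ'

lemma changeLevel_natCast {q r : ℕ} (h : q ∣ r) (χ : DirichletCharacter ℂ q) {n : ℕ}
    (hn : n.Coprime r) : DirichletCharacter.changeLevel h χ (n : ZMod r) = χ (n : ZMod q) := by
  have := DirichletCharacter.changeLevel_eq_cast_of_dvd χ h (ZMod.unitOfCoprime n hn)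
  rw [ZMod.coe_unitOfCoprime] at this
  rw [this, ZMod.cast_natCast h]

lemma apply_natCast_eq_zero {q : ℕ} (χ : DirichletCharacter ℂ q) {n : ℕ} (hn : ¬ n.Coprime q) :
    χ (n : ZMod q) = 0 :=
  MulChar.map_nonunit _ fun h => hn ((ZMod.isUnit_iff_coprime n q).1 h)

lemma mulCharacter_apply {q r : ℕ} (χ : DirichletCharacter ℂ q)
    (χ' : DirichletCharacter ℂ r) (n : ℕ) :
    mulCharacter χ χ' (n : ZMod (q * r)) = χ (n : ZMod q) * χ' (n : ZMod r) := by
  by_cases h : n.Coprime (q * r)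
  · rw [mulCharacter, MulChar.mul_apply, changeLevel_natCast _ _ h, changeLevel_natCast _ _ h]
  · rw [apply_natCast_eq_zero _ h]
    rw [Nat.coprime_mul_iff_right, not_and_or] at h
    rcases h with h | h
    · rw [apply_natCast_eq_zero _ h, zero_mul]
    · rw [apply_natCast_eq_zero _ h, mul_zero]

lemma mulCharacter_ne_one {q r : ℕ} [NeZero q] [NeZero r] {χ : DirichletCharacter ℂ q}
    {χ' : DirichletCharacter ℂ r} (h' : χ' ^ 2 = 1) (hχ : χ.IsPrimitive) (hχ' : χ'.IsPrimitive)
    (hqr : q ≠ r) : mulCharacter χ χ' ≠ 1 := by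
  intro h
  have h2 : DirichletCharacter.changeLevel (dvd_mul_left r q) χ' *
      DirichletCharacter.changeLevel (dvd_mul_left r q) χ' = 1 := by
    rw [← map_mul, ← sq, h', map_one]
  have h3 : DirichletCharacter.changeLevel (dvd_mul_right q r) χ =
      DirichletCharacter.changeLevel (dvd_mul_left r q) χ' := by
    rw [mulCharacter] at h
    exact mul_right_cancel (h.trans h2.symm)
  have h4 := congrArg DirichletCharacter.conductor h3
  rw [DirichletCharacter.conductor_changeLevel, DirichletCharacter.conductor_changeLevel,
    hχ, hχ'] at h4
  exact hqr h4

lemma mulCharacter_sq {q r : ℕ} {χ : DirichletCharacter ℂ q} {χ' : DirichletCharacter ℂ r}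
    (h : χ ^ 2 = 1) (h' : χ' ^ 2 = 1) : mulCharacter χ χ' ^ 2 = 1 := by
  rw [mulCharacter, mul_pow, ← map_pow, ← map_pow, h, h', map_one, map_one, mul_one]

open scoped ComplexOrder in
lemma quarter_pow_three_le {a b c : ℂ} (ha : ((1 / 4 : ℝ) : ℂ) ≤ a) (hb : ((1 / 4 : ℝ) : ℂ) ≤ b)
    (hc : ((1 / 4 : ℝ) : ℂ) ≤ c) : ((1 / 64 : ℝ) : ℂ) ≤ a * (b * c) := by
  have h4 : (0 : ℂ) ≤ ((1 / 4 : ℝ) : ℂ) := by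
    rw [Complex.zero_le_real]; norm_num
  have hb0 := h4.trans hb
  have h1 := mul_le_mul hb hc h4 hb0
  have h2 := mul_le_mul ha h1 (mul_nonneg h4 h4) (h4.trans ha)
  refine le_trans (le_of_eq ?_) h2
  push_cast; norm_num

open scoped ComplexOrder in
lemma vonMangoldt_add_mul_nonneg {n : ℕ} {a b : ℂ} (ha : a = 0 ∨ a = 1 ∨ a = -1)
    (hb : b = 0 ∨ b = 1 ∨ b = -1) : 0 ≤ (ArithmeticFunction.vonMangoldt n : ℂ) +
      (a * (ArithmeticFunction.vonMangoldt n : ℂ) + (b * (ArithmeticFunction.vonMangoldt n : ℂ) +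
        (a * b) * (ArithmeticFunction.vonMangoldt n : ℂ))) := by
  have h0 : (0 : ℂ) ≤ (ArithmeticFunction.vonMangoldt n : ℂ) := by
    rw [Complex.zero_le_real]; exact ArithmeticFunction.vonMangoldt_nonneg
  have e : (ArithmeticFunction.vonMangoldt n : ℂ) +
      (a * (ArithmeticFunction.vonMangoldt n : ℂ) + (b * (ArithmeticFunction.vonMangoldt n : ℂ) +
        (a * b) * (ArithmeticFunction.vonMangoldt n : ℂ))) =
      (1 + a) * (1 + b) * (ArithmeticFunction.vonMangoldt n : ℂ) := by ring
  rw [e]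
  have h1 : ∀ c : ℂ, c = 0 ∨ c = 1 ∨ c = -1 → 0 ≤ 1 + c := by
    rintro c (rfl | rfl | rfl)
    · simp
    · norm_num
    · simp
  exact mul_nonneg (mul_nonneg (h1 a ha) (h1 b hb)) h0

lemma exists_re_LFunctionTrivChar_one_mul_neg {δ : ℝ} (hδ : 0 < δ) : ∃ β : ℝ, 1 - δ < β ∧ β < 1 ∧
    ∀ y : ℝ, 0 < y → (DirichletCharacter.LFunctionTrivChar 1 β * y).re ≤ 0 := by
  have h1 : Filter.Tendsto (fun σ : ℝ => (DirichletCharacter.LFunctionTrivChar₁ 1 σ).re)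
      (nhds 1) (nhds 1) := by
    have hc : Continuous fun σ : ℝ => (DirichletCharacter.LFunctionTrivChar₁ 1 σ).re :=
      Complex.continuous_re.comp
        ((DirichletCharacter.differentiable_LFunctionTrivChar₁ 1).continuous.comp
          Complex.continuous_ofReal)
    have := hc.tendsto 1
    simpa using this
  have h2 : ∀ᶠ σ : ℝ in nhds 1, 0 < (DirichletCharacter.LFunctionTrivChar₁ 1 σ).re :=
    h1.eventually (lt_mem_nhds one_pos)
  obtain ⟨e, he, h3⟩ := Metric.eventually_nhds_iff.1 h2
  set β : ℝ := 1 - min δ e / 2 with hβ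
  have hm : 0 < min δ e := lt_min hδ he
  have hm1 := min_le_left δ e
  have hm2 := min_le_right δ e
  refine ⟨β, by linarith, by linarith, fun y hy => ?_⟩
  have h4 := h3 (y := β) (by rw [Real.dist_eq, abs_lt]; constructor <;> linarith)
  have hβ1 : (β : ℂ) ≠ 1 := by
    intro h
    have : β = 1 := by exact_mod_cast h
    linarith
  rw [DirichletCharacter.LFunctionTrivChar₁, Function.update_of_ne hβ1] at h4
  rw [Complex.re_mul_ofReal]
  have e1 : ((β : ℂ) - 1) = ((β - 1 : ℝ) : ℂ) := by push_cast; rfl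
  rw [e1, Complex.re_ofReal_mul] at h4
  have : (DirichletCharacter.LFunctionTrivChar 1 β).re < 0 := by
    by_contra! h
    nlinarith
  nlinarith

open scoped ComplexOrder in
/-- **Siegel's theorem** for primitive real characters. -/
theorem exists_le_norm_LFunction_one {ε : ℝ} (hε : 0 < ε) (hε1 : ε ≤ 1) : ∃ c : ℝ, 0 < c ∧
    ∀ (q : ℕ) [NeZero q] (χ : DirichletCharacter ℂ q), χ.IsPrimitive → χ ^ 2 = 1 → χ ≠ 1 →
      c * (q : ℝ) ^ (-ε) ≤ ‖χ.LFunction 1‖ := by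
  obtain ⟨C, hC, hCL⟩ := exists_norm_LFunction_le_mul
  obtain ⟨C', hC', hCL'⟩ := exists_norm_LFunction_le_rpow (ε := ε / 2) (by linarith) (by linarith)
  obtain ⟨c, hc, hmain⟩ := exists_le_norm_apply_one
  set δ : ℝ := ε / 16 with hδ
  have hbd : ∀ (q : ℕ) [NeZero q] (χ : DirichletCharacter ℂ q), χ ≠ 1 → ∀ s : ℂ,
      1 / 2 ≤ s.re → ‖s‖ ≤ 4 → ‖χ.LFunction s‖ ≤ 4 * (C + 1) * q := by
    intro q _ χ hχ s hs hs4
    refine (hCL q χ hχ s hs).trans ?_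
    calc C * q * ‖s‖ ≤ (C + 1) * q * 4 := by gcongr; linarith
      _ = _ := by ring
  by_cases hex : ∃ (r : ℕ) (_ : NeZero r) (ψ : DirichletCharacter ℂ r) (β : ℝ), ψ.IsPrimitive ∧
      ψ ^ 2 = 1 ∧ ψ ≠ 1 ∧ 1 - δ < β ∧ β < 1 ∧ ψ.LFunction β = 0
  · obtain ⟨r, _, ψ, β, hψp, hψ2, hψ1, hβ, hβ1, hψ0⟩ := hex
    have hr1 : (1 : ℝ) ≤ r := by exact_mod_cast NeZero.pos r
    obtain ⟨⟨χ₀, hχ₀⟩, hmin⟩ := @Finite.exists_min {χ : DirichletCharacter ℂ r // χ ≠ 1} _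
      _ ⟨⟨ψ, hψ1⟩⟩ _ fun χ => ‖χ.1.LFunction 1‖
    have hχ₀0 : 0 < ‖χ₀.LFunction 1‖ :=
      norm_pos_iff.2 (DirichletCharacter.LFunction_apply_one_ne_zero hχ₀)
    set κ : ℝ := 4 * (1 - β) with hκ
    set D : ℝ := (4 * (C + 1)) ^ 3 * r ^ 2 with hD
    have hD0 : 0 < D := by positivity
    have hD1 : 1 ≤ D := by
      rw [hD]
      have h1 : (1 : ℝ) ≤ (4 * (C + 1)) ^ 3 := one_le_pow₀ (by linarith)
      have h2 : (1 : ℝ) ≤ (r : ℝ) ^ 2 := one_le_pow₀ hr1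
      nlinarith
    set c₁ : ℝ := c * (1 - β) * D ^ (-κ) / (4 * (C + 1) * r * (C' * (2 * r) ^ (ε / 2))) with hc₁
    have hc₁0 : 0 < c₁ := by
      have : 0 < 1 - β := by linarith
      positivity
    refine ⟨min c₁ ‖χ₀.LFunction 1‖, lt_min hc₁0 hχ₀0, ?_⟩
    intro q _ χ hχp hχ2 hχ1
    have hq1 : (1 : ℝ) ≤ q := by exact_mod_cast NeZero.pos q
    by_cases hqr : q = r
    · subst hqr
      have h1 : (q : ℝ) ^ (-ε) ≤ 1 := Real.rpow_le_one_of_one_le_of_nonpos hq1 (by linarith)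
      have h2 := hmin ⟨χ, hχ1⟩
      calc min c₁ ‖χ₀.LFunction 1‖ * (q : ℝ) ^ (-ε) ≤ ‖χ₀.LFunction 1‖ * 1 :=
            mul_le_mul (min_le_right _ _) h1 (by positivity) hχ₀0.le
        _ ≤ _ := by rw [mul_one]; exact h2
    · set ξ := mulCharacter χ ψ with hξ
      have hξ1 : ξ ≠ 1 := mulCharacter_ne_one hψ2 hχp hψp hqr
      have hξ2 : ξ ^ 2 = 1 := mulCharacter_sq hχ2 hψ2
      have hqrne : NeZero (q * r) := ⟨mul_ne_zero (NeZero.ne q) (NeZero.ne r)⟩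
      have hq0 : (0 : ℝ) < q := by linarith
      have hr0 : (0 : ℝ) < r := by linarith
      have key := hmain (fun s => χ.LFunction s * (ψ.LFunction s * ξ.LFunction s)) _
        (D * q ^ 2) β
        ((DirichletCharacter.differentiable_LFunction hχ1).mul
          ((DirichletCharacter.differentiable_LFunction hψ1).mul
          (DirichletCharacter.differentiable_LFunction hξ1)))
        ((hasNegLogDerivCoeff_LFunction χ).mul
          ((hasNegLogDerivCoeff_LFunction ψ).mul (hasNegLogDerivCoeff_LFunction ξ)))
        (fun n => by
          simp only [Pi.add_apply]
          rw [hξ, mulCharacter_apply]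
          exact vonMangoldt_add_mul_nonneg (eq_zero_or_one_or_neg_one_of_sq_eq_one hχ2 _)
            (eq_zero_or_one_or_neg_one_of_sq_eq_one hψ2 _))
        (quarter_pow_three_le (le_LFunction_two hχ2 hχ1) (le_LFunction_two hψ2 hψ1)
          (le_LFunction_two hξ2 hξ1))
        (by
          have h2 : (1 : ℝ) ≤ (q : ℝ) ^ 2 := one_le_pow₀ hq1
          nlinarith)
        (fun s hs hs4 => by
          rw [norm_mul, norm_mul]
          calc ‖χ.LFunction s‖ * (‖ψ.LFunction s‖ * ‖ξ.LFunction s‖) ≤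
                (4 * (C + 1) * q) * ((4 * (C + 1) * r) * (4 * (C + 1) * (q * r : ℕ))) := by
                gcongr
                · exact hbd q χ hχ1 s hs hs4
                · exact hbd r ψ hψ1 s hs hs4
                · exact hbd (q * r) ξ hξ1 s hs hs4
            _ = D * q ^ 2 := by rw [hD]; push_cast; ring)
        (by linarith) hβ1 (by simp [hψ0])
      simp only [norm_mul] at key
      have hψn := hbd r ψ hψ1 1 (by norm_num) (by norm_num)
      have hξn : ‖ξ.LFunction 1‖ ≤ C' * (2 * r) ^ (ε / 2) * q ^ (ε / 2) := by
        refine (hCL' (q * r) ξ hξ1 1 (by simp; linarith) (by simp)).trans (le_of_eq ?_)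
        rw [mul_assoc, ← Real.mul_rpow (by positivity) (by positivity)]
        congr 2
        simp
        ring
      have h3 : D ^ (-κ) * (q : ℝ) ^ (-(ε / 2)) ≤ (D * q ^ 2) ^ (-κ) := by
        rw [Real.mul_rpow hD0.le (by positivity), ← Real.rpow_natCast, ← Real.rpow_mul hq0.le]
        gcongr
        push_cast; linarith
      have h4 : c * (1 - β) * (D ^ (-κ) * (q : ℝ) ^ (-(ε / 2))) ≤ ‖χ.LFunction 1‖ *
          (4 * (C + 1) * r * (C' * (2 * r) ^ (ε / 2) * q ^ (ε / 2))) := by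
        calc c * (1 - β) * (D ^ (-κ) * (q : ℝ) ^ (-(ε / 2))) ≤
              c * (1 - β) * (D * q ^ 2) ^ (-κ) :=
              mul_le_mul_of_nonneg_left h3 (mul_nonneg hc.le (by linarith))
          _ ≤ ‖χ.LFunction 1‖ * (‖ψ.LFunction 1‖ * ‖ξ.LFunction 1‖) := key
          _ ≤ _ := by gcongr
      have h5 : (q : ℝ) ^ (-ε) = (q : ℝ) ^ (-(ε / 2)) / q ^ (ε / 2) := by
        rw [← Real.rpow_sub hq0]; congr 1; ring
      calc min c₁ ‖χ₀.LFunction 1‖ * (q : ℝ) ^ (-ε) ≤ c₁ * (q : ℝ) ^ (-ε) := by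
            gcongr; exact min_le_left _ _
        _ = (c * (1 - β) * (D ^ (-κ) * (q : ℝ) ^ (-(ε / 2)))) /
            (4 * (C + 1) * r * (C' * (2 * r) ^ (ε / 2) * q ^ (ε / 2))) := by
            rw [hc₁, h5]
            field_simp
        _ ≤ _ := by
            rw [div_le_iff₀ (by positivity)]
            exact h4
  · push Not at hex
    obtain ⟨β, hβ, hβ1, hneg⟩ := exists_re_LFunctionTrivChar_one_mul_neg (δ := δ) (by positivity)
    set κ : ℝ := 4 * (1 - β) with hκ
    have h1β : 0 < 1 - β := by linarith
    refine ⟨c * (1 - β) * (4 * (C + 1)) ^ (-κ), by positivity, ?_⟩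
    intro q _ χ hχp hχ2 hχ1
    have hq1 : (1 : ℝ) ≤ q := by exact_mod_cast NeZero.pos q
    have hq0 : (0 : ℝ) < q := by linarith
    have hpos : 0 < (χ.LFunction β).re := re_LFunction_pos hχ2 hχ1 (by linarith) hβ1
      fun σ hσ hσ1 => hex q inferInstance χ σ hχp hχ2 hχ1 (by linarith) hσ1
    have him := im_LFunction_ofReal hχ2 hχ1 (σ := β) (by linarith)
    have hreal : χ.LFunction β = (((χ.LFunction β).re : ℝ) : ℂ) := by
      apply Complex.ext <;> simp [him]
    have key := hmain χ.LFunction _ (4 * (C + 1) * q) β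
      (DirichletCharacter.differentiable_LFunction hχ1) (hasNegLogDerivCoeff_LFunction χ)
      (fun n => by
        have := vonMangoldt_add_mul_nonneg (n := n) (b := 0)
          (eq_zero_or_one_or_neg_one_of_sq_eq_one hχ2 n) (Or.inl rfl)
        simpa using this)
      (le_trans (by rw [Complex.real_le_real]; norm_num) (le_LFunction_two hχ2 hχ1))
      (by nlinarith)
      (fun s hs hs4 => hbd q χ hχ1 s hs hs4) (by linarith) hβ1
      (by rw [hreal]; exact hneg _ hpos)
    refine le_trans ?_ key
    rw [Real.mul_rpow (by positivity) hq0.le, mul_assoc (c * (1 - β))]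
    gcongr
    linarith

/-- The three-four-one inequality, solved for `L(1 + x + it, χ)`. -/
theorem le_norm_LFunction_pow_four {q : ℕ} [NeZero q] (χ : DirichletCharacter ℂ q) {t x W V : ℝ}
    (hx : 0 < x) (h0 : ‖DirichletCharacter.LFunctionTrivChar q (1 + x)‖ ≤ W)
    (h1 : ‖(χ ^ 2).LFunction (1 + x + 2 * Complex.I * t)‖ ≤ V) :
    1 ≤ W ^ 3 * ‖χ.LFunction (1 + x + Complex.I * t)‖ ^ 4 * V := by
  have h := DirichletCharacter.norm_LFunction_product_ge_one χ hx t
  rw [norm_mul, norm_mul, norm_pow, norm_pow] at h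
  refine h.le.trans ?_
  have hV : 0 ≤ V := (norm_nonneg _).trans h1
  have hW : 0 ≤ W := (norm_nonneg _).trans h0
  gcongr

theorem norm_sub_le_of_norm_deriv_le {f : ℂ → ℂ} (hf : Differentiable ℂ f) {s₁ s₂ : ℂ} {M : ℝ}
    (hM : ∀ s ∈ segment ℝ s₁ s₂, ‖deriv f s‖ ≤ M) : ‖f s₂ - f s₁‖ ≤ M * ‖s₂ - s₁‖ :=
  (convex_segment s₁ s₂).norm_image_sub_le_of_norm_deriv_le (fun s _ => hf s) hM
    (left_mem_segment ℝ s₁ s₂) (right_mem_segment ℝ s₁ s₂)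

theorem re_im_of_mem_segment {s₁ s₂ s : ℂ} (hs : s ∈ segment ℝ s₁ s₂) :
    s.re ∈ segment ℝ s₁.re s₂.re ∧ s.im ∈ segment ℝ s₁.im s₂.im := by
  obtain ⟨a, b, ha, hb, hab, rfl⟩ := hs
  exact ⟨⟨a, b, ha, hb, hab, by simp⟩, ⟨a, b, ha, hb, hab, by simp⟩⟩

/-- A lower bound for `L(s, χ)` near the line `re s = 1` from upper bounds for `L(s, χ²)` and the
derivative. -/
theorem le_norm_LFunction_of_bounds {q : ℕ} [NeZero q] {χ : DirichletCharacter ℂ q} (hχ : χ ≠ 1)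
    {U t : ℝ} (hU : 1 ≤ U)
    (h0 : ∀ x : ℝ, 0 < x → x ≤ 1 → ‖DirichletCharacter.LFunctionTrivChar q (1 + x)‖ ≤ U / x)
    (h1 : ∀ x : ℝ, 0 < x → x ≤ 1 → ‖(χ ^ 2).LFunction (1 + x + 2 * Complex.I * t)‖ ≤ U)
    (h2 : ∀ σ : ℝ, 1 - 1 / (64 * U ^ 8) ≤ σ → σ ≤ 2 →
      ‖deriv χ.LFunction (σ + t * Complex.I)‖ ≤ U) {σ : ℝ} (hσ : 1 - 1 / (64 * U ^ 8) ≤ σ)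
    (hσ2 : σ ≤ 2) : 1 / (64 * U ^ 7) ≤ ‖χ.LFunction (σ + t * Complex.I)‖ := by
  have hU0 : 0 < U := by linarith
  have base : ∀ x : ℝ, 0 < x → x ≤ 1 →
      x ^ 3 ≤ U ^ 4 * ‖χ.LFunction ((1 + x : ℝ) + t * Complex.I)‖ ^ 4 := by
    intro x hx hx1
    have h := le_norm_LFunction_pow_four χ hx (h0 x hx hx1) (h1 x hx hx1)
    rw [show ((1 + x : ℝ) : ℂ) + t * Complex.I = 1 + x + Complex.I * t by push_cast; ring]
    rw [div_pow, div_mul_eq_mul_div, div_mul_eq_mul_div, le_div_iff₀ (by positivity)] at h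
    nlinarith
  set x₀ : ℝ := 1 / (32 * U ^ 8) with hx₀
  have hx₀0 : 0 < x₀ := by positivity
  have hU8 : (1 : ℝ) ≤ U ^ 8 := one_le_pow₀ hU
  have hx₀1 : x₀ ≤ 1 := by
    rw [hx₀, div_le_one (by positivity)]; linarith
  have hhalf : 1 / (64 * U ^ 8) = x₀ / 2 := by rw [hx₀]; field_simp; norm_num
  rcases le_or_gt σ (1 + x₀) with h | h
  · have hb := base x₀ hx₀0 hx₀1
    have hlow : 2 * x₀ * U ≤ ‖χ.LFunction ((1 + x₀ : ℝ) + t * Complex.I)‖ := by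
      refine le_of_pow_le_pow_left₀ (n := 4) (by norm_num) (norm_nonneg _) ?_
      have e : (2 * x₀ * U) ^ 4 * U ^ 4 = x₀ ^ 3 / 2 := by
        rw [hx₀]; field_simp; norm_num
      have hU4 : 0 < U ^ 4 := by positivity
      refine le_of_mul_le_mul_right ?_ hU4
      rw [e]
      have : 0 < x₀ ^ 3 := by positivity
      linarith
    have hd : ‖χ.LFunction ((1 + x₀ : ℝ) + t * Complex.I) - χ.LFunction (σ + t * Complex.I)‖ ≤
        U * (3 / 2 * x₀) := by
      refine (norm_sub_le_of_norm_deriv_le (M := U)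
        (DirichletCharacter.differentiable_LFunction hχ) fun s hs => ?_).trans ?_
      · obtain ⟨hre, him⟩ := re_im_of_mem_segment hs
        have e1 : s.im = t := by simpa using him
        have e2 : s = (s.re : ℂ) + t * Complex.I := by
          rw [← e1]; exact (Complex.re_add_im s).symm
        simp only [Complex.add_re, Complex.ofReal_re, Complex.mul_re, Complex.I_re,
          Complex.ofReal_im, Complex.I_im, mul_zero, zero_mul, sub_zero, add_zero] at hre
        rw [segment_eq_Icc h] at hre
        rw [e2]
        exact h2 _ (hσ.trans hre.1) (hre.2.trans (by linarith))
      · gcongr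
        rw [show ((1 + x₀ : ℝ) : ℂ) + t * Complex.I - (σ + t * Complex.I) =
          ((1 + x₀ - σ : ℝ) : ℂ) by push_cast; ring, Complex.norm_real, Real.norm_eq_abs,
          abs_of_nonneg (by linarith)]
        linarith
    have h3 : 1 / (64 * U ^ 7) = x₀ * U / 2 := by rw [hx₀]; field_simp; norm_num
    rw [h3]
    have := norm_sub_norm_le (χ.LFunction ((1 + x₀ : ℝ) + t * Complex.I))
      (χ.LFunction (σ + t * Complex.I))
    linarith
  · have hb := base (σ - 1) (by linarith) (by linarith)
    rw [show 1 + (σ - 1) = σ by ring] at hb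
    refine le_of_pow_le_pow_left₀ (n := 4) (by norm_num) (norm_nonneg _) ?_
    have h3 : x₀ ^ 3 ≤ (σ - 1) ^ 3 := by gcongr; linarith
    have hU4 : 0 < U ^ 4 := by positivity
    refine le_of_mul_le_mul_right ?_ hU4
    have e : (1 / (64 * U ^ 7)) ^ 4 * U ^ 4 ≤ x₀ ^ 3 := by
      rw [hx₀, div_pow, div_pow, div_mul_eq_mul_div, div_le_div_iff₀ (by positivity)
        (by positivity)]
      ring_nf
      have : 0 < U ^ 28 := by positivity
      nlinarith
    linarith

/-- A lower bound for `L(s, χ)` near `s = 1` from a lower bound for `L(1, χ)`. -/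
theorem le_norm_LFunction_of_le_norm_LFunction_one {q : ℕ} [NeZero q] {χ : DirichletCharacter ℂ q}
    (hχ : χ ≠ 1) (hχ2 : χ ^ 2 = 1) {U : ℝ} (hU : 1 ≤ U) {s : ℂ}
    (h0 : ∀ x : ℝ, 0 < x → x ≤ 1 → ‖DirichletCharacter.LFunctionTrivChar q (1 + x)‖ ≤ U / x)
    (h1 : ∀ x : ℝ, 0 < x → x ≤ 1 →
      ‖DirichletCharacter.LFunctionTrivChar q (1 + x + 2 * Complex.I * s.im)‖ ≤ U * (1 + 1 / x))
    (h2 : ∀ z : ℂ, 1 - 1 / (4 * U ^ 2) ≤ z.re → z.re ≤ 2 → |z.im| ≤ |s.im| →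
      ‖deriv χ.LFunction z‖ ≤ U)
    (h3 : 1 / U ≤ ‖χ.LFunction 1‖)
    (hσ : 1 - 1 / (4 * U ^ 2) ≤ s.re) (hσ2 : s.re ≤ 2) (ht : |s.im| ≤ 1 / (4 * U ^ 2)) :
    1 / (8 * U ^ 3) ≤ ‖χ.LFunction s‖ := by
  have hU0 : 0 < U := by linarith
  have hU2 : 1 ≤ U ^ 2 := one_le_pow₀ hU
  have hU3 : U ≤ U ^ 3 := le_self_pow₀ hU (by norm_num)
  rcases le_or_gt s.re (1 + 1 / (4 * U ^ 2)) with h | h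
  · have hle : ‖(1 : ℂ) - s‖ ≤ 1 / (2 * U ^ 2) := by
      refine (Complex.norm_le_abs_re_add_abs_im _).trans ?_
      simp only [Complex.sub_re, Complex.one_re, Complex.sub_im, Complex.one_im, zero_sub, abs_neg]
      have : |1 - s.re| ≤ 1 / (4 * U ^ 2) := by rw [abs_le]; constructor <;> linarith
      have e : 1 / (2 * U ^ 2) = 1 / (4 * U ^ 2) + 1 / (4 * U ^ 2) := by field_simp; norm_num
      linarith
    have hd : ‖χ.LFunction 1 - χ.LFunction s‖ ≤ U * (1 / (2 * U ^ 2)) := by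
      refine (norm_sub_le_of_norm_deriv_le (M := U)
        (DirichletCharacter.differentiable_LFunction hχ) fun z hz => ?_).trans (by gcongr)
      obtain ⟨hre, him⟩ := re_im_of_mem_segment hz
      rw [segment_eq_uIcc] at hre him
      have e1 := Set.uIcc_subset_Icc (a₂ := 1 - 1 / (4 * U ^ 2)) (b₂ := 2) ⟨hσ, hσ2⟩
        ⟨by simp; positivity, by simp⟩ hre
      refine h2 z e1.1 e1.2 ?_
      have := Set.abs_sub_right_of_mem_uIcc him
      simpa using this
    have := norm_sub_norm_le (χ.LFunction 1) (χ.LFunction s)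
    have e : U * (1 / (2 * U ^ 2)) = 1 / U / 2 := by field_simp
    have e2 : 1 / (8 * U ^ 3) ≤ 1 / U / 2 := by
      rw [div_div]
      exact one_div_le_one_div_of_le (by positivity) (by linarith)
    linarith
  · set x := s.re - 1 with hx
    have hxl : 1 / (4 * U ^ 2) < x := by linarith
    have hx0 : 0 < x := lt_trans (by positivity) hxl
    have hx1 : x ≤ 1 := by linarith
    have h := le_norm_LFunction_pow_four χ hx0 (h0 x hx0 hx1)
      (by simpa only [hχ2] using h1 x hx0 hx1)
    rw [show (1 : ℂ) + x + Complex.I * s.im = s by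
      apply Complex.ext <;> simp [hx]] at h
    have h5 : 1 / x ≥ 1 := by rw [ge_iff_le, le_div_iff₀ hx0]; linarith
    have h6 : 1 ≤ (U / x) ^ 3 * ‖χ.LFunction s‖ ^ 4 * (U * (2 / x)) := by
      refine h.trans ?_
      gcongr
      have : 2 / x = 1 / x + 1 / x := by ring
      linarith
    have h7 : x / (2 * U) ≤ ‖χ.LFunction s‖ := by
      refine le_of_pow_le_pow_left₀ (n := 4) (by norm_num) (norm_nonneg _) ?_
      rw [div_pow, div_le_iff₀ (by positivity)]
      have e : (U / x) ^ 3 * ‖χ.LFunction s‖ ^ 4 * (U * (2 / x)) =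
        2 * U ^ 4 * ‖χ.LFunction s‖ ^ 4 / x ^ 4 := by field_simp
      rw [e, le_div_iff₀ (by positivity)] at h6
      have : 0 ≤ U ^ 4 * ‖χ.LFunction s‖ ^ 4 := by positivity
      nlinarith
    refine le_trans ?_ h7
    rw [div_le_div_iff₀ (by positivity) (by positivity)]
    rw [div_lt_iff₀ (by positivity)] at hxl
    have : 0 < U := hU0
    nlinarith

set_option maxHeartbeats 1000000 in
/-- A quantitative zero-free region for primitive characters. -/
theorem exists_le_norm_LFunction {ε : ℝ} (hε : 0 < ε) (hε1 : ε ≤ 1) : ∃ c : ℝ, 0 < c ∧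
    ∀ (q : ℕ) [NeZero q] (χ : DirichletCharacter ℂ q), χ.IsPrimitive → χ ≠ 1 → ∀ s : ℂ,
      1 - c * (q * (|s.im| + 2)) ^ (-ε) ≤ s.re → s.re ≤ 2 →
      c * (q * (|s.im| + 2)) ^ (-ε) ≤ ‖χ.LFunction s‖ := by
  obtain ⟨δ, hδ⟩ : ∃ z : ℝ, z = ε / 24 := ⟨_, rfl⟩
  have hδ0 : 0 < δ := by rw [hδ]; positivity
  have hδ1 : δ ≤ 1 := by linarith
  obtain ⟨C₁, hC₁, H₁⟩ := exists_norm_LFunction_le_rpow hδ0 hδ1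
  obtain ⟨C₂, hC₂, H₂⟩ := exists_norm_deriv_LFunction_le_rpow hδ0 hδ1
  obtain ⟨C₃, hC₃, H₃⟩ := exists_norm_LFunctionTrivChar_le_rpow hδ0
  obtain ⟨c₄, hc₄, H₄⟩ := exists_le_norm_LFunction_one hδ0 hδ1
  obtain ⟨K, hK⟩ : ∃ z : ℝ, z = 1 + 2 * C₁ + C₂ + 2 * C₃ + 1 / c₄ + 8 / δ := ⟨_, rfl⟩
  have hKC₁ : 2 * C₁ ≤ K := by have : 0 < 1 / c₄ := by positivity
                               have : 0 < 8 / δ := by positivity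
                               linarith
  have hKC₂ : C₂ ≤ K := by have : 0 < 1 / c₄ := by positivity
                           have : 0 < 8 / δ := by positivity
                           linarith
  have hKC₃ : 2 * C₃ ≤ K := by have : 0 < 1 / c₄ := by positivity
                               have : 0 < 8 / δ := by positivity
                               linarith
  have hKc₄ : 1 / c₄ ≤ K := by have : 0 < 8 / δ := by positivity
                               linarith
  have hKδ : 8 / δ ≤ K := by have : 0 < 1 / c₄ := by positivity
                             linarith
  have hK1 : 1 ≤ K := by have : 0 < 1 / c₄ := by positivity
                         have : 0 < 8 / δ := by positivity
                         linarith
  refine ⟨1 / (64 * (3 * K ^ 3) ^ 8), by positivity, ?_⟩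
  intro q _ χ hχp hχ1 s hs hs2
  have hq1 : (1 : ℝ) ≤ q := by exact_mod_cast NeZero.pos q
  obtain ⟨X, hX⟩ : ∃ z : ℝ, z = q * (|s.im| + 2) := ⟨_, rfl⟩
  rw [← hX] at hs ⊢
  have hX1 : 1 ≤ X := by
    have := abs_nonneg s.im
    rw [hX]; nlinarith
  have hX0 : 0 < X := by linarith
  obtain ⟨P, hP⟩ : ∃ z : ℝ, z = X ^ δ := ⟨_, rfl⟩
  have hP1 : 1 ≤ P := hP ▸ Real.one_le_rpow hX1 hδ0.le
  have hP0 : 0 < P := by linarith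
  have hPε : X ^ (-ε) = 1 / P ^ 24 := by
    rw [hP, ← Real.rpow_natCast, ← Real.rpow_mul hX0.le, Real.rpow_neg hX0.le, one_div]
    congr 2
    rw [hδ]; push_cast; ring
  obtain ⟨G, hG⟩ : ∃ z : ℝ, z = K * P := ⟨_, rfl⟩
  have hG1 : 1 ≤ G := hG ▸ one_le_mul_of_one_le_of_one_le hK1 hP1
  have hG0 : 0 < G := by linarith
  obtain ⟨U, hU⟩ : ∃ z : ℝ, z = 3 * G ^ 3 := ⟨_, rfl⟩
  have hGU : G ≤ U := by
    have : G ≤ G ^ 3 := le_self_pow₀ hG1 (by norm_num)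
    linarith
  have hU1 : 1 ≤ U := hG1.trans hGU
  have hU0 : 0 < U := by linarith
  have hcX : 1 / (64 * (3 * K ^ 3) ^ 8) * X ^ (-ε) = 1 / (64 * U ^ 8) := by
    rw [hPε, hU, hG]
    field_simp
  rw [hcX] at hs ⊢
  have hU78 : 1 / (64 * U ^ 8) ≤ 1 / (64 * U ^ 7) := by
    apply one_div_le_one_div_of_le (by positivity)
    have : U ^ 7 ≤ U ^ 8 := pow_le_pow_right₀ hU1 (by norm_num)
    linarith
  have mono : ∀ y : ℝ, 0 ≤ y → y ≤ X → y ^ δ ≤ P := fun y hy h =>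
    hP ▸ Real.rpow_le_rpow hy h hδ0.le
  have mono2 : ∀ y : ℝ, 0 ≤ y → y ≤ 2 * X → y ^ δ ≤ 2 * P := fun y hy h => by
    calc y ^ δ ≤ (2 * X) ^ δ := Real.rpow_le_rpow hy h hδ0.le
      _ = 2 ^ δ * P := by rw [hP, Real.mul_rpow (by norm_num) hX0.le]
      _ ≤ 2 ^ (1 : ℝ) * P := by
        gcongr
        norm_num
      _ = 2 * P := by norm_num
  have hq2X : (q : ℝ) * (|2 * s.im| + 2) ≤ 2 * X := by
    rw [abs_mul, abs_two, hX]; nlinarith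
  have F0 : ∀ x : ℝ, 0 < x → x ≤ 1 →
      ‖DirichletCharacter.LFunctionTrivChar q (1 + x)‖ ≤ G / x := by
    intro x hx hx1
    refine (H₃ q (1 + x) (by simp [hx]) (by simp; linarith)).trans ?_
    have h1 : (q * (|((1 : ℂ) + x).im| + 2) : ℝ) ^ δ ≤ P := by
      apply mono _ (by positivity)
      simp only [Complex.add_im, Complex.one_im, Complex.ofReal_im, add_zero, abs_zero, zero_add]
      have := abs_nonneg s.im
      rw [hX]; gcongr; linarith
    have h2 : 1 + 1 / ‖(1 : ℂ) + x - 1‖ ≤ 2 / x := by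
      rw [add_sub_cancel_left, Complex.norm_real, Real.norm_eq_abs, abs_of_pos hx]
      have : 1 ≤ 1 / x := by rw [le_div_iff₀ hx]; linarith
      have : 2 / x = 1 / x + 1 / x := by ring
      linarith
    calc _ ≤ C₃ * P * (2 / x) := by gcongr
      _ = (2 * C₃) * P / x := by ring
      _ ≤ G / x := by rw [hG]; gcongr
  have F2 : ∀ z : ℂ, 1 - δ / 8 ≤ z.re → z.re ≤ 2 → |z.im| ≤ |s.im| →
      ‖deriv χ.LFunction z‖ ≤ G := by
    intro z hz hz2 hzi
    refine (H₂ q χ hχ1 z hz hz2).trans ?_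
    rw [hG]
    gcongr
    apply mono _ (by positivity)
    rw [hX]; gcongr
  have hGδ : 1 / G ≤ δ / 8 := by
    rw [div_le_div_iff₀ hG0 (by norm_num)]
    rw [div_le_iff₀ hδ0] at hKδ
    have : K ≤ G := by rw [hG]; exact le_mul_of_one_le_right (by linarith) hP1
    nlinarith
  have hUδ : 1 / (64 * U ^ 8) ≤ δ / 8 := by
    refine le_trans ?_ hGδ
    apply one_div_le_one_div_of_le hG0
    have : U ≤ U ^ 8 := le_self_pow₀ hU1 (by norm_num)
    linarith
  have large : (∀ x : ℝ, 0 < x → x ≤ 1 →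
      ‖(χ ^ 2).LFunction (1 + x + 2 * Complex.I * s.im)‖ ≤ U) →
      1 / (64 * U ^ 8) ≤ ‖χ.LFunction s‖ := by
    intro hV
    have h := le_norm_LFunction_of_bounds (t := s.im) hχ1 hU1
      (fun x hx hx1 => (F0 x hx hx1).trans (by gcongr)) hV
      (fun σ hσ hσ2 => (F2 _ (by simpa using (by linarith)) (by simpa using hσ2)
        (by simp)).trans hGU) hs hs2
    rw [Complex.re_add_im] at h
    exact hU78.trans h
  by_cases hχ2 : χ ^ 2 = 1
  · have F1 : ∀ x : ℝ, 0 < x → x ≤ 1 →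
        ‖DirichletCharacter.LFunctionTrivChar q (1 + x + 2 * Complex.I * s.im)‖ ≤
          G * (1 + 1 / ‖(x : ℂ) + 2 * Complex.I * s.im‖) := by
      intro x hx hx1
      refine (H₃ q _ (by simp [hx]) (by simp; linarith)).trans ?_
      rw [show (1 : ℂ) + x + 2 * Complex.I * s.im - 1 = x + 2 * Complex.I * s.im by ring]
      gcongr
      calc _ ≤ C₃ * (2 * P) := by
            gcongr
            apply mono2 _ (by positivity)
            simpa using hq2X
        _ = 2 * C₃ * P := by ring
        _ ≤ G := by rw [hG]; gcongr
    rcases le_or_gt |s.im| (1 / (4 * G ^ 2)) with ht | ht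
    · have hG2 : 1 / (4 * G ^ 2) ≤ δ / 8 := by
        refine le_trans (one_div_le_one_div_of_le hG0 ?_) hGδ
        nlinarith
      have hU8G : 1 / (64 * U ^ 8) ≤ 1 / (4 * G ^ 2) := by
        apply one_div_le_one_div_of_le (by positivity)
        have h1 : U ^ 2 ≤ U ^ 8 := pow_le_pow_right₀ hU1 (by norm_num)
        have h2 : G ^ 2 ≤ U ^ 2 := by gcongr
        linarith [sq_nonneg U]
      have h := le_norm_LFunction_of_le_norm_LFunction_one hχ1 hχ2 hG1 (s := s) F0
        (fun x hx hx1 => (F1 x hx hx1).trans (by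
          gcongr
          refine le_trans ?_ (Complex.re_le_norm _)
          simp))
        (fun z hz hz2 hzi => F2 z (by linarith) hz2 hzi)
        (by
          refine le_trans ?_ (H₄ q χ hχp hχ2 hχ1)
          have h1 : (q : ℝ) ^ δ ≤ P := by
            apply mono _ (by positivity)
            have := abs_nonneg s.im
            rw [hX]
            exact le_mul_of_one_le_right (by positivity) (by linarith)
          rw [Real.rpow_neg (by positivity), ← div_eq_mul_inv, hG,
            div_le_div_iff₀ (by positivity) (by positivity), one_mul]
          rw [div_le_iff₀ hc₄] at hKc₄
          calc (q : ℝ) ^ δ ≤ P * 1 := by rw [mul_one]; exact h1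
            _ ≤ P * (K * c₄) := by gcongr
            _ = c₄ * (K * P) := by ring)
        (by linarith) hs2 ht
      refine le_trans ?_ h
      apply one_div_le_one_div_of_le (by positivity)
      have h1 : U ≤ U ^ 8 := le_self_pow₀ hU1 (by norm_num)
      have : 0 < G ^ 3 := by positivity
      linarith
    · refine large fun x hx hx1 => ?_
      simp only [hχ2]
      refine (F1 x hx hx1).trans ?_
      have h1 : 1 / ‖(x : ℂ) + 2 * Complex.I * s.im‖ ≤ 2 * G ^ 2 := by
        have h2 : 1 / (2 * G ^ 2) ≤ ‖(x : ℂ) + 2 * Complex.I * s.im‖ := by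
          refine le_trans ?_ (Complex.abs_im_le_norm _)
          simp only [Complex.add_im, Complex.ofReal_im, Complex.mul_im, Complex.mul_re]
          simp only [Complex.re_ofNat, Complex.im_ofNat, Complex.I_re, Complex.I_im,
            Complex.ofReal_re, mul_zero, mul_one, sub_zero, add_zero, zero_add, abs_mul, abs_two]
          have e : 1 / (2 * G ^ 2) = 2 * (1 / (4 * G ^ 2)) := by field_simp; norm_num
          rw [e]
          linarith
        have := one_div_le_one_div_of_le (by positivity) h2
        rwa [one_div_one_div] at this
      have hG2 : 1 ≤ G ^ 2 := one_le_pow₀ hG1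
      calc G * (1 + 1 / ‖(x : ℂ) + 2 * Complex.I * s.im‖) ≤ G * (G ^ 2 + 2 * G ^ 2) := by
            gcongr
        _ = U := by rw [hU]; ring
  · refine large fun x hx hx1 => ?_
    refine (H₁ q (χ ^ 2) hχ2 (1 + x + 2 * Complex.I * s.im) (by simp; linarith)
      (by simp; linarith)).trans (le_trans ?_ hGU)
    calc C₁ * (q * (|((1 : ℂ) + x + 2 * Complex.I * s.im).im| + 2)) ^ δ ≤ C₁ * (2 * P) := by
          gcongr
          apply mono2 _ (by positivity)
          simpa using hq2X
      _ = 2 * C₁ * P := by ring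
      _ ≤ G := by rw [hG]; gcongr

theorem exists_norm_deriv_div_LFunction_le {ε : ℝ} (hε : 0 < ε) (hε1 : ε ≤ 1) :
    ∃ c : ℝ, 0 < c ∧ c ≤ 1 / 2 ∧ ∃ C : ℝ, 0 < C ∧
    ∀ (q : ℕ) [NeZero q] (χ : DirichletCharacter ℂ q), χ.IsPrimitive → χ ≠ 1 →
    ∀ (Y : ℝ) (s : ℂ), q * (|s.im| + 2) ≤ Y → 1 - c * Y ^ (-ε) ≤ s.re → s.re ≤ 2 →
      χ.LFunction s ≠ 0 ∧ ‖deriv χ.LFunction s / χ.LFunction s‖ ≤ C * Y ^ ε := by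
  obtain ⟨c, hc, H⟩ := exists_le_norm_LFunction (half_pos hε) (by linarith)
  obtain ⟨C, hC, H'⟩ := exists_norm_deriv_LFunction_le_rpow (half_pos hε) (by linarith)
  refine ⟨min c (ε / 16), by positivity, (min_le_right _ _).trans (by linarith), C / c,
    by positivity, ?_⟩
  intro q _ χ hχp hχ1 Y s hY hs hs2
  have hq1 : (1 : ℝ) ≤ q := by exact_mod_cast NeZero.pos q
  have hX1 : 1 ≤ (q : ℝ) * (|s.im| + 2) := by nlinarith [abs_nonneg s.im]
  have hX0 : 0 < (q : ℝ) * (|s.im| + 2) := by linarith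
  have hY1 : 1 ≤ Y := hX1.trans hY
  have hY0 : 0 < Y := by linarith
  have h1 : Y ^ (-ε) ≤ (q * (|s.im| + 2) : ℝ) ^ (-(ε / 2)) := by
    calc Y ^ (-ε) ≤ Y ^ (-(ε / 2)) := Real.rpow_le_rpow_of_exponent_le hY1 (by linarith)
      _ ≤ _ := Real.rpow_le_rpow_of_nonpos hX0 hY (by linarith)
  have h2 : Y ^ (-ε) ≤ 1 := Real.rpow_le_one_of_one_le_of_nonpos hY1 (by linarith)
  have hYp : 0 < Y ^ (-ε) := by positivity
  have hlow := H q χ hχp hχ1 s (by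
    have : min c (ε / 16) * Y ^ (-ε) ≤ c * (q * (|s.im| + 2) : ℝ) ^ (-(ε / 2)) :=
      mul_le_mul (min_le_left _ _) h1 hYp.le hc.le
    linarith) hs2
  have h3 : c * Y ^ (-(ε / 2)) ≤ ‖χ.LFunction s‖ :=
    le_trans (mul_le_mul_of_nonneg_left (Real.rpow_le_rpow_of_nonpos hX0 hY (by linarith)) hc.le)
      hlow
  have h4 : 0 < c * Y ^ (-(ε / 2)) := by positivity
  refine ⟨norm_pos_iff.mp (h4.trans_le h3), ?_⟩
  rw [norm_div]
  have h5 : ‖deriv χ.LFunction s‖ ≤ C * Y ^ (ε / 2) := by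
    refine (H' q χ hχ1 s ?_ hs2).trans ?_
    · have : min c (ε / 16) * Y ^ (-ε) ≤ ε / 16 * 1 :=
        mul_le_mul (min_le_right _ _) h2 hYp.le (by positivity)
      linarith
    · exact mul_le_mul_of_nonneg_left (Real.rpow_le_rpow hX0.le hY (by positivity)) hC.le
  calc ‖deriv χ.LFunction s‖ / ‖χ.LFunction s‖ ≤ (C * Y ^ (ε / 2)) / (c * Y ^ (-(ε / 2))) := by
        gcongr
    _ = C / c * Y ^ ε := by
        rw [mul_div_mul_comm, ← Real.rpow_sub hY0]
        congr 2
        ring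

/-- The tent function whose Mellin transform is `1 / (s (s + 1))`. -/
noncomputable def tent (v : ℝ) : ℂ := ((max (1 - v) 0 : ℝ) : ℂ)

theorem hasMellin_tent {s : ℂ} (hs : 0 < s.re) : HasMellin tent s (1 / (s * (s + 1))) := by
  have h1 := hasMellin_one_Ioc hs
  have h2 := hasMellin_cpow_Ioc 1 (s := s) (by simp; linarith)
  have h := hasMellin_sub h1.1 h2.1
  have e : Set.EqOn (fun t : ℝ => (t : ℂ) ^ (s - 1) •
      ((Set.Ioc 0 1).indicator (fun _ => (1 : ℂ)) t -
        (Set.Ioc 0 1).indicator (fun t : ℝ => (t : ℂ) ^ (1 : ℂ)) t))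
      (fun t : ℝ => (t : ℂ) ^ (s - 1) • tent t) (Set.Ioi 0) := by
    intro t ht
    have ht0 : 0 < t := ht
    simp only [tent]
    by_cases h1 : t ≤ 1
    · have hm : t ∈ Set.Ioc (0 : ℝ) 1 := ⟨ht0, h1⟩
      simp only [Set.indicator_of_mem hm]
      rw [max_eq_left (by linarith)]
      simp
    · have hm : t ∉ Set.Ioc (0 : ℝ) 1 := fun h => h1 h.2
      simp only [Set.indicator_of_notMem hm]
      rw [max_eq_right (by linarith)]
      simp
  have hs0 : s ≠ 0 := fun h0 => by simp [h0] at hs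
  have hs1 : s + 1 ≠ 0 := fun h0 => by
    have := congrArg Complex.re h0
    simp at this
    linarith
  constructor
  · exact h.1.congr_fun e measurableSet_Ioi
  · rw [mellin, ← MeasureTheory.setIntegral_congr_fun measurableSet_Ioi e]
    refine h.2.trans ?_
    rw [h1.2, h2.2]
    field_simp
    ring

theorem norm_mellin_kernel_le {c : ℝ} (hc : 0 < c) (t : ℝ) :
    ‖(1 / ((c + t * Complex.I) * (c + t * Complex.I + 1)) : ℂ)‖ ≤
      (1 + 1 / c ^ 2) * (1 + t ^ 2)⁻¹ := by
  have h1 : ‖(c + t * Complex.I : ℂ)‖ ^ 2 = c ^ 2 + t ^ 2 := by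
    rw [Complex.sq_norm, Complex.normSq_add_mul_I]
  have h2 : ‖(c + t * Complex.I : ℂ)‖ ≤ ‖(c + t * Complex.I + 1 : ℂ)‖ := by
    refine le_of_sq_le_sq ?_ (norm_nonneg _)
    rw [h1, show (c + t * Complex.I + 1 : ℂ) = ((c + 1 : ℝ) : ℂ) + t * Complex.I by push_cast; ring,
      Complex.sq_norm, Complex.normSq_add_mul_I]
    nlinarith
  rw [norm_div, norm_one, norm_mul, ← div_eq_mul_inv]
  have h3 : c ^ 2 + t ^ 2 ≤ ‖(c + t * Complex.I : ℂ)‖ * ‖(c + t * Complex.I + 1 : ℂ)‖ := by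
    rw [← h1, sq]; gcongr
  refine (one_div_le_one_div_of_le (by positivity) h3).trans ?_
  rw [div_le_div_iff₀ (by positivity) (by positivity)]
  have e : (1 + 1 / c ^ 2) * (c ^ 2 + t ^ 2) = c ^ 2 + t ^ 2 + 1 + t ^ 2 / c ^ 2 := by
    field_simp; ring
  rw [e]
  have : 0 ≤ t ^ 2 / c ^ 2 := by positivity
  nlinarith [sq_nonneg c]

theorem continuous_mellin_kernel {c : ℝ} (hc : 0 < c) :
    Continuous fun t : ℝ => (1 / ((c + t * Complex.I) * (c + t * Complex.I + 1)) : ℂ) := by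
  refine Continuous.div (by fun_prop) (by fun_prop) fun t => mul_ne_zero ?_ ?_
  · intro h
    have := congrArg Complex.re h
    simp at this
    linarith
  · intro h
    have := congrArg Complex.re h
    simp at this
    linarith

theorem integrable_mellin_kernel {c : ℝ} (hc : 0 < c) : MeasureTheory.Integrable
    fun t : ℝ => (1 / ((c + t * Complex.I) * (c + t * Complex.I + 1)) : ℂ) :=
  (integrable_inv_one_add_sq.const_mul (1 + 1 / c ^ 2)).mono'
    (continuous_mellin_kernel hc).aestronglyMeasurable
    (Filter.Eventually.of_forall (norm_mellin_kernel_le hc))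

theorem tent_eq_integral {c v : ℝ} (hc : 0 < c) (hv : 0 < v) :
    tent v = (1 / (2 * Real.pi) : ℝ) * ∫ t : ℝ, (v : ℂ) ^ (-(c + t * Complex.I) : ℂ) *
      (1 / ((c + t * Complex.I) * (c + t * Complex.I + 1))) := by
  have hre : ∀ t : ℝ, 0 < (c + t * Complex.I : ℂ).re := fun t => by simpa using hc
  have h := mellinInv_mellin_eq c tent hv (hasMellin_tent (by simpa using hc)).1
    (by
      refine (integrable_mellin_kernel hc).congr (Filter.Eventually.of_forall fun t => ?_)
      exact (hasMellin_tent (hre t)).2.symm)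
    (by
      apply Continuous.continuousAt
      unfold tent
      fun_prop)
  rw [← h, mellinInv]
  simp only [(hasMellin_tent (hre _)).2, smul_eq_mul, Complex.real_smul]

/-- A smoothed Perron formula. -/
theorem sum_mul_one_sub_div_eq_integral {f : ℕ → ℂ} {c u : ℝ} (hc : 0 < c) (hu : 0 < u)
    (hf : LSeriesSummable f c) :
    ∑ n ∈ Finset.Icc 1 ⌊u⌋₊, f n * ((1 - n / u : ℝ) : ℂ) =
      (1 / (2 * Real.pi) : ℝ) * ∫ t : ℝ, LSeries f (c + t * Complex.I) *
        ((u : ℂ) ^ (c + t * Complex.I : ℂ) *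
        (1 / ((c + t * Complex.I) * (c + t * Complex.I + 1)))) := by
  have hu' : (u : ℂ) ≠ 0 := by exact_mod_cast hu.ne'
  have hInt : ∀ n, MeasureTheory.Integrable fun t : ℝ => LSeries.term f (c + t * Complex.I) n *
      ((u : ℂ) ^ (c + t * Complex.I : ℂ) *
        (1 / ((c + t * Complex.I) * (c + t * Complex.I + 1)))) := by
    intro n
    refine ((integrable_mellin_kernel hc).norm.const_mul
      (‖LSeries.term f c n‖ * u ^ c)).mono' ?_ (Filter.Eventually.of_forall fun t => ?_)
    · refine Continuous.aestronglyMeasurable (Continuous.mul ?_ (Continuous.mul ?_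
        (continuous_mellin_kernel hc)))
      · rcases eq_or_ne n 0 with rfl | hn
        · simp [continuous_const]
        · simp only [LSeries.term_of_ne_zero hn]
          refine continuous_const.div ?_ fun t => ?_
          · exact Continuous.const_cpow (by fun_prop) (Or.inl (by exact_mod_cast hn))
          · simp [Complex.cpow_eq_zero_iff, hn]
      · exact Continuous.const_cpow (by fun_prop) (Or.inl hu')
    · rw [norm_mul, norm_mul, Complex.norm_cpow_eq_rpow_re_of_pos hu, ← mul_assoc]
      refine le_of_eq ?_
      congr 2
      · simp only [LSeries.norm_term_eq]; simp
      · simp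
  have hnorm : ∀ n (t : ℝ), ‖LSeries.term f (c + t * Complex.I) n *
      ((u : ℂ) ^ (c + t * Complex.I : ℂ) *
        (1 / ((c + t * Complex.I) * (c + t * Complex.I + 1))))‖ = ‖LSeries.term f c n‖ *
      (u ^ c * ‖(1 / ((c + t * Complex.I) * (c + t * Complex.I + 1)) : ℂ)‖) := by
    intro n t
    rw [norm_mul, norm_mul, Complex.norm_cpow_eq_rpow_re_of_pos hu]
    congr 1
    · simp only [LSeries.norm_term_eq]; simp
    · simp
  have hsum := MeasureTheory.hasSum_integral_of_summable_integral_norm hInt (by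
    simp only [hnorm, MeasureTheory.integral_const_mul]
    exact hf.norm.mul_right _)
  have hterm : ∀ n, ∫ t : ℝ, LSeries.term f (c + t * Complex.I) n *
      ((u : ℂ) ^ (c + t * Complex.I : ℂ) *
        (1 / ((c + t * Complex.I) * (c + t * Complex.I + 1)))) =
      if n = 0 then 0 else (2 * Real.pi : ℝ) * (f n * tent (n / u)) := by
    intro n
    split_ifs with hn
    · simp [hn]
    · have hn0 : 0 < (n : ℝ) := by exact_mod_cast Nat.pos_of_ne_zero hn
      rw [tent_eq_integral hc (div_pos hn0 hu), ← mul_assoc, ← mul_assoc, mul_comm _ (f n),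
        mul_assoc (f n), ← Complex.ofReal_mul, mul_one_div_cancel (by positivity),
        Complex.ofReal_one, mul_one, ← MeasureTheory.integral_const_mul]
      congr 1
      ext t
      rw [LSeries.term_of_ne_zero hn, ← mul_assoc, ← mul_assoc]
      congr 1
      rw [div_eq_mul_inv, ← Complex.cpow_neg, mul_assoc]
      congr 1
      rw [Complex.ofReal_div, Complex.div_cpow_ofReal_nonneg hn0.le hu.le, Complex.cpow_neg (u : ℂ),
        div_inv_eq_mul]
      rfl
  simp only [hterm, tsum_mul_right] at hsum
  have h2 := hsum.tsum_eq
  have h3 : ∑' n : ℕ, (if n = 0 then 0 else (2 * Real.pi : ℝ) * (f n * tent (n / u))) =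
      ∑ n ∈ Finset.Icc 1 ⌊u⌋₊, ((2 * Real.pi : ℝ) : ℂ) * (f n * ((1 - n / u : ℝ) : ℂ)) := by
    rw [tsum_eq_sum (s := Finset.Icc 1 ⌊u⌋₊)]
    · refine Finset.sum_congr rfl fun n hn => ?_
      rw [Finset.mem_Icc] at hn
      rw [if_neg (by omega), tent, max_eq_left]
      have := (Nat.le_floor_iff hu.le).mp hn.2
      rw [sub_nonneg, div_le_one hu]
      exact this
    · intro n hn
      rw [Finset.mem_Icc, not_and, not_le] at hn
      split_ifs with h0
      · rfl
      · have := (Nat.floor_lt hu.le).mp (hn (Nat.pos_of_ne_zero h0))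
        rw [tent, max_eq_right]
        · simp
        · rw [sub_nonpos, le_div_iff₀ hu]; linarith
  rw [h3, ← Finset.mul_sum] at h2
  have h4 : ((1 / (2 * Real.pi) : ℝ) : ℂ) * ((2 * Real.pi : ℝ) : ℂ) = 1 := by
    rw [← Complex.ofReal_mul, one_div_mul_cancel (by positivity), Complex.ofReal_one]
  calc _ = ((1 / (2 * Real.pi) : ℝ) : ℂ) * (((2 * Real.pi : ℝ) : ℂ) *
        ∑ n ∈ Finset.Icc 1 ⌊u⌋₊, f n * ((1 - n / u : ℝ) : ℂ)) := by
        rw [← mul_assoc, h4, one_mul]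
    _ = _ := by
        rw [h2]
        rfl

theorem norm_integral_sub_intervalIntegral_le {g : ℝ → ℂ} (hg : MeasureTheory.Integrable g)
    {K T : ℝ} (hT : 0 < T) (h : ∀ t, T ≤ |t| → ‖g t‖ ≤ K * |t| ^ (-2 : ℝ)) :
    ‖(∫ t, g t) - ∫ t in (-T)..T, g t‖ ≤ 2 * K / T := by
  have hdec : (∫ t, g t) - ∫ t in (-T)..T, g t =
      (∫ t in Set.Ioi T, g (-t)) + ∫ t in Set.Ioi T, g t := by
    rw [integral_comp_neg_Ioi, ← intervalIntegral.integral_Iic_sub_Iic hg.integrableOn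
      hg.integrableOn, ← intervalIntegral.integral_Iic_add_Ioi (b := T) hg.integrableOn
      hg.integrableOn]
    ring
  have hInt : MeasureTheory.IntegrableOn (fun t : ℝ => K * t ^ (-2 : ℝ)) (Set.Ioi T) :=
    (integrableOn_Ioi_rpow_of_lt (by norm_num) hT).const_mul K
  have hval : ∫ t in Set.Ioi T, K * t ^ (-2 : ℝ) = K / T := by
    rw [MeasureTheory.integral_const_mul, integral_Ioi_rpow_of_lt (by norm_num) hT]
    norm_num [Real.rpow_neg_one]
    rfl
  have key : ∀ f : ℝ → ℂ, (∀ t, T ≤ |t| → ‖f t‖ ≤ K * |t| ^ (-2 : ℝ)) →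
      ‖∫ t in Set.Ioi T, f t‖ ≤ K / T := by
    intro f hf
    rw [← hval]
    refine MeasureTheory.norm_integral_le_of_norm_le hInt ?_
    filter_upwards [MeasureTheory.ae_restrict_mem measurableSet_Ioi] with t ht
    have ht0 : 0 < t := hT.trans ht
    have := hf t (by rw [abs_of_pos ht0]; exact (Set.mem_Ioi.mp ht).le)
    rwa [abs_of_pos ht0] at this
  rw [hdec]
  refine (norm_add_le _ _).trans ?_
  have h1 := key g h
  have h2 := key (fun t => g (-t)) fun t ht => by
    have := h (-t) (by rwa [abs_neg])
    rwa [abs_neg] at this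
  calc _ ≤ K / T + K / T := add_le_add h2 h1
    _ = 2 * K / T := by ring

theorem norm_vertical_integral_le {Φ : ℂ → ℂ} {a c T M₁ M₂ : ℝ} (hac : a ≤ c) (hT : 0 ≤ T)
    (hΦ : ∀ s : ℂ, a ≤ s.re → s.re ≤ c → |s.im| ≤ T → DifferentiableAt ℂ Φ s)
    (h₁ : ∀ t : ℝ, |t| ≤ T → ‖Φ (a + t * Complex.I)‖ ≤ M₁)
    (h₂ : ∀ σ t : ℝ, a ≤ σ → σ ≤ c → |t| = T → ‖Φ (σ + t * Complex.I)‖ ≤ M₂) :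
    ‖∫ t in (-T)..T, Φ (c + t * Complex.I)‖ ≤ 2 * T * M₁ + 2 * (c - a) * M₂ := by
  have h := Complex.integral_boundary_rect_eq_zero_of_differentiableOn Φ
    (a + (-T : ℝ) * Complex.I) (c + T * Complex.I) (by
      intro s hs
      rw [Complex.mem_reProdIm] at hs
      simp only [Complex.add_re, Complex.ofReal_re, Complex.mul_re, Complex.I_re, mul_zero,
        Complex.ofReal_im, Complex.I_im, mul_one, sub_self, add_zero, Complex.add_im,
        Complex.mul_im, zero_add, Set.uIcc_of_le hac, Set.uIcc_of_le (neg_le_self hT),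
        Set.mem_Icc] at hs
      exact (hΦ s hs.1.1 hs.1.2 (abs_le.mpr hs.2)).differentiableWithinAt)
  simp only [Complex.add_re, Complex.ofReal_re, Complex.mul_re, Complex.I_re, mul_zero,
        Complex.ofReal_im, Complex.I_im, mul_one, sub_self, add_zero, Complex.add_im,
        Complex.mul_im, zero_add, smul_eq_mul] at h
  have e : Complex.I * ∫ t in (-T)..T, Φ (c + t * Complex.I) =
      (Complex.I * ∫ t in (-T)..T, Φ (a + t * Complex.I)) +
      (∫ σ in a..c, Φ (σ + T * Complex.I)) - ∫ σ in a..c, Φ (σ + (-T : ℝ) * Complex.I) := by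
    linear_combination h
  have hn : ‖∫ t in (-T)..T, Φ (c + t * Complex.I)‖ =
      ‖Complex.I * ∫ t in (-T)..T, Φ (c + t * Complex.I)‖ := by
    rw [norm_mul, Complex.norm_I, one_mul]
  rw [hn, e]
  have b1 : ‖Complex.I * ∫ t in (-T)..T, Φ (a + t * Complex.I)‖ ≤ M₁ * |T - (-T)| := by
    rw [norm_mul, Complex.norm_I, one_mul]
    refine intervalIntegral.norm_integral_le_of_norm_le_const fun t ht => h₁ t ?_
    rw [Set.uIoc_of_le (neg_le_self hT)] at ht
    exact abs_le.mpr ⟨ht.1.le, ht.2⟩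
  have b2 : ‖∫ σ in a..c, Φ (σ + T * Complex.I)‖ ≤ M₂ * |c - a| := by
    refine intervalIntegral.norm_integral_le_of_norm_le_const fun σ hσ => ?_
    rw [Set.uIoc_of_le hac] at hσ
    exact h₂ σ T hσ.1.le hσ.2 (abs_of_nonneg hT)
  have b3 : ‖∫ σ in a..c, Φ (σ + (-T : ℝ) * Complex.I)‖ ≤ M₂ * |c - a| := by
    refine intervalIntegral.norm_integral_le_of_norm_le_const fun σ hσ => ?_
    rw [Set.uIoc_of_le hac] at hσ
    exact h₂ σ (-T) hσ.1.le hσ.2 (by rw [abs_neg, abs_of_nonneg hT])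
  rw [abs_of_nonneg (by linarith)] at b1 b2 b3
  refine (norm_sub_le _ _).trans ((add_le_add (norm_add_le _ _) le_rfl).trans ?_)
  linarith

/-- `L(s, χΛ)` is bounded polynomially in `1 / (re s - 1)`. -/
theorem exists_norm_LSeries_vonMangoldt_le : ∃ C : ℝ, 0 < C ∧ ∀ (f : ℕ → ℂ),
    (∀ n, ‖f n‖ ≤ ArithmeticFunction.vonMangoldt n) → ∀ (κ t : ℝ), 0 < κ → κ ≤ 1 →
      ‖LSeries f ((1 + 2 * κ : ℝ) + t * Complex.I)‖ ≤ C / κ ^ 2 := by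
  obtain ⟨C, hC, H⟩ := exists_norm_riemannZeta_le_rpow (ε := 1) one_pos
  refine ⟨C * 2 + 2, by positivity, ?_⟩
  intro f hf κ t hκ hκ1
  have hsum : Summable fun n : ℕ => 1 / (n : ℝ) ^ (1 + κ) :=
    Real.summable_one_div_nat_rpow.mpr (by linarith)
  have hz : ∑' n : ℕ, 1 / (n : ℝ) ^ (1 + κ) ≤ (C * 2 + 2) / κ := by
    have h := H (((1 + κ : ℝ)) : ℂ) (by simp [hκ]) (by simp; linarith)
    rw [zeta_eq_tsum_one_div_nat_cpow (by simp [hκ])] at h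
    have e : ∑' n : ℕ, 1 / (n : ℂ) ^ (((1 + κ : ℝ)) : ℂ) =
        ((∑' n : ℕ, 1 / (n : ℝ) ^ (1 + κ) : ℝ) : ℂ) := by
      rw [Complex.ofReal_tsum]
      refine tsum_congr fun n => ?_
      rw [Complex.ofReal_div, Complex.ofReal_cpow (Nat.cast_nonneg n)]
      simp
    rw [e, Complex.norm_real, Real.norm_eq_abs] at h
    refine (le_abs_self _).trans (h.trans ?_)
    have e2 : (((1 + κ : ℝ)) : ℂ) - 1 = (κ : ℂ) := by push_cast; ring
    rw [e2, Complex.norm_real, Real.norm_eq_abs, abs_of_pos hκ]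
    simp only [Complex.ofReal_im, abs_zero, zero_add, Real.rpow_one]
    rw [add_div]
    gcongr
    rw [le_div_iff₀ hκ]
    nlinarith
  have hterm : ∀ n : ℕ, ‖LSeries.term f ((1 + 2 * κ : ℝ) + t * Complex.I) n‖ ≤
      1 / κ * (1 / (n : ℝ) ^ (1 + κ)) := by
    intro n
    rw [LSeries.norm_term_eq]
    split_ifs with hn
    · positivity
    · have hn0 : 0 < (n : ℝ) := by exact_mod_cast Nat.pos_of_ne_zero hn
      have h1 : ‖f n‖ ≤ (n : ℝ) ^ κ / κ := (hf n).trans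
        (ArithmeticFunction.vonMangoldt_le_log.trans (Real.log_le_rpow_div hn0.le hκ))
      have e : (((1 + 2 * κ : ℝ)) + t * Complex.I : ℂ).re = 1 + 2 * κ := by simp
      rw [e, div_le_iff₀ (by positivity)]
      refine h1.trans (le_of_eq ?_)
      rw [show 1 + 2 * κ = κ + (1 + κ) by ring, Real.rpow_add hn0 κ]
      field_simp
  rw [LSeries]
  refine (tsum_of_norm_bounded (hsum.mul_left (1 / κ)).hasSum hterm).trans ?_
  rw [tsum_mul_left]
  calc 1 / κ * ∑' n : ℕ, 1 / (n : ℝ) ^ (1 + κ) ≤ 1 / κ * ((C * 2 + 2) / κ) := by gcongr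
    _ = _ := by field_simp

theorem norm_one_div_mul_add_one_le_re {s : ℂ} (hs : 1 / 2 ≤ s.re) :
    ‖1 / (s * (s + 1))‖ ≤ 4 := by
  have h1 : 1 / 2 ≤ ‖s‖ := hs.trans (Complex.re_le_norm s)
  have h2 : 1 / 2 ≤ ‖s + 1‖ :=
    le_trans (by simp; linarith) (Complex.re_le_norm (s + 1))
  rw [norm_div, norm_one, norm_mul, div_le_iff₀ (by positivity)]
  nlinarith

theorem norm_one_div_mul_add_one_le_im {s : ℂ} (hs : s.im ≠ 0) :
    ‖1 / (s * (s + 1))‖ ≤ |s.im| ^ (-2 : ℝ) := by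
  have h0 : 0 < |s.im| := abs_pos.mpr hs
  have h1 : |s.im| ≤ ‖s‖ := Complex.abs_im_le_norm s
  have h2 : |s.im| ≤ ‖s + 1‖ := le_trans (by simp) (Complex.abs_im_le_norm (s + 1))
  rw [norm_div, norm_one, norm_mul, Real.rpow_neg h0.le, one_div]
  gcongr
  rw [Real.rpow_two, sq]
  gcongr

theorem LSeries_mul_vonMangoldt_eq {q : ℕ} [NeZero q] (χ : DirichletCharacter ℂ q) {s : ℂ}
    (hs : 1 < s.re) : LSeries (fun n => χ n * (ArithmeticFunction.vonMangoldt n : ℂ)) s =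
      -(deriv χ.LFunction s / χ.LFunction s) := by
  have h := DirichletCharacter.LSeries_twist_vonMangoldt_eq χ hs
  rw [DirichletCharacter.LFunction_eq_LSeries χ hs,
    DirichletCharacter.deriv_LFunction_eq_deriv_LSeries χ hs, ← neg_div, ← h]
  rfl

set_option maxHeartbeats 1000000 in
theorem exists_norm_sum_mul_vonMangoldt_mul_tent_le {ε : ℝ} (hε : 0 < ε) (hε1 : ε ≤ 1) :
    ∃ c : ℝ, 0 < c ∧ c ≤ 1 / 2 ∧ ∃ C : ℝ, 0 < C ∧
    ∀ (q : ℕ) [NeZero q] (χ : DirichletCharacter ℂ q), χ.IsPrimitive → χ ≠ 1 →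
    ∀ T Y u : ℝ, 1 ≤ T → q * (T + 2) ≤ Y → 3 ≤ u →
      ‖∑ n ∈ Finset.Icc 1 ⌊u⌋₊, (χ n * (ArithmeticFunction.vonMangoldt n : ℂ)) *
        ((1 - n / u : ℝ) : ℂ)‖ ≤
      C * (u * Real.log u ^ 2 / T + T * Y ^ ε * u ^ (1 - c * Y ^ (-ε)) + Y ^ ε * u / T ^ 2) := by
  obtain ⟨c, hc, hc1, C₂, hC₂, H⟩ := exists_norm_deriv_div_LFunction_le hε hε1
  obtain ⟨C₁, hC₁, H₁⟩ := exists_norm_LSeries_vonMangoldt_le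
  refine ⟨c, hc, hc1, 24 * C₁ + 9 * C₂, by positivity, ?_⟩
  intro q _ χ hχp hχ1 T Y u hT hY hu
  have hq1 : (1 : ℝ) ≤ q := by exact_mod_cast NeZero.pos q
  have hT0 : 0 < T := by linarith
  have hu0 : 0 < u := by linarith
  have hY1 : 1 ≤ Y := by nlinarith
  have hY0 : 0 < Y := by linarith
  obtain ⟨L, hL⟩ : ∃ L, L = Real.log u := ⟨_, rfl⟩
  have hL1 : 1 ≤ L := by
    rw [hL, Real.le_log_iff_exp_le hu0]
    linarith [Real.exp_one_lt_d9]
  have hL0 : 0 < L := by linarith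
  obtain ⟨a, ha⟩ : ∃ a, a = 1 - c * Y ^ (-ε) := ⟨_, rfl⟩
  have hYε : Y ^ (-ε) ≤ 1 := Real.rpow_le_one_of_one_le_of_nonpos hY1 (by linarith)
  have hYε0 : 0 < Y ^ (-ε) := by positivity
  have ha2 : 1 / 2 ≤ a := by rw [ha]; nlinarith
  have ha1 : a < 1 := by rw [ha]; nlinarith
  rw [← hL, ← ha]
  obtain ⟨κ, hκ⟩ : ∃ κ, κ = 1 / (2 * L) := ⟨_, rfl⟩
  have hκ0 : 0 < κ := by rw [hκ]; positivity
  have hκ1 : κ ≤ 1 / 2 := by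
    rw [hκ]; exact one_div_le_one_div_of_le (by norm_num) (by linarith)
  have huc : u ^ (1 + 2 * κ) ≤ 3 * u := by
    rw [Real.rpow_add hu0, Real.rpow_one, Real.rpow_def_of_pos hu0, ← hL, hκ]
    have : L * (2 * (1 / (2 * L))) = 1 := by field_simp
    rw [this]
    have := Real.exp_one_lt_d9
    nlinarith
  obtain ⟨f, hf⟩ : ∃ f : ℕ → ℂ, f = fun n : ℕ => χ n * (ArithmeticFunction.vonMangoldt n : ℂ) :=
    ⟨_, rfl⟩
  have hfΛ : ∀ n, ‖f n‖ ≤ ArithmeticFunction.vonMangoldt n := by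
    intro n
    rw [hf, norm_mul, Complex.norm_real, Real.norm_eq_abs,
      abs_of_nonneg ArithmeticFunction.vonMangoldt_nonneg]
    exact mul_le_of_le_one_left ArithmeticFunction.vonMangoldt_nonneg (χ.norm_le_one _)
  obtain ⟨Φ, hΦ⟩ : ∃ Φ : ℂ → ℂ, Φ = fun s => -(deriv χ.LFunction s / χ.LFunction s) *
      ((u : ℂ) ^ s * (1 / (s * (s + 1)))) := ⟨_, rfl⟩
  have hdiff := DirichletCharacter.differentiable_LFunction hχ1
  have hΦd : ∀ s : ℂ, 0 < s.re → χ.LFunction s ≠ 0 → DifferentiableAt ℂ Φ s := by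
    intro s hs hLs
    have hs0 : s ≠ 0 := fun h0 => by simp [h0] at hs
    have hs1 : s + 1 ≠ 0 := fun h0 => by
      have := congrArg Complex.re h0
      simp at this
      linarith
    rw [hΦ]
    have hd' : DifferentiableAt ℂ (deriv χ.LFunction) s :=
      (hdiff.analyticAt s).deriv.differentiableAt
    refine ((hd'.div (hdiff s) hLs).neg).mul (DifferentiableAt.mul ?_ ?_)
    · exact DifferentiableAt.const_cpow differentiableAt_id (Or.inl (by exact_mod_cast hu0.ne'))
    · exact (differentiableAt_const _).div (differentiableAt_id.mul
        (differentiableAt_id.add_const _)) (mul_ne_zero hs0 hs1)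
  have hre : ∀ σ t : ℝ, ((σ : ℂ) + t * Complex.I).re = σ := fun σ t => by simp
  have him : ∀ σ t : ℝ, ((σ : ℂ) + t * Complex.I).im = t := fun σ t => by simp
  have hLΦ : ∀ t : ℝ, LSeries f ((1 + 2 * κ : ℝ) + t * Complex.I) *
      ((u : ℂ) ^ (((1 + 2 * κ : ℝ)) + t * Complex.I : ℂ) *
      (1 / ((((1 + 2 * κ : ℝ)) + t * Complex.I) * (((1 + 2 * κ : ℝ)) + t * Complex.I + 1)))) =
      Φ ((1 + 2 * κ : ℝ) + t * Complex.I) := by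
    intro t
    rw [hf, LSeries_mul_vonMangoldt_eq χ (by rw [hre]; linarith), hΦ]
  have hperron := sum_mul_one_sub_div_eq_integral (f := f) (c := 1 + 2 * κ) (by linarith) hu0
    (by rw [hf]; exact DirichletCharacter.LSeriesSummable_twist_vonMangoldt χ (by simp; linarith))
  simp only [hLΦ] at hperron
  have hbound : ∀ t : ℝ, ‖Φ ((1 + 2 * κ : ℝ) + t * Complex.I)‖ ≤ 12 * C₁ * L ^ 2 * u *
      ‖(1 / (((1 + 2 * κ : ℝ) + t * Complex.I) * ((1 + 2 * κ : ℝ) + t * Complex.I + 1)) : ℂ)‖ := by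
    intro t
    rw [← hLΦ, norm_mul, norm_mul, Complex.norm_cpow_eq_rpow_re_of_pos hu0, hre, ← mul_assoc]
    refine mul_le_mul_of_nonneg_right ?_ (norm_nonneg _)
    have h1 := H₁ f hfΛ κ t hκ0 (by linarith)
    have e : C₁ / κ ^ 2 = 4 * C₁ * L ^ 2 := by rw [hκ]; field_simp; norm_num
    rw [e] at h1
    calc _ ≤ (4 * C₁ * L ^ 2) * (3 * u) := by gcongr
      _ = _ := by ring
  have hcont : Continuous fun t : ℝ => Φ ((1 + 2 * κ : ℝ) + t * Complex.I) := by
    rw [continuous_iff_continuousAt]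
    intro t
    have h1 : ContinuousAt Φ ((1 + 2 * κ : ℝ) + t * Complex.I) :=
      (hΦd _ (by rw [hre]; linarith) (DirichletCharacter.LFunction_ne_zero_of_one_le_re χ
        (Or.inl hχ1) (by rw [hre]; linarith))).continuousAt
    exact ContinuousAt.comp (f := fun t : ℝ => (((1 + 2 * κ : ℝ) : ℂ) + t * Complex.I)) h1
      (by fun_prop)
  have hInt : MeasureTheory.Integrable fun t : ℝ => Φ ((1 + 2 * κ : ℝ) + t * Complex.I) :=
    ((integrable_mellin_kernel (c := 1 + 2 * κ) (by linarith)).norm.const_mul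
      (12 * C₁ * L ^ 2 * u)).mono' hcont.aestronglyMeasurable (Filter.Eventually.of_forall hbound)
  have htail := norm_integral_sub_intervalIntegral_le hInt hT0 (K := 12 * C₁ * L ^ 2 * u)
    fun t ht => by
      refine (hbound t).trans (mul_le_mul_of_nonneg_left ?_ (by positivity))
      have ht0 : t ≠ 0 := fun h => by rw [h, abs_zero] at ht; linarith
      have := norm_one_div_mul_add_one_le_im (s := ((1 + 2 * κ : ℝ) : ℂ) + t * Complex.I)
        (by rwa [him])
      rwa [him] at this
  have hZ : ∀ σ t : ℝ, a ≤ σ → σ ≤ 1 + 2 * κ → |t| ≤ T → χ.LFunction (σ + t * Complex.I) ≠ 0 ∧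
      ‖deriv χ.LFunction (σ + t * Complex.I) / χ.LFunction (σ + t * Complex.I)‖ ≤ C₂ * Y ^ ε := by
    intro σ t h1 h2 h3
    refine H q χ hχp hχ1 Y _ ?_ ?_ ?_
    · rw [him]
      refine le_trans ?_ hY
      gcongr
    · rw [hre, ← ha]; exact h1
    · rw [hre]; linarith
  have hmain := norm_vertical_integral_le (Φ := Φ) (a := a) (c := 1 + 2 * κ) (T := T)
    (M₁ := C₂ * Y ^ ε * (u ^ a * 4)) (M₂ := C₂ * Y ^ ε * (3 * u * T ^ (-2 : ℝ)))
    (by linarith) hT0.le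
    (fun s h1 h2 h3 => by
      refine hΦd s (by linarith) ?_
      have := (hZ s.re s.im h1 h2 h3).1
      rwa [Complex.re_add_im] at this)
    (fun t ht => by
      rw [hΦ, norm_mul, norm_mul, norm_neg, Complex.norm_cpow_eq_rpow_re_of_pos hu0, hre]
      have h1 := (hZ a t le_rfl (by linarith) ht).2
      have h2 := norm_one_div_mul_add_one_le_re (s := (a : ℂ) + t * Complex.I)
        (by rw [hre]; exact ha2)
      gcongr)
    (fun σ t h1 h2 h3 => by
      rw [hΦ, norm_mul, norm_mul, norm_neg, Complex.norm_cpow_eq_rpow_re_of_pos hu0, hre]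
      have h4 := (hZ σ t h1 h2 h3.le).2
      have ht0 : t ≠ 0 := fun h => by rw [h, abs_zero] at h3; linarith
      have h5 := norm_one_div_mul_add_one_le_im (s := (σ : ℂ) + t * Complex.I)
        (by rwa [him])
      rw [him, h3] at h5
      have h6 : u ^ σ ≤ 3 * u :=
        (Real.rpow_le_rpow_of_exponent_le (by linarith) h2).trans huc
      gcongr)
  have hfin : ‖∫ t : ℝ, Φ ((1 + 2 * κ : ℝ) + t * Complex.I)‖ ≤ 2 * (12 * C₁ * L ^ 2 * u) / T +
      (2 * T * (C₂ * Y ^ ε * (u ^ a * 4)) +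
      2 * (1 + 2 * κ - a) * (C₂ * Y ^ ε * (3 * u * T ^ (-2 : ℝ)))) := by
    have := norm_le_norm_sub_add (∫ t : ℝ, Φ ((1 + 2 * κ : ℝ) + t * Complex.I))
      (∫ t in (-T)..T, Φ ((1 + 2 * κ : ℝ) + t * Complex.I))
    linarith
  have hgoal : ∑ n ∈ Finset.Icc 1 ⌊u⌋₊, (χ n * (ArithmeticFunction.vonMangoldt n : ℂ)) *
      ((1 - n / u : ℝ) : ℂ) = ∑ n ∈ Finset.Icc 1 ⌊u⌋₊, f n * ((1 - n / u : ℝ) : ℂ) := by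
    rw [hf]
  rw [hgoal, hperron, norm_mul, Complex.norm_real, Real.norm_eq_abs, abs_of_pos (by positivity)]
  have hpi : 1 / (2 * Real.pi) ≤ 1 := by
    rw [div_le_one (by positivity)]
    linarith [Real.pi_gt_three]
  refine (mul_le_of_le_one_left (norm_nonneg _) hpi).trans (hfin.trans ?_)
  have hT2 : T ^ (-2 : ℝ) = 1 / T ^ 2 := by
    rw [Real.rpow_neg hT0.le, Real.rpow_two, one_div]
  rw [hT2]
  have e1 : 2 * (1 + 2 * κ - a) * (C₂ * Y ^ ε * (3 * u * (1 / T ^ 2))) ≤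
      3 * (C₂ * Y ^ ε * (3 * u * (1 / T ^ 2))) := by
    gcongr
    linarith
  have p1 : 0 ≤ u * L ^ 2 / T := by positivity
  have p2 : 0 ≤ T * Y ^ ε * u ^ a := by positivity
  have p3 : 0 ≤ Y ^ ε * u / T ^ 2 := by positivity
  have q1 : 2 * (12 * C₁ * L ^ 2 * u) / T = 24 * C₁ * (u * L ^ 2 / T) := by ring
  have q2 : 2 * T * (C₂ * Y ^ ε * (u ^ a * 4)) = 8 * C₂ * (T * Y ^ ε * u ^ a) := by ring
  have q3 : 3 * (C₂ * Y ^ ε * (3 * u * (1 / T ^ 2))) = 9 * C₂ * (Y ^ ε * u / T ^ 2) := by ring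
  nlinarith [mul_nonneg hC₁.le p1, mul_nonneg hC₁.le p2, mul_nonneg hC₁.le p3,
    mul_nonneg hC₂.le p1, mul_nonneg hC₂.le p2, mul_nonneg hC₂.le p3]

theorem exp_neg_mul_sqrt_le {a : ℝ} (ha : 0 < a) (k : ℕ) : ∃ C : ℝ, 0 < C ∧ ∀ L : ℝ, 1 ≤ L →
    Real.exp (-(a * √L)) ≤ C / L ^ k := by
  refine ⟨(2 * k).factorial / a ^ (2 * k), by positivity, fun L hL => ?_⟩
  have h := Real.pow_div_factorial_le_exp (a * √L) (by positivity) (2 * k)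
  rw [Real.exp_neg, div_div, inv_eq_one_div, div_le_div_iff₀ (Real.exp_pos _) (by positivity)]
  rw [mul_pow, pow_mul (√L), Real.sq_sqrt (by linarith),
    div_le_iff₀ (by positivity)] at h
  linarith

theorem log_pow_le_mul_sqrt (k : ℕ) : ∃ C : ℝ, 0 < C ∧ ∀ x : ℝ, 1 ≤ x →
    Real.log x ^ k ≤ C * √x := by
  refine ⟨2 ^ k * k.factorial, by positivity, fun x hx => ?_⟩
  have h := Real.pow_div_factorial_le_exp (Real.log x / 2)
    (by have := Real.log_nonneg hx; positivity) k
  rw [Real.exp_half, Real.exp_log (by linarith), div_pow, div_div, div_le_iff₀ (by positivity)] at h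
  linarith

theorem one_le_log {x : ℝ} (hx : 3 ≤ x) : 1 ≤ Real.log x := by
  rw [Real.le_log_iff_exp_le (by linarith)]
  linarith [Real.exp_one_lt_d9]

theorem exists_norm_sum_mul_vonMangoldt_mul_tent_le_log (D E : ℕ) : ∃ C : ℝ, 0 < C ∧
    ∀ (q : ℕ) [NeZero q] (χ : DirichletCharacter ℂ q), χ.IsPrimitive → χ ≠ 1 →
    ∀ x u : ℝ, 3 ≤ x → q ≤ Real.log x ^ D → 3 ≤ u → u ≤ x →
      ‖∑ n ∈ Finset.Icc 1 ⌊u⌋₊, (χ n * (ArithmeticFunction.vonMangoldt n : ℂ)) *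
        ((1 - n / u : ℝ) : ℂ)‖ ≤ C * x / Real.log x ^ E := by
  obtain ⟨ε, hε⟩ : ∃ ε : ℝ, ε = 1 / (2 * (D + E + 2 : ℕ)) := ⟨_, rfl⟩
  have hε0 : 0 < ε := by rw [hε]; positivity
  have hε1 : ε ≤ 1 := by
    rw [hε, div_le_one (by positivity)]
    push_cast
    have : (0 : ℝ) ≤ D := by positivity
    have : (0 : ℝ) ≤ E := by positivity
    linarith
  obtain ⟨c, hc, hc1, C, hC, H⟩ := exists_norm_sum_mul_vonMangoldt_mul_tent_le hε0 hε1
  obtain ⟨C', hC', H'⟩ := exp_neg_mul_sqrt_le (a := c / 3) (by positivity) (2 * E + 3)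
  refine ⟨C * (1 + 3 * C' + 3), by positivity, ?_⟩
  intro q _ χ hχp hχ1 x u hx hq hu hux
  have hL1 := one_le_log hx
  have hlogu : Real.log u ≤ Real.log x := Real.log_le_log (by linarith) hux
  have hlogu0 : 0 ≤ Real.log u := Real.log_nonneg (by linarith)
  have hxlog : Real.exp (Real.log x) = x := Real.exp_log (by linarith)
  generalize hL : Real.log x = L at *
  have hL0 : 0 < L := by linarith
  have hx0 : 0 < x := by linarith
  obtain ⟨T, hT⟩ : ∃ T, T = L ^ (E + 2) := ⟨_, rfl⟩
  obtain ⟨Y, hY⟩ : ∃ Y, Y = 3 * L ^ (D + E + 2) := ⟨_, rfl⟩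
  have hT1 : 1 ≤ T := by rw [hT]; exact one_le_pow₀ hL1
  have hLsqrt : √L ≤ L := Real.sqrt_le_iff.mpr ⟨hL0.le, by nlinarith⟩
  have hLε : (L ^ (D + E + 2)) ^ ε = √L := by
    rw [← Real.rpow_natCast, ← Real.rpow_mul hL0.le, Real.sqrt_eq_rpow, hε]
    congr 1
    field_simp
  have h3ε : (3 : ℝ) ^ ε ≤ 3 := by
    calc (3 : ℝ) ^ ε ≤ 3 ^ (1 : ℝ) := Real.rpow_le_rpow_of_exponent_le (by norm_num) hε1
      _ = 3 := by norm_num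
  have hYε' : Y ^ ε ≤ 3 * √L := by
    rw [hY, Real.mul_rpow (by norm_num) (by positivity), hLε]
    gcongr
  have hYε : Y ^ ε ≤ 3 * L := hYε'.trans (by linarith)
  have hY0 : 0 < Y := by rw [hY]; positivity
  have hYε0 : 0 < Y ^ ε := by positivity
  have hsq0 : 0 < √L := Real.sqrt_pos.mpr hL0
  have hYneg : 1 / (3 * √L) ≤ Y ^ (-ε) := by
    rw [Real.rpow_neg hY0.le, ← one_div]
    exact one_div_le_one_div_of_le hYε0 hYε'
  have hYneg1 : Y ^ (-ε) ≤ 1 := by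
    refine Real.rpow_le_one_of_one_le_of_nonpos ?_ (by linarith)
    rw [hY]
    have : 1 ≤ L ^ (D + E + 2) := one_le_pow₀ hL1
    linarith
  have hqT : q * (T + 2) ≤ Y := by
    calc q * (T + 2) ≤ L ^ D * (3 * T) := by gcongr; linarith
      _ = Y := by rw [hT, hY]; ring
  refine (H q χ hχp hχ1 T Y u hT1 hqT hu).trans ?_
  have hLE : 0 < L ^ E := by positivity
  have t1 : u * Real.log u ^ 2 / T ≤ x / L ^ E := by
    calc u * Real.log u ^ 2 / T ≤ x * L ^ 2 / T := by gcongr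
      _ = x / L ^ E := by rw [hT, pow_add]; field_simp
  have t2 : T * Y ^ ε * u ^ (1 - c * Y ^ (-ε)) ≤ 3 * C' * (x / L ^ E) := by
    have h1 : u ^ (1 - c * Y ^ (-ε)) ≤ x * (C' / L ^ (2 * E + 3)) := by
      calc u ^ (1 - c * Y ^ (-ε)) ≤ x ^ (1 - c * Y ^ (-ε)) := by
            apply Real.rpow_le_rpow (by linarith) hux
            nlinarith
        _ ≤ x ^ (1 - c * (1 / (3 * √L))) := by
            apply Real.rpow_le_rpow_of_exponent_le (by linarith)
            gcongr
        _ = x * Real.exp (-(c / 3 * √L)) := by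
            rw [sub_eq_add_neg, Real.rpow_add hx0, Real.rpow_one, Real.rpow_def_of_pos hx0, hL]
            congr 2
            have h2 : L = √L * √L := (Real.mul_self_sqrt hL0.le).symm
            nth_rewrite 1 [h2]
            field_simp
        _ ≤ _ := by
            gcongr
            exact H' L hL1
    calc T * Y ^ ε * u ^ (1 - c * Y ^ (-ε)) ≤ L ^ (E + 2) * (3 * L) *
          (x * (C' / L ^ (2 * E + 3))) := by
          rw [hT]
          gcongr
      _ = 3 * C' * (x / L ^ E) := by
          field_simp
          ring
  have t3 : Y ^ ε * u / T ^ 2 ≤ 3 * (x / L ^ E) := by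
    calc Y ^ ε * u / T ^ 2 ≤ (3 * L) * x / (L ^ E * L) := by
          gcongr
          rw [hT, ← pow_succ, ← pow_mul]
          exact pow_le_pow_right₀ hL1 (by omega)
      _ = _ := by field_simp
  calc C * (u * Real.log u ^ 2 / T + T * Y ^ ε * u ^ (1 - c * Y ^ (-ε)) + Y ^ ε * u / T ^ 2) ≤
        C * (x / L ^ E + 3 * C' * (x / L ^ E) + 3 * (x / L ^ E)) := by gcongr
    _ = _ := by ring

/-- Twisted prime sums with tent weights, for all lengths up to `x`. -/
theorem exists_norm_sum_mul_vonMangoldt_mul_sub_le (D E : ℕ) : ∃ C : ℝ, 0 < C ∧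
    ∀ (q : ℕ) [NeZero q] (χ : DirichletCharacter ℂ q), χ.IsPrimitive → χ ≠ 1 →
    ∀ x u : ℝ, 3 ≤ x → q ≤ Real.log x ^ D → 3 ≤ u → u ≤ x →
      ‖∑ n ∈ Finset.Icc 1 ⌊u⌋₊, (χ n * (ArithmeticFunction.vonMangoldt n : ℂ)) *
        ((u - n : ℝ) : ℂ)‖ ≤ C * x ^ 2 / Real.log x ^ E := by
  obtain ⟨C, hC, H⟩ := exists_norm_sum_mul_vonMangoldt_mul_tent_le_log D E
  refine ⟨C, hC, fun q _ χ hχp hχ1 x u hx hq hu hux => ?_⟩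
  have hu0 : 0 < u := by linarith
  have hL1 := one_le_log hx
  have e : ∑ n ∈ Finset.Icc 1 ⌊u⌋₊, (χ n * (ArithmeticFunction.vonMangoldt n : ℂ)) *
      ((u - n : ℝ) : ℂ) = (u : ℂ) * ∑ n ∈ Finset.Icc 1 ⌊u⌋₊,
        (χ n * (ArithmeticFunction.vonMangoldt n : ℂ)) * ((1 - n / u : ℝ) : ℂ) := by
    rw [Finset.mul_sum]
    refine Finset.sum_congr rfl fun n _ => ?_
    rw [mul_left_comm, ← Complex.ofReal_mul]
    congr 3
    field_simp
  rw [e, norm_mul, Complex.norm_real, Real.norm_eq_abs, abs_of_pos hu0]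
  calc _ ≤ x * (C * x / Real.log x ^ E) := by
        gcongr
        exact H q χ hχp hχ1 x u hx hq hu hux
    _ = _ := by ring

/-- Removing the smoothing. -/
theorem sum_mul_sub_sub_eq (a : ℕ → ℂ) {N : ℕ} {h : ℝ} (hh : 0 ≤ h) :
    (∑ n ∈ Finset.Icc 1 ⌊N + h⌋₊, a n * ((N + h - n : ℝ) : ℂ)) -
      ∑ n ∈ Finset.Icc 1 N, a n * ((N - n : ℝ) : ℂ) =
      h * (∑ n ∈ Finset.Icc 1 N, a n) +
        ∑ n ∈ Finset.Ioc N ⌊N + h⌋₊, a n * ((N + h - n : ℝ) : ℂ) := by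
  have hN : N ≤ ⌊N + h⌋₊ := Nat.le_floor (by linarith)
  have e1 : ∀ k : ℕ, Finset.Icc 1 k = Finset.Ioc 0 k := fun k => by ext; simp; omega
  rw [e1, e1, ← Finset.sum_Ioc_consecutive _ (Nat.zero_le N) hN, Finset.mul_sum, add_sub_right_comm,
    ← Finset.sum_sub_distrib]
  congr 1
  refine Finset.sum_congr rfl fun n _ => ?_
  push_cast
  ring

theorem exists_norm_sum_mul_vonMangoldt_le (D E : ℕ) : ∃ C : ℝ, 0 < C ∧
    ∀ (q : ℕ) [NeZero q] (χ : DirichletCharacter ℂ q), χ.IsPrimitive → χ ≠ 1 →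
    ∀ (x : ℝ) (N : ℕ), 3 ≤ x → q ≤ Real.log x ^ D → (N : ℝ) ≤ x →
      ‖∑ n ∈ Finset.Icc 1 N, χ n * (ArithmeticFunction.vonMangoldt n : ℂ)‖ ≤
        C * x / Real.log x ^ E := by
  obtain ⟨C, hC, H⟩ := exists_norm_sum_mul_vonMangoldt_mul_sub_le D (2 * E + 1)
  obtain ⟨C', hC', H'⟩ := log_pow_le_mul_sqrt E
  refine ⟨8 * C + 2 + 2 * C', by positivity, ?_⟩
  intro q _ χ hχp hχ1 x N hx hq hN
  have hL1 := one_le_log hx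
  have hL0 : 0 < Real.log x := by linarith
  have hx0 : 0 < x := by linarith
  have hterm : ∀ n : ℕ, ‖χ n * (ArithmeticFunction.vonMangoldt n : ℂ)‖ ≤ Real.log n := by
    intro n
    rw [norm_mul, Complex.norm_real, Real.norm_of_nonneg ArithmeticFunction.vonMangoldt_nonneg]
    calc _ ≤ 1 * ArithmeticFunction.vonMangoldt n :=
          mul_le_mul_of_nonneg_right (χ.norm_le_one _) ArithmeticFunction.vonMangoldt_nonneg
      _ ≤ _ := by rw [one_mul]; exact ArithmeticFunction.vonMangoldt_le_log
  have hC'x : 1 ≤ C' * x / Real.log x ^ E := by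
    rw [le_div_iff₀ (by positivity), one_mul]
    refine (H' x (by linarith)).trans ?_
    gcongr
    exact Real.sqrt_le_iff.mpr ⟨hx0.le, by nlinarith⟩
  by_cases hN3 : N < 3
  · have h1 : ‖∑ n ∈ Finset.Icc 1 N, χ n * (ArithmeticFunction.vonMangoldt n : ℂ)‖ ≤ 2 := by
      calc _ ≤ ∑ n ∈ Finset.Icc 1 N, (1 : ℝ) := by
            refine norm_sum_le_of_le _ fun n hn => (hterm n).trans ?_
            rw [Finset.mem_Icc] at hn
            have hn2 : (n : ℝ) ≤ 2 := by exact_mod_cast (by omega : n ≤ 2)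
            have hn1 : (0 : ℝ) < n := by exact_mod_cast hn.1
            linarith [Real.log_le_sub_one_of_pos hn1]
        _ ≤ 2 := by
            simp only [Finset.sum_const, Nat.card_Icc, nsmul_eq_mul, mul_one]
            exact_mod_cast (by omega : N + 1 - 1 ≤ 2)
    have : (8 * C + 2 + 2 * C') * x / Real.log x ^ E =
      (8 * C + 2) * x / Real.log x ^ E + 2 * (C' * x / Real.log x ^ E) := by ring
    have h0 : 0 ≤ (8 * C + 2) * x / Real.log x ^ E := by positivity
    linarith
  · have hN3' : (3 : ℝ) ≤ N := by exact_mod_cast (by omega : 3 ≤ N)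
    obtain ⟨h, hh⟩ : ∃ h, h = x / Real.log x ^ (E + 1) := ⟨_, rfl⟩
    have hh0 : 0 < h := by rw [hh]; positivity
    have hhx : h ≤ x := by
      rw [hh]; exact div_le_self hx0.le (one_le_pow₀ hL1)
    have hlog2 : Real.log x ≤ Real.log (2 * x) := Real.log_le_log hx0 (by linarith)
    have hlog2' : Real.log (2 * x) ≤ 2 * Real.log x := by
      calc _ ≤ Real.log (x ^ 2) := Real.log_le_log (by linarith) (by nlinarith)
        _ = _ := by rw [Real.log_pow]; norm_num
    have hq2 : (q : ℝ) ≤ Real.log (2 * x) ^ D := hq.trans (by gcongr)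
    have key : ∀ u : ℝ, 3 ≤ u → u ≤ 2 * x →
        ‖∑ n ∈ Finset.Icc 1 ⌊u⌋₊, (χ n * (ArithmeticFunction.vonMangoldt n : ℂ)) *
          ((u - n : ℝ) : ℂ)‖ ≤ 4 * C * x ^ 2 / Real.log x ^ (2 * E + 1) := by
      intro u hu hux
      refine (H q χ hχp hχ1 (2 * x) u (by linarith) hq2 hu hux).trans ?_
      have : C * (2 * x) ^ 2 = 4 * C * x ^ 2 := by ring
      rw [this]
      gcongr
    have h1 := key N hN3' (by linarith)
    have h2 := key (N + h) (by linarith) (by linarith)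
    rw [Nat.floor_natCast] at h1
    have h3 := sum_mul_sub_sub_eq
      (fun n : ℕ => χ n * (ArithmeticFunction.vonMangoldt n : ℂ)) (N := N) hh0.le
    have hfl : (⌊(N : ℝ) + h⌋₊ : ℝ) ≤ N + h := Nat.floor_le (by positivity)
    have hNfl : N ≤ ⌊(N : ℝ) + h⌋₊ := Nat.le_floor (by linarith)
    have h4 : ‖∑ n ∈ Finset.Ioc N ⌊(N : ℝ) + h⌋₊,
        (χ n * (ArithmeticFunction.vonMangoldt n : ℂ)) * ((N + h - n : ℝ) : ℂ)‖ ≤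
        h * (2 * Real.log x * h) := by
      calc _ ≤ ∑ n ∈ Finset.Ioc N ⌊(N : ℝ) + h⌋₊, (2 * Real.log x * h) := by
            refine norm_sum_le_of_le _ fun n hn => ?_
            rw [Finset.mem_Ioc] at hn
            have hn2 : (n : ℝ) ≤ N + h := le_trans (by exact_mod_cast hn.2) hfl
            have hn1 : (N : ℝ) ≤ n := by exact_mod_cast hn.1.le
            rw [norm_mul, Complex.norm_real, Real.norm_of_nonneg (by linarith)]
            refine mul_le_mul ((hterm n).trans ?_) (by linarith) (by linarith) (by positivity)
            exact (Real.log_le_log (by linarith) (by linarith)).trans hlog2'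
        _ = ((⌊(N : ℝ) + h⌋₊ : ℝ) - N) * (2 * Real.log x * h) := by
            rw [Finset.sum_const, Nat.card_Ioc, nsmul_eq_mul, Nat.cast_sub hNfl]
        _ ≤ _ := by
            gcongr
            linarith
    obtain ⟨S, hS⟩ : ∃ S, S = ∑ n ∈ Finset.Icc 1 N, χ n *
      (ArithmeticFunction.vonMangoldt n : ℂ) := ⟨_, rfl⟩
    rw [← hS] at h3 ⊢
    have h5 : h * ‖S‖ ≤ 2 * (4 * C * x ^ 2 / Real.log x ^ (2 * E + 1)) +
        h * (2 * Real.log x * h) := by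
      have : ‖(h : ℂ) * S‖ = h * ‖S‖ := by
        rw [norm_mul, Complex.norm_real, Real.norm_of_nonneg hh0.le]
      rw [← this, ← sub_eq_iff_eq_add.mpr h3]
      refine (norm_sub_le _ _).trans ?_
      refine (add_le_add_left (norm_sub_le _ _) _).trans ?_
      linarith
    have h6 : 2 * (4 * C * x ^ 2 / Real.log x ^ (2 * E + 1)) + h * (2 * Real.log x * h) =
        h * ((8 * C + 2) * x / Real.log x ^ E) := by
      rw [hh]
      field_simp
      ring
    rw [h6] at h5
    refine (le_of_mul_le_mul_left h5 hh0).trans ?_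
    refine div_le_div_of_nonneg_right (mul_le_mul_of_nonneg_right ?_ hx0.le) (by positivity)
    linarith

theorem gam_natCast (n : ℕ) : gam n = if 2 < n ∧ n.Prime then Real.log n else 0 := by
  unfold gam
  have h1 : (2 < (n : ℤ) ∧ Prime (n : ℤ)) ↔ (2 < n ∧ n.Prime) := by
    rw [← Nat.prime_iff_prime_int]
    exact and_congr_left fun _ => by exact_mod_cast Iff.rfl
  simp only [h1, Int.cast_natCast]

theorem gam_nonneg (n : ℕ) : 0 ≤ gam n := by
  rw [gam_natCast]
  split_ifs
  · exact Real.log_natCast_nonneg n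
  · exact le_rfl

theorem gam_le_vonMangoldt (n : ℕ) : gam n ≤ ArithmeticFunction.vonMangoldt n := by
  rw [gam_natCast]
  split_ifs with h
  · rw [ArithmeticFunction.vonMangoldt_apply_prime h.2]
  · exact ArithmeticFunction.vonMangoldt_nonneg

theorem gam_le_log (n : ℕ) : gam n ≤ Real.log n :=
  (gam_le_vonMangoldt n).trans ArithmeticFunction.vonMangoldt_le_log

theorem sum_vonMangoldt_sub_gam_le {N : ℕ} (hN : 1 ≤ N) :
    ∑ n ∈ Finset.Icc 1 N, (ArithmeticFunction.vonMangoldt n - gam n) ≤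
      2 * √N * Real.log N + 1 := by
  have h1 := Chebyshev.psi_sub_theta_le (x := N) (by exact_mod_cast hN)
  have hI : ∀ f : ℕ → ℝ, f 0 = 0 →
      ∑ n ∈ Finset.Icc 0 N, f n = ∑ n ∈ Finset.Icc 1 N, f n := by
    intro f hf
    rw [← Finset.insert_Icc_add_one_left_eq_Icc (Nat.zero_le N), Finset.sum_insert (by simp), hf,
      zero_add, zero_add]
  rw [Chebyshev.psi_eq_sum_Icc, Chebyshev.theta_eq_sum_Icc, Nat.floor_natCast,
    Finset.sum_filter, hI _ (by simp), hI _ (by simp)] at h1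
  have h2 : ∑ n ∈ Finset.Icc 1 N, (if n.Prime then Real.log n else 0) ≤
      ∑ n ∈ Finset.Icc 1 N, gam n + 1 := by
    calc _ ≤ ∑ n ∈ Finset.Icc 1 N, (gam n + if n = 2 then 1 else 0) := by
          refine Finset.sum_le_sum fun n hn => ?_
          rw [gam_natCast]
          by_cases hp : n.Prime
          · by_cases h2 : n = 2
            · subst h2
              have := Real.log_two_lt_d9
              norm_num
              linarith
            · have : 2 < n := lt_of_le_of_ne hp.two_le (Ne.symm h2)
              simp [hp, this, h2]
          · simp only [hp, and_false, if_false, zero_add]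
            split_ifs <;> norm_num
      _ ≤ _ := by
          rw [Finset.sum_add_distrib, Finset.sum_ite_eq']
          gcongr
          split_ifs <;> norm_num
  rw [Finset.sum_sub_distrib]
  linarith

/-- The Siegel–Walfisz theorem for primitive characters. -/
theorem exists_norm_sum_mul_gam_le (D E : ℕ) : ∃ C : ℝ, 0 < C ∧
    ∀ (q : ℕ) [NeZero q] (χ : DirichletCharacter ℂ q), χ.IsPrimitive → χ ≠ 1 →
    ∀ (x : ℝ) (N : ℕ), 3 ≤ x → q ≤ Real.log x ^ D → (N : ℝ) ≤ x →
      ‖∑ n ∈ Finset.Icc 1 N, χ n * (gam n : ℂ)‖ ≤ C * x / Real.log x ^ E := by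
  obtain ⟨C, hC, H⟩ := exists_norm_sum_mul_vonMangoldt_le D E
  obtain ⟨C', hC', H'⟩ := log_pow_le_mul_sqrt (E + 1)
  refine ⟨C + 3 * C', by positivity, ?_⟩
  intro q _ χ hχp hχ1 x N hx hq hN
  have hL1 := one_le_log hx
  have hL0 : 0 < Real.log x := by linarith
  have hx0 : 0 < x := by linarith
  rcases Nat.eq_zero_or_pos N with rfl | hN0
  · simp
    positivity
  have h1 := H q χ hχp hχ1 x N hx hq hN
  have h2 : ‖∑ n ∈ Finset.Icc 1 N, χ n * ((ArithmeticFunction.vonMangoldt n - gam n : ℝ) : ℂ)‖ ≤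
      3 * C' * x / Real.log x ^ E := by
    calc _ ≤ ∑ n ∈ Finset.Icc 1 N, (ArithmeticFunction.vonMangoldt n - gam n) := by
          refine norm_sum_le_of_le _ fun n hn => ?_
          have h0 : 0 ≤ ArithmeticFunction.vonMangoldt n - gam n :=
            sub_nonneg.mpr (gam_le_vonMangoldt n)
          rw [norm_mul, Complex.norm_real, Real.norm_of_nonneg h0]
          exact mul_le_of_le_one_left h0 (χ.norm_le_one _)
      _ ≤ 2 * √N * Real.log N + 1 := sum_vonMangoldt_sub_gam_le hN0
      _ ≤ 2 * √x * Real.log x + √x * Real.log x := by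
          have hs : 1 ≤ √x := Real.one_le_sqrt.mpr (by linarith)
          have : (1 : ℝ) ≤ N := by exact_mod_cast hN0
          gcongr
          nlinarith
      _ = 3 * √x * Real.log x := by ring
      _ ≤ _ := by
          rw [le_div_iff₀ (by positivity)]
          have h3 := H' x (by linarith)
          calc 3 * √x * Real.log x * Real.log x ^ E = 3 * √x * Real.log x ^ (E + 1) := by ring
            _ ≤ 3 * √x * (C' * √x) := by gcongr
            _ = 3 * C' * (√x * √x) := by ring
            _ = _ := by rw [Real.mul_self_sqrt hx0.le]
  have h3 : ∑ n ∈ Finset.Icc 1 N, χ n * (gam n : ℂ) =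
      ∑ n ∈ Finset.Icc 1 N, χ n * (ArithmeticFunction.vonMangoldt n : ℂ) -
      ∑ n ∈ Finset.Icc 1 N, χ n * ((ArithmeticFunction.vonMangoldt n - gam n : ℝ) : ℂ) := by
    rw [← Finset.sum_sub_distrib]
    refine Finset.sum_congr rfl fun n _ => ?_
    push_cast
    ring
  rw [h3]
  refine (norm_sub_le _ _).trans ((add_le_add h1 h2).trans (le_of_eq ?_))
  ring

theorem star_dirichletCharacter_apply {q : ℕ} (χ : DirichletCharacter ℂ q) [NeZero q] (a : ZMod q) :
    (starRingEnd ℂ) (χ a) = χ⁻¹ a := by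
  rw [← MulChar.star_eq_inv, MulChar.star_apply, RCLike.star_def]

theorem sum_dirichletCharacter_mul_inv {q : ℕ} [NeZero q] (c d : ZMod q) :
    ∑ χ : DirichletCharacter ℂ q, χ c * χ⁻¹ d =
      if IsUnit c ∧ c = d then (q.totient : ℂ) else 0 := by
  by_cases hd : IsUnit d
  · have h := DirichletCharacter.sum_char_inv_mul_char_eq ℂ hd c
    have h2 : ∀ χ : DirichletCharacter ℂ q, χ⁻¹ d = χ d⁻¹ := by
      intro χ
      obtain ⟨u, rfl⟩ := hd
      rw [MulChar.inv_apply_eq_inv, ZMod.inv_coe_unit]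
      exact (Ring.inverse_unit (Units.map (χ : ZMod q →* ℂ) u)).trans (by simp)
    simp only [h2]
    rw [← Finset.sum_congr rfl fun χ _ => mul_comm (χ d⁻¹) (χ c), h]
    by_cases hcd : c = d
    · subst hcd; simp [hd]
    · simp [hcd, Ne.symm hcd]
  · have h2 : ∀ χ : DirichletCharacter ℂ q, χ⁻¹ d = 0 := fun χ => MulChar.map_nonunit _ hd
    have h3 : ¬ (IsUnit c ∧ c = d) := fun h => hd (h.2 ▸ h.1)
    simp [h2, h3]

/-- Plancherel for the group of Dirichlet characters. -/
theorem sum_dirichletCharacter_norm_sq {q : ℕ} [NeZero q] (f : ZMod q → ℂ) :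
    ∑ χ : DirichletCharacter ℂ q, ‖∑ c, χ c * f c‖ ^ 2 =
      q.totient * ∑ c : ZMod q, if IsUnit c then ‖f c‖ ^ 2 else 0 := by
  have h : ∀ χ : DirichletCharacter ℂ q, ((‖∑ c, χ c * f c‖ ^ 2 : ℝ) : ℂ) =
      ∑ c, ∑ d, (χ c * χ⁻¹ d) * (f c * (starRingEnd ℂ) (f d)) := by
    intro χ
    push_cast
    rw [← Complex.mul_conj', map_sum, Finset.sum_mul_sum]
    refine Finset.sum_congr rfl fun c _ => Finset.sum_congr rfl fun d _ => ?_
    rw [map_mul, star_dirichletCharacter_apply]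
    ring
  apply Complex.ofReal_injective
  rw [Complex.ofReal_sum, Finset.sum_congr rfl fun χ _ => h χ, Finset.sum_comm]
  push_cast
  rw [Finset.mul_sum]
  refine Finset.sum_congr rfl fun c _ => ?_
  rw [Finset.sum_comm]
  simp only [← Finset.sum_mul, sum_dirichletCharacter_mul_inv]
  by_cases hc : IsUnit c
  · simp [hc, Complex.mul_conj']
  · simp [hc]

theorem norm_gaussSum_sq {q : ℕ} [NeZero q] {χ : DirichletCharacter ℂ q} (hχ : χ.IsPrimitive) :
    ‖gaussSum χ ZMod.stdAddChar‖ ^ 2 = q := by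
  have h1 := congr_fun (ZMod.dft_dft (fun j => χ j)) (-1)
  have h2 : ∀ k, ZMod.dft (fun j => χ j) k = χ⁻¹ (-k) * gaussSum χ ZMod.stdAddChar := fun k => 
    DirichletCharacter.IsPrimitive.fourierTransform_eq_inv_mul_gaussSum hχ k
  rw [funext h2, ZMod.dft_apply] at h1
  apply Complex.ofReal_injective
  push_cast
  rw [← Complex.mul_conj']
  have h3 := star_gaussSum_eq χ ZMod.stdAddChar
  simp only [RCLike.star_def] at h3
  rw [h3]
  simp only [neg_neg, map_one, smul_eq_mul, mul_one] at h1
  rw [← h1]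
  generalize gaussSum χ ZMod.stdAddChar = τ
  rw [gaussSum, Finset.mul_sum, ← Equiv.sum_comp (Equiv.neg (ZMod q))]
  refine Finset.sum_congr rfl fun j _ => ?_
  simp [AddChar.inv_apply]
  ring

theorem sum_primitive_norm_sq_le {r : ℕ} [NeZero r] (s : Finset ℕ) (a : ℕ → ℂ) :
    (r : ℝ) * ∑ χ : DirichletCharacter ℂ r with χ.IsPrimitive, ‖∑ n ∈ s, a n * χ n‖ ^ 2 ≤
      r.totient * ∑ c : ZMod r, if IsUnit c then ‖∑ n ∈ s, a n * ZMod.stdAddChar (c * (n : ZMod r))‖ ^ 2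
        else 0 := by
  rw [← sum_dirichletCharacter_norm_sq, ← Equiv.sum_comp (Equiv.inv (DirichletCharacter ℂ r)),
    Finset.mul_sum]
  refine (Finset.sum_le_sum fun χ hχ => ?_).trans
    (Finset.sum_le_univ_sum_of_nonneg (s := Finset.univ.filter fun χ : DirichletCharacter ℂ r =>
      χ.IsPrimitive) fun χ => by positivity)
  have hχp := (Finset.mem_filter.mp hχ).2
  have hχp' : (χ⁻¹).IsPrimitive := by
    rw [DirichletCharacter.isPrimitive_def] at hχp ⊢
    rw [DirichletCharacter.conductor_inv, hχp]
  rw [← norm_gaussSum_sq hχp', ← mul_pow, ← norm_mul, Finset.mul_sum]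
  refine le_of_eq ?_
  congr 2
  simp only [Equiv.inv_apply, Finset.mul_sum]
  rw [Finset.sum_comm]
  refine Finset.sum_congr rfl fun n _ => ?_
  have h := gaussSum_mulShift_of_isPrimitive ZMod.stdAddChar hχp' (n : ZMod r)
  rw [inv_inv] at h
  rw [mul_left_comm, mul_comm (gaussSum _ _), ← h, gaussSum, Finset.mul_sum]
  refine Finset.sum_congr rfl fun c _ => ?_
  rw [AddChar.mulShift_apply, mul_comm (n : ZMod r)]
  ring

theorem integral_exp_two_pi_mul (k : ℤ) :
    ∫ t in (-1 : ℝ)..2, Complex.exp (2 * Real.pi * Complex.I * k * t) = if k = 0 then 3 else 0 := by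
  split_ifs with hk
  · subst hk
    simp
    norm_num
  · have hc : (2 * Real.pi * Complex.I * k : ℂ) ≠ 0 := by
      have : (k : ℂ) ≠ 0 := by exact_mod_cast hk
      have := Complex.two_pi_I_ne_zero
      positivity
    rw [integral_exp_mul_complex hc]
    have h1 : Complex.exp (2 * Real.pi * Complex.I * k * (2 : ℝ)) = 1 := by
      rw [Complex.exp_eq_one_iff]
      exact ⟨2 * k, by push_cast; ring⟩
    have h2 : Complex.exp (2 * Real.pi * Complex.I * k * (-1 : ℝ)) = 1 := by
      rw [Complex.exp_eq_one_iff]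
      exact ⟨-k, by push_cast; ring⟩
    rw [h1, h2, sub_self, zero_div]

noncomputable def expSum (s : Finset ℕ) (a : ℕ → ℂ) (t : ℝ) : ℂ :=
  ∑ n ∈ s, a n * Complex.exp (2 * Real.pi * Complex.I * n * t)

theorem continuous_expSum (s : Finset ℕ) (a : ℕ → ℂ) : Continuous (expSum s a) := by
  unfold expSum
  fun_prop

theorem hasDerivAt_expSum (s : Finset ℕ) (a : ℕ → ℂ) (t : ℝ) :
    HasDerivAt (expSum s a) (expSum s (fun n => 2 * Real.pi * Complex.I * n * a n) t) t := by
  unfold expSum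
  refine HasDerivAt.fun_sum fun n _ => ?_
  have h1 : HasDerivAt (fun t : ℝ => (2 * Real.pi * Complex.I * n * t : ℂ))
      (2 * Real.pi * Complex.I * n) t := by
    simpa using (Complex.ofRealCLM.hasDerivAt (x := t)).const_mul (2 * Real.pi * Complex.I * n : ℂ)
  exact ((h1.cexp).const_mul (a n)).congr_deriv (by ring)

theorem integral_norm_sq_expSum (s : Finset ℕ) (a : ℕ → ℂ) :
    ∫ t in (-1 : ℝ)..2, ‖expSum s a t‖ ^ 2 = 3 * ∑ n ∈ s, ‖a n‖ ^ 2 := by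
  have h : ∀ t : ℝ, ((‖expSum s a t‖ ^ 2 : ℝ) : ℂ) = ∑ m ∈ s, ∑ n ∈ s,
      (a m * (starRingEnd ℂ) (a n)) *
        Complex.exp (2 * Real.pi * Complex.I * ((m - n : ℤ) : ℂ) * t) := by
    intro t
    push_cast
    rw [← Complex.mul_conj', expSum, map_sum, Finset.sum_mul_sum]
    refine Finset.sum_congr rfl fun m _ => Finset.sum_congr rfl fun n _ => ?_
    rw [map_mul, ← Complex.exp_conj, mul_mul_mul_comm, ← Complex.exp_add]
    congr 2
    simp only [map_mul, Complex.conj_ofReal, Complex.conj_I, Complex.conj_natCast, Complex.conj_ofNat]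
    ring
  apply Complex.ofReal_injective
  rw [← intervalIntegral.integral_ofReal]
  simp only [h]
  rw [intervalIntegral.integral_finsetSum fun m _ => by
    apply Continuous.intervalIntegrable; fun_prop]
  push_cast
  rw [Finset.mul_sum]
  refine Finset.sum_congr rfl fun m hm => ?_
  rw [intervalIntegral.integral_finsetSum fun m _ => by
    apply Continuous.intervalIntegrable; fun_prop]
  simp only [intervalIntegral.integral_const_mul]
  have h2 : ∀ n : ℕ, ∫ t in (-1 : ℝ)..2, Complex.exp (2 * Real.pi * Complex.I *
      (m - n : ℂ) * t) = if (m - n : ℤ) = 0 then 3 else 0 := fun n => by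
    simpa only [Int.cast_sub, Int.cast_natCast] using integral_exp_two_pi_mul (m - n : ℤ)
  simp only [h2]
  rw [Finset.sum_eq_single_of_mem m hm]
  · simp [Complex.mul_conj']
    ring
  · intro n _ hn
    have : ((m : ℤ) - n) ≠ 0 := by omega
    simp [this]

theorem mul_norm_sq_le_integral {f f' : ℝ → ℂ} (hf : ∀ t, HasDerivAt f (f' t) t)
    (hf' : Continuous f') (α : ℝ) {δ : ℝ} (hδ : 0 < δ) :
    δ * ‖f α‖ ^ 2 ≤ ∫ t in (α - δ / 2)..(α + δ / 2), (‖f t‖ ^ 2 + δ * (2 * ‖f t‖ * ‖f' t‖)) := by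
  have hfc : Continuous f := continuous_iff_continuousAt.mpr fun t => (hf t).continuousAt
  have hle : α - δ / 2 ≤ α + δ / 2 := by linarith
  obtain ⟨J, hJ⟩ : ∃ J, J = ∫ t in (α - δ / 2)..(α + δ / 2), (2 * ‖f t‖ * ‖f' t‖) := ⟨_, rfl⟩
  have hpt : ∀ t ∈ Set.Icc (α - δ / 2) (α + δ / 2), ‖f α‖ ^ 2 - J ≤ ‖f t‖ ^ 2 := by
    intro t ht
    have h1 : ∫ u in t..α, 2 * f u * f' u = f α ^ 2 - f t ^ 2 := by
      rw [intervalIntegral.integral_eq_sub_of_hasDerivAt (f := fun u => f u ^ 2)]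
      · intro u _
        simpa using (hf u).fun_pow 2
      · apply Continuous.intervalIntegrable; fun_prop
    have h2 : ‖∫ u in t..α, 2 * f u * f' u‖ ≤ J := by
      refine (intervalIntegral.norm_integral_le_abs_integral_norm).trans ?_
      rw [hJ]
      have h3 : ∀ u, ‖2 * f u * f' u‖ = 2 * ‖f u‖ * ‖f' u‖ := by intro u; simp
      simp only [h3]
      rw [← abs_of_nonneg (intervalIntegral.integral_nonneg hle (f := fun t => 2 * ‖f t‖ * ‖f' t‖)
        fun u _ => by positivity)]
      refine intervalIntegral.abs_integral_mono_interval ?_ ?_ ?_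
      · rw [Set.uIoc_of_le hle]
        refine Set.Ioc_subset_Ioc ?_ ?_
        · exact le_min ht.1 (by linarith)
        · exact max_le ht.2 (by linarith)
      · exact Filter.Eventually.of_forall fun u => by simp only [Pi.zero_apply]; positivity
      · apply Continuous.intervalIntegrable; fun_prop
    rw [h1] at h2
    have h4 : ‖f α ^ 2‖ ≤ ‖f t ^ 2‖ + ‖f α ^ 2 - f t ^ 2‖ := by
      have := norm_add_le (f t ^ 2) (f α ^ 2 - f t ^ 2)
      simpa using this
    rw [norm_pow, norm_pow] at h4
    linarith
  have h5 : ∫ t in (α - δ / 2)..(α + δ / 2), (‖f α‖ ^ 2 - J) ≤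
      ∫ t in (α - δ / 2)..(α + δ / 2), ‖f t‖ ^ 2 := by
    refine intervalIntegral.integral_mono_on hle ?_ ?_ hpt <;>
    · apply Continuous.intervalIntegrable; fun_prop
  rw [intervalIntegral.integral_const, smul_eq_mul] at h5
  rw [intervalIntegral.integral_add, intervalIntegral.integral_const_mul, ← hJ]
  · nlinarith
  all_goals apply Continuous.intervalIntegrable; fun_prop

/-- The large sieve inequality for well-spaced points. -/
theorem sum_norm_sq_expSum_le {ι : Type*} (P : Finset ι) (α : ι → ℝ) {δ : ℝ} (hδ : 0 < δ)
    (hδ1 : δ ≤ 1) (hα0 : ∀ i ∈ P, 0 ≤ α i) (hα1 : ∀ i ∈ P, α i ≤ 1)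
    (hsep : ∀ i ∈ P, ∀ j ∈ P, i ≠ j → δ ≤ |α i - α j|) {N : ℕ} (hN : 1 ≤ N) (s : Finset ℕ)
    (hs : ∀ n ∈ s, n ≤ N) (a : ℕ → ℂ) :
    ∑ i ∈ P, ‖expSum s a (α i)‖ ^ 2 ≤ 130 * (δ⁻¹ + N) * ∑ n ∈ s, ‖a n‖ ^ 2 := by
  obtain ⟨a', ha'⟩ : ∃ a' : ℕ → ℂ, a' = fun n => 2 * Real.pi * Complex.I * n * a n := ⟨_, rfl⟩
  have hN0 : (0 : ℝ) < N := by exact_mod_cast hN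
  have hc1 := continuous_expSum s a
  have hc2 := continuous_expSum s a'
  obtain ⟨g, hg⟩ : ∃ g : ℝ → ℝ, g = fun t => (1 + δ * N) * ‖expSum s a t‖ ^ 2 +
    δ * (N : ℝ)⁻¹ * ‖expSum s a' t‖ ^ 2 := ⟨_, rfl⟩
  have hgc : Continuous g := by rw [hg]; fun_prop
  have hg0 : ∀ t, 0 ≤ g t := fun t => by rw [hg]; positivity
  have h1 : ∀ i, δ * ‖expSum s a (α i)‖ ^ 2 ≤
      ∫ t in Set.Ioc (α i - δ / 2) (α i + δ / 2), g t := by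
    intro i
    refine (mul_norm_sq_le_integral (hasDerivAt_expSum s a)
      (continuous_expSum _ _) (α i) hδ).trans ?_
    rw [← ha', ← intervalIntegral.integral_of_le (by linarith)]
    refine intervalIntegral.integral_mono_on (by linarith) ?_ ?_ fun t _ => ?_
    · apply Continuous.intervalIntegrable; fun_prop
    · exact hgc.intervalIntegrable _ _
    · simp only [hg]
      generalize ‖expSum s a t‖ = u
      generalize ‖expSum s a' t‖ = v
      have : 2 * u * v ≤ N * u ^ 2 + (N : ℝ)⁻¹ * v ^ 2 := by
        have h := sq_nonneg (N * u - v)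
        have h2 : N * u ^ 2 + (N : ℝ)⁻¹ * v ^ 2 - 2 * u * v = (N : ℝ)⁻¹ * (N * u - v) ^ 2 := by
          field_simp
          ring
        have h3 : 0 ≤ (N : ℝ)⁻¹ * (N * u - v) ^ 2 := by positivity
        linarith
      nlinarith
  have h2 : ∑ i ∈ P, ∫ t in Set.Ioc (α i - δ / 2) (α i + δ / 2), g t ≤
      ∫ t in (-1 : ℝ)..2, g t := by
    rw [← MeasureTheory.integral_biUnion_finset]
    · rw [intervalIntegral.integral_of_le (by norm_num)]
      refine MeasureTheory.setIntegral_mono_set ?_ ?_ ?_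
      · exact (hgc.intervalIntegrable (-1) 2).1
      · exact Filter.Eventually.of_forall hg0
      · refine Filter.Eventually.of_forall ?_
        refine Set.iUnion₂_subset fun i hi => ?_
        have := hα0 i hi
        have := hα1 i hi
        exact Set.Ioc_subset_Ioc (by linarith) (by linarith)
    · exact fun i _ => measurableSet_Ioc
    · intro i hi j hj hij
      have h := hsep i hi j hj hij
      rw [Function.onFun, Set.disjoint_left]
      intro t ht ht'
      rw [Set.mem_Ioc] at ht ht'
      rcases le_abs.mp h with h | h <;> linarith
    · intro i hi
      exact (hgc.intervalIntegrable (α i - δ / 2) (α i + δ / 2)).1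
  have h3 : ∫ t in (-1 : ℝ)..2, g t = (1 + δ * N) * (3 * ∑ n ∈ s, ‖a n‖ ^ 2) +
      δ * (N : ℝ)⁻¹ * (3 * ∑ n ∈ s, ‖a' n‖ ^ 2) := by
    rw [hg, intervalIntegral.integral_add, intervalIntegral.integral_const_mul,
      intervalIntegral.integral_const_mul, integral_norm_sq_expSum, integral_norm_sq_expSum]
    all_goals apply Continuous.intervalIntegrable; fun_prop
  have h4 : ∑ n ∈ s, ‖a' n‖ ^ 2 ≤ 40 * N ^ 2 * ∑ n ∈ s, ‖a n‖ ^ 2 := by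
    rw [Finset.mul_sum]
    refine Finset.sum_le_sum fun n hn => ?_
    have hn' : (n : ℝ) ≤ N := by exact_mod_cast hs n hn
    have hpi := Real.pi_lt_d2
    have hpi0 := Real.pi_pos
    rw [ha']
    simp only [norm_mul, Complex.norm_ofNat, Complex.norm_real, Complex.norm_I, mul_one,
      Complex.norm_natCast, Real.norm_of_nonneg hpi0.le, mul_pow]
    gcongr
    nlinarith
  have h5 : δ * ∑ i ∈ P, ‖expSum s a (α i)‖ ^ 2 ≤
      δ * (130 * (δ⁻¹ + N) * ∑ n ∈ s, ‖a n‖ ^ 2) := by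
    rw [Finset.mul_sum]
    refine (Finset.sum_le_sum fun i _ => h1 i).trans (h2.trans ?_)
    rw [h3]
    have h0 : 0 ≤ ∑ n ∈ s, ‖a n‖ ^ 2 := by positivity
    have h6 : δ * (N : ℝ)⁻¹ * (3 * ∑ n ∈ s, ‖a' n‖ ^ 2) ≤
        δ * (N : ℝ)⁻¹ * (3 * (40 * N ^ 2 * ∑ n ∈ s, ‖a n‖ ^ 2)) := by gcongr
    refine (add_le_add_right h6 _).trans ?_
    have h7 : δ * (N : ℝ)⁻¹ * (3 * (40 * N ^ 2 * ∑ n ∈ s, ‖a n‖ ^ 2)) =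
      120 * (δ * N * ∑ n ∈ s, ‖a n‖ ^ 2) := by field_simp; ring
    have h8 : δ * (130 * (δ⁻¹ + N) * ∑ n ∈ s, ‖a n‖ ^ 2) =
      130 * ∑ n ∈ s, ‖a n‖ ^ 2 + 130 * (δ * N * ∑ n ∈ s, ‖a n‖ ^ 2) := by field_simp
    have h9 : 0 ≤ δ * N * ∑ n ∈ s, ‖a n‖ ^ 2 := by positivity
    rw [h7, h8]
    nlinarith
  exact le_of_mul_le_mul_left h5 hδ

theorem sum_stdAddChar_eq_expSum {r : ℕ} [NeZero r] (s : Finset ℕ) (a : ℕ → ℂ) (c : ZMod r) :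
    ∑ n ∈ s, a n * ZMod.stdAddChar (c * (n : ZMod r)) = expSum s a ((c.val : ℝ) / r) := by
  refine Finset.sum_congr rfl fun n _ => ?_
  have h : c * (n : ZMod r) = (((c.val * n : ℕ) : ℤ) : ZMod r) := by
    push_cast
    rw [ZMod.natCast_zmod_val]
  rw [h, ZMod.stdAddChar_coe]
  congr 2
  push_cast
  ring

theorem sum_isUnit_eq_sum_coprime {r : ℕ} [NeZero r] (f : ℕ → ℝ) :
    ∑ c : ZMod r, (if IsUnit c then f c.val else 0) =
      ∑ b ∈ Finset.range r with b.Coprime r, f b := by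
  rw [← Finset.sum_filter]
  refine Finset.sum_nbij (fun c => c.val) ?_ ?_ ?_ ?_
  · intro c hc
    have hc := (Finset.mem_filter.mp hc).2
    rw [Finset.mem_filter, Finset.mem_range]
    exact ⟨c.val_lt, by
      obtain ⟨u, rfl⟩ := hc
      exact ZMod.val_coe_unit_coprime u⟩
  · exact fun _ _ _ _ h => ZMod.val_injective r h
  · intro b hb
    rw [Finset.mem_coe, Finset.mem_filter, Finset.mem_range] at hb
    refine ⟨(b : ZMod r), ?_, ZMod.val_cast_of_lt hb.1⟩
    simpa using (ZMod.isUnit_iff_coprime b r).mpr hb.2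
  · exact fun _ _ => rfl

theorem sum_farey_norm_sq_expSum_le {R N : ℕ} (hR : 1 ≤ R) (hN : 1 ≤ N) (s : Finset ℕ)
    (hs : ∀ n ∈ s, n ≤ N) (a : ℕ → ℂ) :
    ∑ r ∈ Finset.Icc 1 R, ∑ b ∈ Finset.range r with b.Coprime r, ‖expSum s a ((b : ℝ) / r)‖ ^ 2 ≤
      130 * (R ^ 2 + N) * ∑ n ∈ s, ‖a n‖ ^ 2 := by
  have hR1 : (1 : ℝ) ≤ R := by exact_mod_cast hR
  rw [Finset.sum_sigma']
  have h := sum_norm_sq_expSum_le ((Finset.Icc 1 R).sigma fun r =>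
    (Finset.range r).filter fun b => b.Coprime r) (fun i => (i.2 : ℝ) / i.1)
    (δ := ((R : ℝ) ^ 2)⁻¹) (by positivity) (inv_le_one_of_one_le₀ (one_le_pow₀ hR1)) ?_ ?_ ?_ hN s hs a
  · rwa [inv_inv] at h
  · intro i _
    positivity
  · intro i hi
    rw [Finset.mem_sigma, Finset.mem_filter, Finset.mem_range] at hi
    exact div_le_one_of_le₀ (by exact_mod_cast hi.2.1.le) (by positivity)
  · rintro ⟨r, b⟩ hi ⟨r', b'⟩ hj hij
    rw [Finset.mem_sigma, Finset.mem_filter, Finset.mem_range, Finset.mem_Icc] at hi hj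
    obtain ⟨⟨hr1, hrR⟩, hb, hc⟩ := hi
    obtain ⟨⟨hr1', hrR'⟩, hb', hc'⟩ := hj
    simp only at hr1 hrR hb hc hr1' hrR' hb' hc' ⊢
    have hr0 : (0 : ℝ) < r := by exact_mod_cast hr1
    have hr0' : (0 : ℝ) < r' := by exact_mod_cast hr1'
    have hrR2 : (r : ℝ) ≤ R := by exact_mod_cast hrR
    have hrR2' : (r' : ℝ) ≤ R := by exact_mod_cast hrR'
    have hne : (b * r' - r * b' : ℤ) ≠ 0 := by
      intro h0
      have h1 : b * r' = r * b' := by exact_mod_cast sub_eq_zero.mp h0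
      have h2 : r ∣ r' := hc.symm.dvd_of_dvd_mul_left ⟨b', h1⟩
      have h3 : r' ∣ r := hc'.symm.dvd_of_dvd_mul_right ⟨b, by rw [← h1, mul_comm]⟩
      obtain rfl := Nat.dvd_antisymm h2 h3
      rw [mul_comm] at h1
      obtain rfl := Nat.eq_of_mul_eq_mul_left hr1 h1
      exact hij rfl
    have h1 : (1 : ℝ) ≤ |(b * r' - r * b' : ℝ)| := by
      have := Int.one_le_abs hne
      exact_mod_cast this
    rw [div_sub_div _ _ hr0.ne' hr0'.ne', abs_div, abs_of_pos (mul_pos hr0 hr0'), inv_eq_one_div,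
      div_le_div_iff₀ (by positivity) (by positivity)]
    calc 1 * ((r : ℝ) * r') ≤ 1 * (R * R) := by gcongr
      _ = 1 * (R : ℝ) ^ 2 := by ring
      _ ≤ _ := by gcongr

/-- The multiplicative large sieve inequality. -/
theorem large_sieve {R N : ℕ} (hR : 1 ≤ R) (hN : 1 ≤ N) (s : Finset ℕ)
    (hs : ∀ n ∈ s, n ≤ N) (a : ℕ → ℂ) :
    ∑ r ∈ Finset.Icc 1 R, (r : ℝ) / r.totient *
      ∑ χ : DirichletCharacter ℂ r with χ.IsPrimitive, ‖∑ n ∈ s, a n * χ n‖ ^ 2 ≤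
      130 * (R ^ 2 + N) * ∑ n ∈ s, ‖a n‖ ^ 2 := by
  refine (Finset.sum_le_sum fun r hr => ?_).trans (sum_farey_norm_sq_expSum_le hR hN s hs a)
  have hr1 := (Finset.mem_Icc.mp hr).1
  have : NeZero r := ⟨by omega⟩
  have hφ : (0 : ℝ) < r.totient := by exact_mod_cast Nat.totient_pos.mpr hr1
  rw [div_mul_eq_mul_div, div_le_iff₀ hφ, ← sum_isUnit_eq_sum_coprime
    (fun b : ℕ => ‖expSum s a ((b : ℝ) / r)‖ ^ 2), mul_comm _ (r.totient : ℝ)]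
  refine (sum_primitive_norm_sq_le s a).trans (le_of_eq ?_)
  simp only [sum_stdAddChar_eq_expSum]

theorem sum_gam_not_coprime_le {q : ℕ} (hq : q ≠ 0) (s : Finset ℕ) :
    ∑ n ∈ s with ¬ n.Coprime q, gam n ≤ Real.log q := by
  have h1 : ∑ n ∈ s with ¬ n.Coprime q, gam n ≤ ∑ p ∈ q.primeFactors, Real.log p := by
    calc ∑ n ∈ s with ¬ n.Coprime q, gam n
        ≤ ∑ n ∈ s with ¬ n.Coprime q, if n ∈ q.primeFactors then Real.log n else 0 := by
          refine Finset.sum_le_sum fun n hn => ?_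
          have hn := (Finset.mem_filter.mp hn).2
          rw [gam_natCast]
          by_cases h : 2 < n ∧ n.Prime
          · have h2 : n ∈ q.primeFactors := Nat.mem_primeFactors.mpr
              ⟨h.2, by by_contra h3; exact hn ((Nat.Prime.coprime_iff_not_dvd h.2).mpr h3), hq⟩
            simp [h, h2]
          · simp only [h, if_false]
            split_ifs
            · exact Real.log_natCast_nonneg n
            · exact le_rfl
      _ = ∑ n ∈ (s.filter fun n => ¬ n.Coprime q).filter (· ∈ q.primeFactors), Real.log n := by
          rw [Finset.sum_filter (fun n => n ∈ q.primeFactors)]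
      _ ≤ _ := by
          refine Finset.sum_le_sum_of_subset_of_nonneg (fun n hn => (Finset.mem_filter.mp hn).2) ?_
          exact fun n _ _ => Real.log_natCast_nonneg n
  refine h1.trans ?_
  rw [← Real.log_prod fun p hp => by
    exact_mod_cast (Nat.prime_of_mem_primeFactors hp).ne_zero]
  refine Real.log_le_log (Finset.prod_pos fun p hp => by
    exact_mod_cast (Nat.prime_of_mem_primeFactors hp).pos) ?_
  rw [← Nat.cast_prod]
  exact_mod_cast Nat.le_of_dvd (Nat.pos_of_ne_zero hq) (Nat.prod_primeFactors_dvd q)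

noncomputable def charSum {q : ℕ} (χ : DirichletCharacter ℂ q) (u : ℕ) : ℂ :=
  ∑ n ∈ Finset.Icc 1 u, (gam n : ℂ) * χ n

theorem norm_charSum_sub_primitiveCharacter_le {q : ℕ} (hq : q ≠ 0) (χ : DirichletCharacter ℂ q)
    (u : ℕ) : ‖charSum χ u - charSum χ.primitiveCharacter u‖ ≤ Real.log q := by
  refine le_trans ?_ (sum_gam_not_coprime_le hq (Finset.Icc 1 u))
  rw [charSum, charSum, ← Finset.sum_sub_distrib, Finset.sum_filter]
  refine norm_sum_le_of_le _ fun n _ => ?_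
  by_cases h : n.Coprime q
  · rw [← changeLevel_natCast χ.conductor_dvd_level χ.primitiveCharacter h,
      DirichletCharacter.changeLevel_primitiveCharacter]
    simp [h]
  · rw [if_pos h, apply_natCast_eq_zero _ h, mul_zero, zero_sub, norm_neg, norm_mul,
      Complex.norm_real, Real.norm_of_nonneg (gam_nonneg n)]
    exact mul_le_of_le_one_right (gam_nonneg n) (DirichletCharacter.norm_le_one _ _)

noncomputable def primSum (u r : ℕ) : ℝ :=
  ∑ χ : DirichletCharacter ℂ r with χ.IsPrimitive ∧ χ ≠ 1, ‖charSum χ u‖ ^ 2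

theorem primSum_nonneg (u r : ℕ) : 0 ≤ primSum u r :=
  Finset.sum_nonneg fun _ _ => by positivity

theorem sum_norm_sq_charSum_primitiveCharacter_le {q : ℕ} (hq : q ≠ 0) (u : ℕ) :
    ∑ χ : DirichletCharacter ℂ q with χ ≠ 1, ‖charSum χ.primitiveCharacter u‖ ^ 2 ≤
      ∑ r ∈ q.divisors, primSum u r := by
  have : NeZero q := ⟨hq⟩
  simp only [primSum]
  rw [Finset.sum_sigma']
  let i : DirichletCharacter ℂ q → (Σ r : ℕ, DirichletCharacter ℂ r) :=
    fun χ => ⟨χ.conductor, χ.primitiveCharacter⟩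
  let j : (Σ r : ℕ, DirichletCharacter ℂ r) → DirichletCharacter ℂ q :=
    fun x => if h : x.1 ∣ q then DirichletCharacter.changeLevel h x.2 else 1
  have hij : Function.LeftInverse j i := by
    intro χ
    simp only [i, j]
    rw [dif_pos χ.conductor_dvd_level, DirichletCharacter.changeLevel_primitiveCharacter]
  have h1 : ∑ χ : DirichletCharacter ℂ q with χ ≠ 1, ‖charSum χ.primitiveCharacter u‖ ^ 2 =
      ∑ x ∈ (Finset.univ.filter fun χ : DirichletCharacter ℂ q => χ ≠ 1).image i,
        ‖charSum x.2 u‖ ^ 2 := by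
    rw [Finset.sum_image hij.injective.injOn]
  refine le_trans (le_of_eq (Eq.trans (by congr!) h1)) ?_
  refine Finset.sum_le_sum_of_subset_of_nonneg ?_ fun _ _ _ => by positivity
  intro x hx
  obtain ⟨χ, hχ, rfl⟩ := Finset.mem_image.mp hx
  have hχ := (Finset.mem_filter.mp hχ).2
  rw [Finset.mem_sigma, Nat.mem_divisors, Finset.mem_filter]
  refine ⟨⟨χ.conductor_dvd_level, hq⟩, Finset.mem_univ _,
    χ.primitiveCharacter_isPrimitive, fun h => hχ ?_⟩
  have h' : χ.primitiveCharacter = 1 := h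
  rw [← χ.changeLevel_primitiveCharacter, h', DirichletCharacter.changeLevel_one]

theorem sum_norm_sq_charSum_le {q : ℕ} (hq : q ≠ 0) (u : ℕ) :
    ∑ χ : DirichletCharacter ℂ q with χ ≠ 1, ‖charSum χ u‖ ^ 2 ≤
      2 * ∑ r ∈ q.divisors, primSum u r + 2 * q.totient * Real.log q ^ 2 := by
  have hlog := Real.log_natCast_nonneg q
  calc ∑ χ : DirichletCharacter ℂ q with χ ≠ 1, ‖charSum χ u‖ ^ 2
      ≤ ∑ χ : DirichletCharacter ℂ q with χ ≠ 1,
        (2 * ‖charSum χ.primitiveCharacter u‖ ^ 2 + 2 * Real.log q ^ 2) := by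
        refine Finset.sum_le_sum fun χ _ => ?_
        have h1 := norm_charSum_sub_primitiveCharacter_le hq χ u
        have h2 : ‖charSum χ u‖ ≤ ‖charSum χ.primitiveCharacter u‖ + Real.log q := by
          have := norm_add_le (charSum χ.primitiveCharacter u)
            (charSum χ u - charSum χ.primitiveCharacter u)
          rw [add_sub_cancel] at this
          linarith
        nlinarith [norm_nonneg (charSum χ u),
          sq_nonneg (‖charSum χ.primitiveCharacter u‖ - Real.log q)]
    _ ≤ _ := by
        rw [Finset.sum_add_distrib, ← Finset.mul_sum, Finset.sum_const, nsmul_eq_mul]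
        refine add_le_add (mul_le_mul_of_nonneg_left
          (sum_norm_sq_charSum_primitiveCharacter_le hq u) (by norm_num)) ?_
        have h3 : ((Finset.univ.filter fun χ : DirichletCharacter ℂ q => χ ≠ 1).card : ℝ) ≤
            q.totient := by
          have : NeZero q := ⟨hq⟩
          rw [← DirichletCharacter.card_eq_totient_of_hasEnoughRootsOfUnity ℂ q,
            Nat.card_eq_fintype_card]
          exact_mod_cast Finset.card_filter_le _ _
        nlinarith [sq_nonneg (Real.log q)]

theorem sum_inv_totient_mul_sum_divisors_le {f : ℕ → ℝ} (hf : ∀ r, 0 ≤ f r) (Q : ℕ) :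
    ∑ q ∈ Finset.Icc 1 Q, (q.totient : ℝ)⁻¹ * ∑ r ∈ q.divisors, f r ≤
      (∑ m ∈ Finset.Icc 1 Q, (m.totient : ℝ)⁻¹) *
        ∑ r ∈ Finset.Icc 1 Q, f r * (r.totient : ℝ)⁻¹ := by
  rw [Finset.sum_mul_sum, ← Finset.sum_product']
  simp only [Finset.mul_sum]
  rw [Finset.sum_sigma']
  have hinj : Set.InjOn (fun x : (Σ _ : ℕ, ℕ) => (x.1 / x.2, x.2))
      ((Finset.Icc 1 Q).sigma fun q => q.divisors) := by
    rintro ⟨q, r⟩ h ⟨q', r'⟩ h' heq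
    rw [Finset.mem_coe, Finset.mem_sigma, Nat.mem_divisors] at h h'
    simp only [Prod.mk.injEq] at heq h h'
    obtain ⟨h1, rfl⟩ := heq
    have : q = q' := by
      rw [← Nat.div_mul_cancel h.2.1, h1, Nat.div_mul_cancel h'.2.1]
    rw [this]
  refine (Finset.sum_le_sum (g := fun x : (Σ _ : ℕ, ℕ) => (((x.1 / x.2).totient : ℝ)⁻¹ *
    (f x.2 * (x.2.totient : ℝ)⁻¹))) fun x hx => ?_).trans ?_
  · rw [Finset.mem_sigma, Nat.mem_divisors, Finset.mem_Icc] at hx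
    obtain ⟨k, hk⟩ := hx.2.1
    have hr : 0 < x.2 := Nat.pos_of_dvd_of_pos hx.2.1 hx.1.1
    have hk0 : 0 < k := by
      rcases Nat.eq_zero_or_pos k with rfl | h
      · rw [mul_zero] at hk; omega
      · exact h
    rw [hk, Nat.mul_div_cancel_left _ hr, mul_left_comm, ← mul_inv, mul_comm (f x.2)]
    refine mul_le_mul_of_nonneg_right ?_ (hf _)
    have h1 : (0 : ℝ) < k.totient := by exact_mod_cast Nat.totient_pos.mpr hk0
    have h2 : (0 : ℝ) < x.2.totient := by exact_mod_cast Nat.totient_pos.mpr hr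
    refine inv_anti₀ (by positivity) ?_
    rw [mul_comm]
    exact_mod_cast Nat.totient_super_multiplicative x.2 k
  · rw [← Finset.sum_image (f := fun y : ℕ × ℕ => ((y.1.totient : ℝ)⁻¹ *
      (f y.2 * (y.2.totient : ℝ)⁻¹))) hinj]
    refine Finset.sum_le_sum_of_subset_of_nonneg ?_ fun y _ _ =>
      mul_nonneg (by positivity) (mul_nonneg (hf _) (by positivity))
    intro y hy
    obtain ⟨⟨q, r⟩, h, rfl⟩ := Finset.mem_image.mp hy
    rw [Finset.mem_sigma, Nat.mem_divisors, Finset.mem_Icc] at h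
    simp only at h
    rw [Finset.mem_product, Finset.mem_Icc, Finset.mem_Icc]
    have hr : 0 < r := Nat.pos_of_dvd_of_pos h.2.1 h.1.1
    have hrq : r ≤ q := Nat.le_of_dvd h.1.1 h.2.1
    exact ⟨⟨Nat.div_pos hrq hr, (Nat.div_le_self _ _).trans h.1.2⟩, hr, hrq.trans h.1.2⟩

theorem sum_inv_totient_le {x : ℝ} (hx : 3 ≤ x) {Q : ℕ} (hQ : (Q : ℝ) ≤ x) :
    ∑ m ∈ Finset.Icc 1 Q, (m.totient : ℝ)⁻¹ ≤ 6 * Real.log x ^ 2 := by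
  have hL := one_le_log hx
  have h1 : ∑ m ∈ Finset.Icc 1 Q, (m.totient : ℝ)⁻¹ ≤
      ∑ m ∈ Finset.Icc 1 Q, 3 * Real.log x * (m : ℝ)⁻¹ := by
    refine Finset.sum_le_sum fun m hm => ?_
    rw [Finset.mem_Icc] at hm
    have hm0 : (0 : ℝ) < m := by exact_mod_cast hm.1
    have hmx : (m : ℝ) ≤ x := le_trans (by exact_mod_cast hm.2) hQ
    have := Real.log_le_log hm0 hmx
    refine (inv_totient_le (by omega)).trans ?_
    rw [div_eq_mul_inv]
    gcongr
    linarith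
  refine h1.trans ?_
  rw [← Finset.mul_sum]
  have h2 : ∑ m ∈ Finset.Icc 1 Q, (m : ℝ)⁻¹ ≤ 1 + Real.log x := by
    rcases Nat.eq_zero_or_pos Q with rfl | hQ0
    · simp; linarith
    · have := harmonic_le_one_add_log Q
      rw [harmonic_eq_sum_Icc] at this
      push_cast at this
      refine this.trans ?_
      gcongr
  calc 3 * Real.log x * ∑ m ∈ Finset.Icc 1 Q, (m : ℝ)⁻¹ ≤
        3 * Real.log x * (1 + Real.log x) := by gcongr
    _ ≤ _ := by nlinarith

theorem sum_gam_le (u : ℕ) : ∑ n ∈ Finset.Icc 1 u, gam n ≤ 2 * u := by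
  have h := Chebyshev.theta_le_log4_mul_x (x := u) (by positivity)
  rw [Chebyshev.theta_eq_sum_Icc, Nat.floor_natCast, Finset.sum_filter] at h
  have h4 : Real.log 4 ≤ 2 := by
    rw [show (4 : ℝ) = 2 ^ 2 by norm_num, Real.log_pow]
    push_cast
    linarith [Real.log_two_lt_d9]
  calc ∑ n ∈ Finset.Icc 1 u, gam n
      ≤ ∑ n ∈ Finset.Icc 0 u, if n.Prime then Real.log n else 0 := by
        refine (Finset.sum_le_sum_of_subset_of_nonneg (Finset.Icc_subset_Icc_left zero_le_one)
          fun n _ _ => gam_nonneg n).trans (Finset.sum_le_sum fun n _ => ?_)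
        rw [gam_natCast]
        by_cases hp : n.Prime
        · simp only [hp, and_true, if_true]
          split_ifs
          · exact le_rfl
          · exact Real.log_natCast_nonneg n
        · simp [hp]
    _ ≤ Real.log 4 * u := h
    _ ≤ _ := by gcongr

theorem sum_gam_sq_le {x : ℝ} {u : ℕ} (hu : (u : ℝ) ≤ x) :
    ∑ n ∈ Finset.Icc 1 u, gam n ^ 2 ≤ 2 * u * Real.log x := by
  rcases Nat.eq_zero_or_pos u with rfl | hu0
  · simp
  have hu1 : (1 : ℝ) ≤ u := by exact_mod_cast hu0
  have hlog : 0 ≤ Real.log x := Real.log_nonneg (by linarith)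
  calc ∑ n ∈ Finset.Icc 1 u, gam n ^ 2 ≤ ∑ n ∈ Finset.Icc 1 u, gam n * Real.log x := by
        refine Finset.sum_le_sum fun n hn => ?_
        rw [Finset.mem_Icc] at hn
        rw [sq]
        refine mul_le_mul_of_nonneg_left ((gam_le_log n).trans ?_) (gam_nonneg n)
        refine Real.log_le_log (by exact_mod_cast hn.1) (le_trans ?_ hu)
        exact_mod_cast hn.2
    _ ≤ _ := by
        rw [← Finset.sum_mul]
        exact mul_le_mul_of_nonneg_right (sum_gam_le u) hlog

theorem sum_Ioc_div_le {w : ℕ → ℝ} {K X : ℝ} (hK : 0 ≤ K) (hX : 0 ≤ X) (hw : ∀ r, 0 ≤ w r)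
    (hW : ∀ k : ℕ, 1 ≤ k → ∑ r ∈ Finset.Icc 1 k, w r ≤ K * (k ^ 2 + X)) {R Q : ℕ}
    (hRQ : R + 1 ≤ Q) :
    ∑ r ∈ Finset.Ioc R Q, w r / r ≤ K * (2 * Q + 2 * X / (R + 1)) := by
  have key : ∑ r ∈ Finset.Ioc R Q, w r / r ≤ (∑ r ∈ Finset.Icc 1 Q, w r) / Q +
      K * ((Q - R - 1) + X * (1 / (R + 1) - 1 / Q)) := by
    induction Q, hRQ using Nat.le_induction with
    | base =>
      rw [Nat.Ioc_succ_singleton, Finset.sum_singleton]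
      push_cast
      have : w (R + 1) ≤ ∑ r ∈ Finset.Icc 1 (R + 1), w r :=
        Finset.single_le_sum (fun r _ => hw r) (Finset.mem_Icc.mpr ⟨by omega, le_rfl⟩)
      have h1 : w (R + 1) / ((R : ℝ) + 1) ≤ (∑ r ∈ Finset.Icc 1 (R + 1), w r) / ((R : ℝ) + 1) := by
        gcongr
      have h2 : K * ((R : ℝ) + 1 - R - 1 + X * (1 / (R + 1) - 1 / (R + 1))) = 0 := by ring
      rw [h2, add_zero]
      exact h1
    | succ Q hQ ih =>
      rw [Finset.sum_Ioc_succ_top (by omega), Finset.sum_Icc_succ_top (by omega)]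
      have h1 := hW Q (by omega)
      have hQ0 : (0 : ℝ) < Q := by exact_mod_cast (by omega : 0 < Q)
      generalize (∑ r ∈ Finset.Icc 1 Q, w r) = W at *
      have h2 : W / Q = W / (Q + 1) + W / (Q * (Q + 1)) := by field_simp
      have h3 : W / (Q * (Q + 1)) ≤ K * (1 + X * (1 / Q - 1 / (Q + 1))) := by
        rw [div_le_iff₀ (by positivity)]
        have : K * (1 + X * (1 / Q - 1 / (Q + 1))) * (Q * ((Q : ℝ) + 1)) =
          K * (Q ^ 2 + X) + K * Q := by field_simp; ring
        rw [this]
        have : 0 ≤ K * Q := by positivity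
        linarith
      push_cast
      rw [add_div]
      refine (add_le_add_left ih _).trans ?_
      rw [h2]
      linarith
  refine key.trans ?_
  have hQ0 : (0 : ℝ) < Q := by exact_mod_cast (by omega : 0 < Q)
  have h1 : (∑ r ∈ Finset.Icc 1 Q, w r) / Q ≤ K * (Q + X * (1 / Q)) := by
    rw [div_le_iff₀ hQ0]
    refine (hW Q (by omega)).trans (le_of_eq ?_)
    field_simp
  refine (add_le_add_left h1 _).trans ?_
  rw [← mul_add]
  refine mul_le_mul_of_nonneg_left ?_ hK
  have h2 : 0 ≤ X * (1 / ((R : ℝ) + 1)) := by positivity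
  have h3 : 2 * X / ((R : ℝ) + 1) = 2 * (X * (1 / (R + 1))) := by ring
  have h4 : (0 : ℝ) ≤ R := by positivity
  rw [h3]
  linarith

theorem sum_primSum_Ioc_le {x : ℝ} (hx : 3 ≤ x) {u R Q : ℕ} (hu : (u : ℝ) ≤ x) :
    ∑ r ∈ Finset.Ioc R Q, primSum u r * (r.totient : ℝ)⁻¹ ≤
      520 * x * Real.log x * (Q + x / (R + 1)) := by
  have hL := one_le_log hx
  have hx0 : 0 < x := by linarith
  rcases Nat.eq_zero_or_pos u with rfl | hu0
  · have : ∀ r, primSum 0 r = 0 := fun r => by simp [primSum, charSum]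
    simp only [this, zero_mul, Finset.sum_const_zero]
    positivity
  by_cases hRQ : R + 1 ≤ Q
  swap
  · rw [Finset.Ioc_eq_empty (by omega), Finset.sum_empty]
    positivity
  obtain ⟨w, hw⟩ : ∃ w : ℕ → ℝ, w = fun r : ℕ => (r : ℝ) / r.totient *
      ∑ χ : DirichletCharacter ℂ r with χ.IsPrimitive, ‖charSum χ u‖ ^ 2 := ⟨_, rfl⟩
  have hw0 : ∀ r, 0 ≤ w r := fun r => by rw [hw]; positivity
  have hW : ∀ k : ℕ, 1 ≤ k → ∑ r ∈ Finset.Icc 1 k, w r ≤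
      (260 * x * Real.log x) * (k ^ 2 + x) := by
    intro k hk
    have h1 := large_sieve hk hu0 (Finset.Icc 1 u) (fun n hn => (Finset.mem_Icc.mp hn).2)
      (fun n => (gam n : ℂ))
    rw [hw]
    refine h1.trans ?_
    simp only [Complex.norm_real, Real.norm_eq_abs, sq_abs]
    calc 130 * ((k : ℝ) ^ 2 + u) * ∑ n ∈ Finset.Icc 1 u, gam n ^ 2
        ≤ 130 * ((k : ℝ) ^ 2 + x) * (2 * x * Real.log x) := by
          refine mul_le_mul (by gcongr) ((sum_gam_sq_le hu).trans (by gcongr)) ?_ (by positivity)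
          exact Finset.sum_nonneg fun n _ => sq_nonneg _
      _ = _ := by ring
  have h2 := sum_Ioc_div_le (by positivity) hx0.le hw0 hW hRQ
  refine (Finset.sum_le_sum fun r hr => ?_).trans (h2.trans (le_of_eq (by ring)))
  rw [Finset.mem_Ioc] at hr
  have hr0 : (0 : ℝ) < r := by exact_mod_cast (by omega : 0 < r)
  have h3 : w r / r = (∑ χ : DirichletCharacter ℂ r with χ.IsPrimitive, ‖charSum χ u‖ ^ 2) *
      (r.totient : ℝ)⁻¹ := by
    rw [hw]
    field_simp
  rw [h3]
  refine mul_le_mul_of_nonneg_right ?_ (by positivity)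
  refine Finset.sum_le_sum_of_subset_of_nonneg ?_ fun _ _ _ => by positivity
  intro χ hχ
  rw [Finset.mem_filter] at hχ ⊢
  exact ⟨hχ.1, hχ.2.1⟩

theorem exists_sum_primSum_Icc_le (D E : ℕ) : ∃ C : ℝ, 0 < C ∧ ∀ (x : ℝ) (u R : ℕ), 3 ≤ x →
    (u : ℝ) ≤ x → (R : ℝ) ≤ Real.log x ^ D →
    ∑ r ∈ Finset.Icc 1 R, primSum u r * (r.totient : ℝ)⁻¹ ≤ C * x ^ 2 / Real.log x ^ E := by
  obtain ⟨C, hC, H⟩ := exists_norm_sum_mul_gam_le D (D + E)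
  refine ⟨C ^ 2, by positivity, fun x u R hx hu hR => ?_⟩
  have hL := one_le_log hx
  have hL0 : 0 < Real.log x := by linarith
  have hx0 : 0 < x := by linarith
  have h1 : ∀ r ∈ Finset.Icc 1 R, primSum u r * (r.totient : ℝ)⁻¹ ≤
      (C * x / Real.log x ^ (D + E)) ^ 2 := by
    intro r hr
    rw [Finset.mem_Icc] at hr
    have hr0 : NeZero r := ⟨by omega⟩
    have hφ : (0 : ℝ) < r.totient := by exact_mod_cast Nat.totient_pos.mpr hr.1
    rw [← div_eq_mul_inv, div_le_iff₀ hφ, mul_comm]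
    calc primSum u r ≤ ∑ χ : DirichletCharacter ℂ r with χ.IsPrimitive ∧ χ ≠ 1,
          (C * x / Real.log x ^ (D + E)) ^ 2 := by
          rw [primSum]
          refine le_trans (le_of_eq (by congr!)) (Finset.sum_le_sum fun χ hχ => ?_)
          have hχ := (Finset.mem_filter.mp hχ).2
          have h2 := H r χ hχ.1 hχ.2 x u hx (le_trans (by exact_mod_cast hr.2) hR) hu
          rw [charSum]
          refine pow_le_pow_left₀ (norm_nonneg _) (le_trans (le_of_eq ?_) h2) 2
          congr 1
          exact Finset.sum_congr rfl fun n _ => mul_comm _ _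
      _ ≤ _ := by
          rw [Finset.sum_const, nsmul_eq_mul]
          refine mul_le_mul_of_nonneg_right ?_ (sq_nonneg _)
          rw [← DirichletCharacter.card_eq_totient_of_hasEnoughRootsOfUnity ℂ r,
            Nat.card_eq_fintype_card]
          exact_mod_cast Finset.card_filter_le _ _
  refine (Finset.sum_le_sum h1).trans ?_
  rw [Finset.sum_const, Nat.card_Icc, nsmul_eq_mul, Nat.add_sub_cancel]
  calc (R : ℝ) * (C * x / Real.log x ^ (D + E)) ^ 2
      ≤ Real.log x ^ D * (C * x / Real.log x ^ (D + E)) ^ 2 := by gcongr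
    _ = (C ^ 2 * x ^ 2 / Real.log x ^ E) / Real.log x ^ (D + E) := by
        field_simp
        ring
    _ ≤ _ := div_le_self (by positivity) (one_le_pow₀ hL)

/-- Mean square of character sums over primes, over all non-principal characters. -/
theorem exists_sum_norm_sq_charSum_le (A : ℕ) : ∃ C : ℝ, 0 < C ∧ ∀ (x : ℝ) (u Q : ℕ), 3 ≤ x →
    (u : ℝ) ≤ x → Q * Real.log x ^ (A + 3) ≤ x →
    ∑ q ∈ Finset.Icc 1 Q, (q.totient : ℝ)⁻¹ *
      ∑ χ : DirichletCharacter ℂ q with χ ≠ 1, ‖charSum χ u‖ ^ 2 ≤ C * x ^ 2 / Real.log x ^ A := by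
  obtain ⟨C, hC, H⟩ := exists_sum_primSum_Icc_le (A + 3) (A + 2)
  refine ⟨12 * (C + 1040) + 2, by positivity, fun x u Q hx hu hQ => ?_⟩
  have hL := one_le_log hx
  have hL0 : 0 < Real.log x := by linarith
  have hx0 : 0 < x := by linarith
  have hQ' : (Q : ℝ) ≤ x / Real.log x ^ (A + 3) := by rwa [le_div_iff₀ (by positivity)]
  have hQx : (Q : ℝ) ≤ x := hQ'.trans (div_le_self hx0.le (one_le_pow₀ hL))
  obtain ⟨R, hR⟩ : ∃ R, R = ⌊Real.log x ^ (A + 3)⌋₊ := ⟨_, rfl⟩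
  have hR1 : (R : ℝ) ≤ Real.log x ^ (A + 3) := by rw [hR]; exact Nat.floor_le (by positivity)
  have hR2 : Real.log x ^ (A + 3) ≤ R + 1 := by rw [hR]; exact (Nat.lt_floor_add_one _).le
  have h1 : ∑ r ∈ Finset.Icc 1 Q, primSum u r * (r.totient : ℝ)⁻¹ ≤
      (C + 1040) * x ^ 2 / Real.log x ^ (A + 2) := by
    have hnn : ∀ r, 0 ≤ primSum u r * (r.totient : ℝ)⁻¹ := fun r =>
      mul_nonneg (primSum_nonneg u r) (by positivity)
    have hsub : Finset.Icc 1 Q ⊆ Finset.Icc 1 R ∪ Finset.Ioc R Q := by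
      intro r
      simp only [Finset.mem_union, Finset.mem_Icc, Finset.mem_Ioc]
      omega
    have h2 := H x u R hx hu hR1
    have h3 := sum_primSum_Ioc_le (R := R) (Q := Q) hx hu
    have h4 : (Q : ℝ) + x / (R + 1) ≤ 2 * (x / Real.log x ^ (A + 3)) := by
      have : x / (R + 1) ≤ x / Real.log x ^ (A + 3) := by gcongr
      linarith
    have h5 : 520 * x * Real.log x * (Q + x / (R + 1)) ≤
        1040 * x ^ 2 / Real.log x ^ (A + 2) := by
      calc _ ≤ 520 * x * Real.log x * (2 * (x / Real.log x ^ (A + 3))) := by gcongr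
        _ = _ := by field_simp; ring
    refine (Finset.sum_le_sum_of_subset_of_nonneg hsub fun r _ _ => hnn r).trans ?_
    have hdisj : Disjoint (Finset.Icc 1 R) (Finset.Ioc R Q) := by
      rw [Finset.disjoint_left]
      intro r
      simp only [Finset.mem_Icc, Finset.mem_Ioc]
      omega
    rw [Finset.sum_union hdisj]
    rw [add_mul, add_div]
    linarith
  have h2 : ∑ q ∈ Finset.Icc 1 Q, (q.totient : ℝ)⁻¹ *
      ∑ χ : DirichletCharacter ℂ q with χ ≠ 1, ‖charSum χ u‖ ^ 2 ≤
      ∑ q ∈ Finset.Icc 1 Q, (2 * ((q.totient : ℝ)⁻¹ * ∑ r ∈ q.divisors, primSum u r) +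
        2 * Real.log x ^ 2) := by
    refine Finset.sum_le_sum fun q hq => ?_
    rw [Finset.mem_Icc] at hq
    have hφ : (0 : ℝ) < q.totient := by exact_mod_cast Nat.totient_pos.mpr hq.1
    have hlq0 := Real.log_natCast_nonneg q
    have hlq : Real.log q ≤ Real.log x := Real.log_le_log (by exact_mod_cast hq.1)
      (le_trans (by exact_mod_cast hq.2) hQx)
    calc _ ≤ (q.totient : ℝ)⁻¹ *
          (2 * ∑ r ∈ q.divisors, primSum u r + 2 * q.totient * Real.log q ^ 2) :=
          mul_le_mul_of_nonneg_left (sum_norm_sq_charSum_le (by omega) u) (by positivity)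
      _ = 2 * ((q.totient : ℝ)⁻¹ * ∑ r ∈ q.divisors, primSum u r) + 2 * Real.log q ^ 2 := by
          field_simp
      _ ≤ _ := by gcongr
  refine h2.trans ?_
  rw [Finset.sum_add_distrib, ← Finset.mul_sum, Finset.sum_const, Nat.card_Icc, nsmul_eq_mul,
    Nat.add_sub_cancel]
  have h3 := sum_inv_totient_mul_sum_divisors_le (primSum_nonneg u) Q
  have h4 := sum_inv_totient_le hx hQx
  have h5 : ∑ q ∈ Finset.Icc 1 Q, (q.totient : ℝ)⁻¹ * ∑ r ∈ q.divisors, primSum u r ≤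
      6 * Real.log x ^ 2 * ((C + 1040) * x ^ 2 / Real.log x ^ (A + 2)) := by
    refine h3.trans (mul_le_mul h4 h1 ?_ (by positivity))
    exact Finset.sum_nonneg fun r _ => mul_nonneg (primSum_nonneg u r) (by positivity)
  have h6 : 6 * Real.log x ^ 2 * ((C + 1040) * x ^ 2 / Real.log x ^ (A + 2)) =
      6 * (C + 1040) * x ^ 2 / Real.log x ^ A := by
    field_simp
    ring
  have h7 : (Q : ℝ) * (2 * Real.log x ^ 2) ≤ 2 * x ^ 2 / Real.log x ^ A := by
    rw [le_div_iff₀ (by positivity)]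
    calc (Q : ℝ) * (2 * Real.log x ^ 2) * Real.log x ^ A
        = 2 * (Q * Real.log x ^ (A + 2)) := by ring
      _ ≤ 2 * (Q * Real.log x ^ (A + 3)) := by
          have := pow_le_pow_right₀ hL (show A + 2 ≤ A + 3 by omega)
          gcongr
      _ ≤ 2 * x ^ 2 := by nlinarith
  have h8 : (12 * (C + 1040) + 2) * x ^ 2 / Real.log x ^ A =
      2 * (6 * (C + 1040) * x ^ 2 / Real.log x ^ A) + 2 * x ^ 2 / Real.log x ^ A := by ring
  rw [h8]
  linarith

/-- Discrepancy of `gam` up to `u` in the residue class `c` modulo `q`. -/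
noncomputable def apDiff (q u : ℕ) (c : ZMod q) : ℝ :=
  (∑ n ∈ Finset.Icc 1 u, if (n : ZMod q) = c then gam n else 0) -
    (q.totient : ℝ)⁻¹ * ∑ n ∈ Finset.Icc 1 u, gam n

theorem sum_dirichletCharacter_mul_apDiff {q : ℕ} [NeZero q] (χ : DirichletCharacter ℂ q) (u : ℕ) :
    ∑ c, χ c * (apDiff q u c : ℂ) =
      charSum χ u - (∑ c, χ c) * ((q.totient : ℂ)⁻¹ * ∑ n ∈ Finset.Icc 1 u, (gam n : ℂ)) := by
  have h1 : ∀ c, χ c * (apDiff q u c : ℂ) =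
      (∑ n ∈ Finset.Icc 1 u, if (n : ZMod q) = c then (gam n : ℂ) * χ c else 0) -
        χ c * ((q.totient : ℂ)⁻¹ * ∑ n ∈ Finset.Icc 1 u, (gam n : ℂ)) := by
    intro c
    rw [apDiff]
    push_cast
    rw [mul_sub, Finset.mul_sum]
    congr 1
    refine Finset.sum_congr rfl fun n _ => ?_
    split_ifs
    · ring
    · simp
  simp only [h1]
  rw [Finset.sum_sub_distrib, ← Finset.sum_mul, Finset.sum_comm, charSum]
  congr 1
  refine Finset.sum_congr rfl fun n _ => ?_
  simp

theorem totient_mul_sum_apDiff_sq_le {q : ℕ} [NeZero q] (u : ℕ) :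
    (q.totient : ℝ) * ∑ c : ZMod q, (if IsUnit c then apDiff q u c ^ 2 else 0) ≤
      (∑ χ : DirichletCharacter ℂ q with χ ≠ 1, ‖charSum χ u‖ ^ 2) + Real.log q ^ 2 := by
  have h0 := sum_dirichletCharacter_norm_sq (q := q) (fun c => (apDiff q u c : ℂ))
  simp only [Complex.norm_real, Real.norm_eq_abs, sq_abs] at h0
  rw [← h0, ← Finset.sum_filter_add_sum_filter_not Finset.univ
    (fun χ : DirichletCharacter ℂ q => χ ≠ 1)]
  refine add_le_add (le_of_eq ?_) ?_
  · refine Finset.sum_congr (by congr!) fun χ hχ => ?_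
    have hχ := (Finset.mem_filter.mp hχ).2
    rw [sum_dirichletCharacter_mul_apDiff, MulChar.sum_eq_zero_of_ne_one hχ, zero_mul, sub_zero]
  · have h1 : (Finset.univ.filter fun χ : DirichletCharacter ℂ q => ¬ χ ≠ 1) = {1} := by
      ext χ
      simp
    rw [h1, Finset.sum_singleton, sum_dirichletCharacter_mul_apDiff]
    have hφ : (q.totient : ℂ) ≠ 0 := by
      exact_mod_cast (Nat.totient_pos.mpr (Nat.pos_of_ne_zero (NeZero.ne q))).ne'
    have h2 : ∑ c, (1 : DirichletCharacter ℂ q) c = q.totient := by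
      rw [MulChar.sum_one_eq_card_units, ZMod.card_units_eq_totient]
    rw [h2, ← mul_assoc, mul_inv_cancel₀ hφ, one_mul, charSum, ← Finset.sum_sub_distrib]
    refine pow_le_pow_left₀ (norm_nonneg _) ?_ 2
    refine le_trans ?_ (sum_gam_not_coprime_le (NeZero.ne q) (Finset.Icc 1 u))
    rw [Finset.sum_filter]
    refine norm_sum_le_of_le _ fun n _ => ?_
    split_ifs with h
    swap
    · rw [apply_natCast_eq_zero _ h]
      simp [abs_of_nonneg (gam_nonneg _)]
    · rw [MulChar.one_apply ((ZMod.isUnit_iff_coprime n q).mpr h)]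
      simp

/-- Variance of `gam` up to `u` over reduced residue classes modulo `q`. -/
noncomputable def apVar (q u : ℕ) : ℝ :=
  ∑ b ∈ Finset.range q with b.Coprime q, apDiff q u b ^ 2

theorem apVar_eq {q : ℕ} [NeZero q] (u : ℕ) :
    apVar q u = ∑ c : ZMod q, if IsUnit c then apDiff q u c ^ 2 else 0 := by
  rw [apVar, ← sum_isUnit_eq_sum_coprime (fun b => apDiff q u b ^ 2)]
  simp

/-- Barban–Davenport–Halberstam for `gam`. -/
theorem exists_sum_apVar_le (A : ℕ) : ∃ C : ℝ, 0 < C ∧ ∀ (x : ℝ) (u Q : ℕ), 3 ≤ x →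
    (u : ℝ) ≤ x → Q * Real.log x ^ (A + 3) ≤ x →
    ∑ q ∈ Finset.Icc 1 Q, apVar q u ≤ C * x ^ 2 / Real.log x ^ A := by
  obtain ⟨C, hC, H⟩ := exists_sum_norm_sq_charSum_le A
  refine ⟨C + 1, by positivity, fun x u Q hx hu hQ => ?_⟩
  have hL := one_le_log hx
  have hx0 : 0 < x := by linarith
  have hQx : (Q : ℝ) ≤ x := by
    have := one_le_pow₀ hL (n := A + 3)
    nlinarith [Nat.cast_nonneg (α := ℝ) Q]
  have h1 : ∀ q ∈ Finset.Icc 1 Q, apVar q u ≤ (q.totient : ℝ)⁻¹ *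
      (∑ χ : DirichletCharacter ℂ q with χ ≠ 1, ‖charSum χ u‖ ^ 2) + Real.log x ^ 2 := by
    intro q hq
    rw [Finset.mem_Icc] at hq
    have hq0 : NeZero q := ⟨by omega⟩
    have hφ : (1 : ℝ) ≤ q.totient := by exact_mod_cast Nat.totient_pos.mpr hq.1
    have hφ0 : (0 : ℝ) < q.totient := by linarith
    have h2 := totient_mul_sum_apDiff_sq_le (q := q) u
    rw [← apVar_eq] at h2
    have hlq0 := Real.log_natCast_nonneg q
    have hlq : Real.log q ≤ Real.log x := Real.log_le_log (by exact_mod_cast hq.1)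
      (le_trans (by exact_mod_cast hq.2) hQx)
    have h3 : Real.log q ^ 2 ≤ q.totient * Real.log x ^ 2 := by
      have : Real.log q ^ 2 ≤ Real.log x ^ 2 := by gcongr
      nlinarith [sq_nonneg (Real.log x)]
    refine le_of_mul_le_mul_left (h2.trans ?_) hφ0
    rw [mul_add, ← mul_assoc, mul_inv_cancel₀ hφ0.ne', one_mul]
    refine add_le_add (le_of_eq ?_) h3
    congr!
  refine (Finset.sum_le_sum h1).trans ?_
  rw [Finset.sum_add_distrib, Finset.sum_const, Nat.card_Icc, nsmul_eq_mul, Nat.add_sub_cancel,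
    add_mul, add_div]
  refine add_le_add (H x u Q hx hu hQ) ?_
  rw [le_div_iff₀ (by positivity)]
  have := pow_le_pow_right₀ hL (show A + 2 ≤ A + 3 by omega)
  calc (Q : ℝ) * Real.log x ^ 2 * Real.log x ^ A = Q * Real.log x ^ (A + 2) := by ring
    _ ≤ Q * Real.log x ^ (A + 3) := by gcongr
    _ ≤ 1 * x ^ 2 := by nlinarith

theorem sum_Ioc_modEq_gam_le {x : ℝ} (hx : 3 ≤ x) {q u v : ℕ} (hq : q ≠ 0) (huv : u ≤ v)
    (hv : (v : ℝ) ≤ x) (c : ZMod q) :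
    (∑ n ∈ Finset.Ioc u v, if (n : ZMod q) = c then gam n else 0) ≤
      Real.log x * (((v : ℝ) - u) / q + 1) := by
  have : NeZero q := ⟨hq⟩
  have hq0 : (0 : ℝ) < q := by exact_mod_cast Nat.pos_of_ne_zero hq
  have hL := one_le_log hx
  have h1 : ((Finset.Ioc u v).filter fun n : ℕ => (n : ZMod q) = c) =
      (Finset.Ioc u v).filter fun n => n ≡ c.val [MOD q] := by
    refine Finset.filter_congr fun n _ => ?_
    rw [← ZMod.natCast_eq_natCast_iff, ZMod.natCast_zmod_val]
  have h2 := Nat.Ioc_filter_modEq_card u v (Nat.pos_of_ne_zero hq) c.val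
  have h3 : (((Finset.Ioc u v).filter fun n : ℕ => (n : ZMod q) = c).card : ℝ) ≤
      ((v : ℝ) - u) / q + 1 := by
    rw [h1]
    have h4 : (((Finset.Ioc u v).filter fun n => n ≡ c.val [MOD q]).card : ℚ) ≤
        ((v : ℚ) - u) / q + 1 := by
      have h5 : (((Finset.Ioc u v).filter fun n => n ≡ c.val [MOD q]).card : ℚ) =
          (((max (⌊((v : ℚ) - c.val) / q⌋ - ⌊((u : ℚ) - c.val) / q⌋) 0 : ℤ)) : ℚ) := by
        rw [← h2]
        norm_cast
      rw [h5]
      push_cast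
      have huv' : (u : ℚ) ≤ v := by exact_mod_cast huv
      have h0 := div_nonneg (sub_nonneg.mpr huv') (Nat.cast_nonneg (α := ℚ) q)
      refine max_le ?_ (by linarith)
      have h6 := Int.floor_le (((v : ℚ) - c.val) / q)
      have h7 := Int.lt_floor_add_one (((u : ℚ) - c.val) / q)
      have h8 : ((v : ℚ) - u) / q = ((v : ℚ) - c.val) / q - ((u : ℚ) - c.val) / q := by ring
      linarith
    have h9 := (Rat.cast_le (K := ℝ)).mpr h4
    push_cast at h9
    exact h9
  rw [← Finset.sum_filter]
  calc _ ≤ ∑ n ∈ (Finset.Ioc u v).filter fun n : ℕ => (n : ZMod q) = c, Real.log x := by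
        refine Finset.sum_le_sum fun n hn => (gam_le_log n).trans ?_
        have hn := Finset.mem_Ioc.mp (Finset.mem_filter.mp hn).1
        refine Real.log_le_log (by exact_mod_cast (by omega : 0 < n)) (le_trans ?_ hv)
        exact_mod_cast hn.2
    _ ≤ _ := by
        rw [Finset.sum_const, nsmul_eq_mul, mul_comm]
        gcongr

theorem sum_Ioc_sub_eq_apDiff {q U V : ℕ} (hUV : U ≤ V) (c : ZMod q) :
    (∑ n ∈ Finset.Ioc U V, if (n : ZMod q) = c then gam n else 0) -
      (q.totient : ℝ)⁻¹ * ∑ n ∈ Finset.Ioc U V, gam n = apDiff q V c - apDiff q U c := by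
  have h0 : ∀ f : ℕ → ℝ, ∑ n ∈ Finset.Icc 1 V, f n =
      ∑ n ∈ Finset.Icc 1 U, f n + ∑ n ∈ Finset.Ioc U V, f n := by
    intro f
    rw [← Finset.sum_union]
    · congr 1
      ext n
      simp only [Finset.mem_union, Finset.mem_Icc, Finset.mem_Ioc]
      omega
    · rw [Finset.disjoint_left]
      intro n
      simp only [Finset.mem_Icc, Finset.mem_Ioc]
      omega
  rw [apDiff, apDiff, h0, h0]
  ring

theorem abs_apDiff_sub_le {x : ℝ} (hx : 3 ≤ x) {q u v : ℕ} (hq : q ≠ 0) (huv : u ≤ v)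
    (hv : (v : ℝ) ≤ x) (c : ZMod q) :
    |apDiff q v c - apDiff q u c| ≤
      Real.log x * (2 * ((v : ℝ) - u) * (q.totient : ℝ)⁻¹ + 1) := by
  have hL := one_le_log hx
  have hq0 : 0 < q := Nat.pos_of_ne_zero hq
  have hφ : (0 : ℝ) < q.totient := by exact_mod_cast Nat.totient_pos.mpr hq0
  have huv' : (0 : ℝ) ≤ (v : ℝ) - u := sub_nonneg.mpr (by exact_mod_cast huv)
  have h1 := sum_Ioc_sub_eq_apDiff huv c
  have h2 := sum_Ioc_modEq_gam_le hx hq huv hv c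
  have h3 : ∑ n ∈ Finset.Ioc u v, gam n ≤ Real.log x * ((v : ℝ) - u) := by
    have : ∀ n ∈ Finset.Ioc u v, gam n ≤ Real.log x := fun n hn => by
      rw [Finset.mem_Ioc] at hn
      refine (gam_le_log n).trans (Real.log_le_log (by exact_mod_cast (by omega : 0 < n)) ?_)
      exact le_trans (by exact_mod_cast hn.2) hv
    refine (Finset.sum_le_sum this).trans (le_of_eq ?_)
    rw [Finset.sum_const, Nat.card_Ioc, nsmul_eq_mul, Nat.cast_sub huv, mul_comm]
  have h4 : 0 ≤ ∑ n ∈ Finset.Ioc u v, if (n : ZMod q) = c then gam n else 0 :=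
    Finset.sum_nonneg fun n _ => by split_ifs <;> simp [gam_nonneg]
  have h5 : 0 ≤ (q.totient : ℝ)⁻¹ * ∑ n ∈ Finset.Ioc u v, gam n :=
    mul_nonneg (by positivity) (Finset.sum_nonneg fun n _ => gam_nonneg n)
  have h6 : (q.totient : ℝ)⁻¹ * ∑ n ∈ Finset.Ioc u v, gam n ≤
      (q.totient : ℝ)⁻¹ * (Real.log x * ((v : ℝ) - u)) := by gcongr
  have h7 : ((v : ℝ) - u) / q ≤ ((v : ℝ) - u) * (q.totient : ℝ)⁻¹ := by
    rw [← div_eq_mul_inv]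
    exact div_le_div_of_nonneg_left huv' hφ (by exact_mod_cast Nat.totient_le q)
  have h8 : Real.log x * (((v : ℝ) - u) / q + 1) ≤
      Real.log x * (((v : ℝ) - u) * (q.totient : ℝ)⁻¹ + 1) := by gcongr
  have h9 : 0 ≤ Real.log x * (((v : ℝ) - u) * (q.totient : ℝ)⁻¹ + 1) := by positivity
  have h10 : 0 ≤ (q.totient : ℝ)⁻¹ * (Real.log x * ((v : ℝ) - u)) := by positivity
  rw [← h1, abs_le]
  constructor <;> nlinarith

theorem apDiff_zero (q : ℕ) (c : ZMod q) : apDiff q 0 c = 0 := by simp [apDiff]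

theorem abs_apDiff_le {x : ℝ} (hx : 3 ≤ x) {q v : ℕ} (hq : q ≠ 0)
    (hv : (v : ℝ) ≤ x) (c : ZMod q) :
    |apDiff q v c| ≤ Real.log x * (2 * x * (q.totient : ℝ)⁻¹ + 1) := by
  have hL := one_le_log hx
  have h := abs_apDiff_sub_le hx hq (Nat.zero_le v) hv c
  rw [apDiff_zero, sub_zero, Nat.cast_zero, sub_zero] at h
  refine h.trans ?_
  gcongr

theorem sum_isUnit_mul {q : ℕ} [NeZero q] (a : (ZMod q)ˣ) (f : ZMod q → ℝ) :
    ∑ c : ZMod q, (if IsUnit c then f (a * c) else 0) = ∑ c : ZMod q, if IsUnit c then f c else 0 := by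
  rw [← Equiv.sum_comp (Units.mulLeft a) (fun c => if IsUnit c then f c else 0)]
  simp

theorem sum_isUnit_abs_le {q : ℕ} [NeZero q] (f : ZMod q → ℝ) {t : ℝ} (ht : 0 < t) :
    ∑ c : ZMod q, (if IsUnit c then |f c| else 0) ≤
      q.totient * (∑ c : ZMod q, if IsUnit c then f c ^ 2 else 0) / t + t := by
  have hφ : (0 : ℝ) < q.totient := by
    exact_mod_cast Nat.totient_pos.mpr (Nat.pos_of_ne_zero (NeZero.ne q))
  have h1 : ∑ c : ZMod q, (if IsUnit c then (1 : ℝ) else 0) = q.totient := by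
    rw [sum_isUnit_eq_sum_coprime (fun _ => (1 : ℝ)), Finset.sum_const, nsmul_eq_mul, mul_one,
      Nat.totient_eq_card_coprime]
    simp only [Nat.coprime_comm]
  calc ∑ c : ZMod q, (if IsUnit c then |f c| else 0)
      ≤ ∑ c : ZMod q, (q.totient / t * (if IsUnit c then f c ^ 2 else 0) +
          t / q.totient * (if IsUnit c then (1 : ℝ) else 0)) := by
        refine Finset.sum_le_sum fun c _ => ?_
        split_ifs
        · have h2 : q.totient / t * f c ^ 2 + t / q.totient * 1 =
              (q.totient / t) * (|f c| - t / (2 * q.totient)) ^ 2 + |f c| +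
                3 / 4 * (t / q.totient) := by
            rw [sub_sq, sq_abs]
            field_simp
            ring
          rw [h2]
          have : 0 ≤ q.totient / t * (|f c| - t / (2 * q.totient)) ^ 2 := by positivity
          have : 0 ≤ 3 / 4 * (t / (q.totient : ℝ)) := by positivity
          linarith
        · simp
    _ = _ := by
        rw [Finset.sum_add_distrib, ← Finset.mul_sum, ← Finset.mul_sum, h1]
        field_simp

theorem sum_gam_mul_coprime_le {x : ℝ} (hx : 3 ≤ x) {q N : ℕ} (hq : q ≠ 0)
    (hqx : (q : ℝ) ≤ x) (hN : (N : ℝ) ≤ x) {t : ℝ} (ht : 0 < t) (f : ZMod q → ℝ) {a : ZMod q}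
    (ha : IsUnit a) :
    ∑ l ∈ Finset.Icc 1 N with l.Coprime q, gam l * |f (a * (l : ZMod q))| ≤
      2 * x * Real.log x * ((∑ b ∈ Finset.range q with b.Coprime q, f b ^ 2) / t +
        t * (q.totient : ℝ)⁻¹) := by
  have : NeZero q := ⟨hq⟩
  have hL := one_le_log hx
  have hq0 : (0 : ℝ) < q := by exact_mod_cast Nat.pos_of_ne_zero hq
  have hφ : (0 : ℝ) < q.totient := by exact_mod_cast Nat.totient_pos.mpr (Nat.pos_of_ne_zero hq)
  have hφq : (q.totient : ℝ) ≤ q := by exact_mod_cast Nat.totient_le q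
  have h1 : ∀ l ∈ Finset.Icc 1 N, (if l.Coprime q then gam l * |f (a * (l : ZMod q))| else 0) =
      ∑ c : ZMod q, if IsUnit c then (if (l : ZMod q) = c then gam l else 0) * |f (a * c)| else 0 := by
    intro l _
    rw [Finset.sum_eq_single (l : ZMod q)]
    · simp [ZMod.isUnit_iff_coprime]
    · intro c _ hc
      simp [hc.symm]
    · simp
  rw [Finset.sum_filter, Finset.sum_congr rfl h1, Finset.sum_comm]
  have h2 : ∀ c : ZMod q, (∑ l ∈ Finset.Icc 1 N, if (l : ZMod q) = c then gam l else 0) ≤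
      2 * x * Real.log x * (q.totient : ℝ)⁻¹ := by
    intro c
    have h3 := sum_Ioc_modEq_gam_le hx hq (Nat.zero_le N) hN c
    refine h3.trans ?_
    have h4 : ((N : ℝ) - (0 : ℕ)) / q + 1 ≤ 2 * x * (q.totient : ℝ)⁻¹ := by
      rw [Nat.cast_zero, sub_zero, ← div_eq_mul_inv]
      calc (N : ℝ) / q + 1 ≤ x / q + x / q := by
            refine add_le_add (by gcongr) ?_
            rwa [le_div_iff₀ hq0, one_mul]
        _ = 2 * x / q := by ring
        _ ≤ _ := by gcongr
    calc _ ≤ Real.log x * (2 * x * (q.totient : ℝ)⁻¹) := by gcongr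
      _ = _ := by ring
  calc _ ≤ ∑ c : ZMod q, (if IsUnit c then
        2 * x * Real.log x * (q.totient : ℝ)⁻¹ * |f (a * c)| else 0) := by
        refine Finset.sum_le_sum fun c _ => ?_
        split_ifs
        · rw [← Finset.sum_mul]
          gcongr
          exact h2 c
        · simp
    _ = 2 * x * Real.log x * (q.totient : ℝ)⁻¹ * ∑ c : ZMod q, if IsUnit c then |f c| else 0 := by
        rw [← sum_isUnit_mul ha.unit (fun c => |f c|), Finset.mul_sum]
        refine Finset.sum_congr rfl fun c _ => ?_
        simp
    _ ≤ 2 * x * Real.log x * (q.totient : ℝ)⁻¹ *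
        (q.totient * (∑ c : ZMod q, if IsUnit c then f c ^ 2 else 0) / t + t) := by
        gcongr
        exact sum_isUnit_abs_le f ht
    _ = _ := by
        rw [← sum_isUnit_eq_sum_coprime (fun b => f b ^ 2)]
        simp only [ZMod.natCast_zmod_val]
        field_simp

theorem sum_gam_mul_abs_apDiff_le {x : ℝ} (hx : 3 ≤ x) {q u N : ℕ} (hq : q ≠ 0)
    (hqx : (q : ℝ) ≤ x) (hu : (u : ℝ) ≤ x) (hN : (N : ℝ) ≤ x) {t : ℝ} (ht : 0 < t) {a : ZMod q}
    (ha : IsUnit a) :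
    ∑ l ∈ Finset.Icc 1 N, gam l * |apDiff q u (a * (l : ZMod q))| ≤
      2 * x * Real.log x * (apVar q u / t + t * (q.totient : ℝ)⁻¹) +
        3 * x * Real.log x ^ 2 * (q.totient : ℝ)⁻¹ := by
  have hL := one_le_log hx
  have hφ : (0 : ℝ) < q.totient := by exact_mod_cast Nat.totient_pos.mpr (Nat.pos_of_ne_zero hq)
  have hφq : (q.totient : ℝ) ≤ q := by exact_mod_cast Nat.totient_le q
  rw [← Finset.sum_filter_add_sum_filter_not (Finset.Icc 1 N) (fun l : ℕ => l.Coprime q)]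
  refine add_le_add (sum_gam_mul_coprime_le hx hq hqx hN ht (apDiff q u) ha) ?_
  have h1 : ∀ c, |apDiff q u c| ≤ 3 * x * Real.log x * (q.totient : ℝ)⁻¹ := by
    intro c
    refine (abs_apDiff_le hx hq hu c).trans ?_
    have : 1 ≤ x * (q.totient : ℝ)⁻¹ := by
      rw [← div_eq_mul_inv, le_div_iff₀ hφ]
      linarith
    nlinarith
  calc _ ≤ ∑ l ∈ (Finset.Icc 1 N).filter (fun l : ℕ => ¬ l.Coprime q),
        gam l * (3 * x * Real.log x * (q.totient : ℝ)⁻¹) :=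
        Finset.sum_le_sum fun l _ => mul_le_mul_of_nonneg_left (h1 _) (gam_nonneg l)
    _ ≤ Real.log q * (3 * x * Real.log x * (q.totient : ℝ)⁻¹) := by
        rw [← Finset.sum_mul]
        gcongr
        exact sum_gam_not_coprime_le hq _
    _ ≤ Real.log x * (3 * x * Real.log x * (q.totient : ℝ)⁻¹) := by
        gcongr
    _ = _ := by ring

/-- Bilinear equidistribution for a fixed cut-off. -/
theorem exists_sum_sum_gam_mul_abs_apDiff_le (E : ℕ) : ∃ C : ℝ, 0 < C ∧
    ∀ (x : ℝ) (u N Q : ℕ) (a : ℕ → ℤ), 3 ≤ x → (u : ℝ) ≤ x → (N : ℝ) ≤ x →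
    Q * Real.log x ^ (2 * E + 9) ≤ x → (∀ q ∈ Finset.Icc 1 Q, IsUnit (a q : ZMod q)) →
    ∑ q ∈ Finset.Icc 1 Q, ∑ l ∈ Finset.Icc 1 N, gam l * |apDiff q u ((a q : ZMod q) * (l : ZMod q))| ≤
      C * x ^ 2 / Real.log x ^ E := by
  obtain ⟨C, hC, H⟩ := exists_sum_apVar_le (2 * E + 6)
  obtain ⟨C', hC', H'⟩ := log_pow_le_mul_sqrt (E + 4)
  refine ⟨2 * C + 12 + 18 * C', by positivity, fun x u N Q a hx hu hN hQ ha => ?_⟩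
  have hL := one_le_log hx
  have hL0 : 0 < Real.log x := by linarith
  have hx0 : 0 < x := by linarith
  have hQx : (Q : ℝ) ≤ x := by
    have := one_le_pow₀ hL (n := 2 * E + 9)
    nlinarith [Nat.cast_nonneg (α := ℝ) Q]
  obtain ⟨t, ht⟩ : ∃ t, t = x / Real.log x ^ (E + 3) := ⟨_, rfl⟩
  have ht0 : 0 < t := by rw [ht]; positivity
  have h1 := H x u Q hx hu hQ
  have h2 := sum_inv_totient_le hx hQx
  calc _ ≤ ∑ q ∈ Finset.Icc 1 Q, (2 * x * Real.log x / t * apVar q u +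
        (2 * x * Real.log x * t + 3 * x * Real.log x ^ 2) * (q.totient : ℝ)⁻¹) := by
        refine Finset.sum_le_sum fun q hq => ?_
        have hq' := Finset.mem_Icc.mp hq
        refine (sum_gam_mul_abs_apDiff_le hx (by omega) (le_trans (by exact_mod_cast hq'.2) hQx)
          hu hN ht0 (ha q hq)).trans (le_of_eq ?_)
        ring
    _ = 2 * x * Real.log x / t * ∑ q ∈ Finset.Icc 1 Q, apVar q u +
        (2 * x * Real.log x * t + 3 * x * Real.log x ^ 2) *
          ∑ q ∈ Finset.Icc 1 Q, (q.totient : ℝ)⁻¹ := by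
        rw [Finset.sum_add_distrib, Finset.mul_sum, Finset.mul_sum]
    _ ≤ 2 * x * Real.log x / t * (C * x ^ 2 / Real.log x ^ (2 * E + 6)) +
        (2 * x * Real.log x * t + 3 * x * Real.log x ^ 2) * (6 * Real.log x ^ 2) := by
        gcongr
    _ = 2 * C * x ^ 2 / Real.log x ^ (E + 2) + 12 * x ^ 2 / Real.log x ^ E +
        18 * x * Real.log x ^ 4 := by
        rw [ht]
        field_simp
        ring
    _ ≤ 2 * C * x ^ 2 / Real.log x ^ E + 12 * x ^ 2 / Real.log x ^ E +
        18 * C' * x ^ 2 / Real.log x ^ E := by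
        refine add_le_add (add_le_add ?_ le_rfl) ?_
        · exact div_le_div_of_nonneg_left (by positivity) (by positivity)
            (pow_le_pow_right₀ hL (by omega))
        · rw [le_div_iff₀ (by positivity)]
          have h3 : √x ≤ x := Real.sqrt_le_self_iff.mpr (Or.inr (by linarith))
          calc 18 * x * Real.log x ^ 4 * Real.log x ^ E = 18 * x * Real.log x ^ (E + 4) := by ring
            _ ≤ 18 * x * (C' * √x) := by
                gcongr
                exact H' x (by linarith)
            _ ≤ 18 * x * (C' * x) := by gcongr
            _ = _ := by ring
    _ = _ := by ring

theorem abs_apDiff_le_sum {x : ℝ} (hx : 3 ≤ x) {q u N H : ℕ} (hq : q ≠ 0) (hH : 0 < H)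
    (hu : u ≤ N) (hN : (N : ℝ) ≤ x) (c : ZMod q) :
    |apDiff q u c| ≤ ∑ j ∈ Finset.range (N / H + 1), |apDiff q (H * j) c| +
      Real.log x * (2 * H * (q.totient : ℝ)⁻¹ + 1) := by
  have hL := one_le_log hx
  have h1 : H * (u / H) ≤ u := Nat.mul_div_le u H
  have h2 := abs_apDiff_sub_le hx hq h1 (le_trans (by exact_mod_cast hu) hN) c
  have h3 : |apDiff q (H * (u / H)) c| ≤
      ∑ j ∈ Finset.range (N / H + 1), |apDiff q (H * j) c| :=
    Finset.single_le_sum (f := fun j => |apDiff q (H * j) c|) (fun _ _ => abs_nonneg _)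
      (Finset.mem_range.mpr (Nat.lt_succ_of_le (Nat.div_le_div_right hu)))
  have h4 : (u : ℝ) - (H * (u / H) : ℕ) ≤ H := by
    have h5 : u ≤ H * (u / H) + H := by
      have := Nat.div_add_mod u H
      have := Nat.mod_lt u hH
      omega
    have h6 : (u : ℝ) ≤ (H * (u / H) : ℕ) + H := by exact_mod_cast h5
    linarith
  have h5 : Real.log x * (2 * ((u : ℝ) - (H * (u / H) : ℕ)) * (q.totient : ℝ)⁻¹ + 1) ≤
      Real.log x * (2 * H * (q.totient : ℝ)⁻¹ + 1) := by gcongr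
  have h6 := abs_sub_abs_le_abs_sub (apDiff q u c) (apDiff q (H * (u / H)) c)
  linarith

/-- Bilinear equidistribution with a cut-off depending on the modulus and the second variable. -/
theorem exists_sum_sum_gam_mul_abs_apDiff_cutoff_le (A : ℕ) : ∃ C : ℝ, 0 < C ∧
    ∀ (x : ℝ) (N Q : ℕ) (a : ℕ → ℤ) (U : ℕ → ℕ → ℕ), 3 ≤ x → (N : ℝ) ≤ x →
    Q * Real.log x ^ (4 * A + 15) ≤ x → (∀ q ∈ Finset.Icc 1 Q, IsUnit (a q : ZMod q)) →
    (∀ q l, U q l ≤ N) →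
    ∑ q ∈ Finset.Icc 1 Q, ∑ l ∈ Finset.Icc 1 N,
      gam l * |apDiff q (U q l) ((a q : ZMod q) * (l : ZMod q))| ≤ C * x ^ 2 / Real.log x ^ A := by
  obtain ⟨C, hC, H⟩ := exists_sum_sum_gam_mul_abs_apDiff_le (2 * A + 3)
  obtain ⟨C', hC', H'⟩ := log_pow_le_mul_sqrt (A + 3)
  refine ⟨2 * C + 24 * (1 + C') + 2, by positivity, fun x N Q a U hx hN hQ ha hU => ?_⟩
  have hL := one_le_log hx
  have hL0 : 0 < Real.log x := by linarith
  have hx0 : 0 < x := by linarith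
  have hQx : (Q : ℝ) ≤ x := by
    have := one_le_pow₀ hL (n := 4 * A + 15)
    nlinarith [Nat.cast_nonneg (α := ℝ) Q]
  obtain ⟨h, hh⟩ : ∃ h, h = ⌈x / Real.log x ^ (A + 3)⌉₊ := ⟨_, rfl⟩
  have hh1 : x / Real.log x ^ (A + 3) ≤ h := by rw [hh]; exact Nat.le_ceil _
  have hh0 : 0 < h := by rw [hh]; exact Nat.ceil_pos.mpr (by positivity)
  have hh2 : (h : ℝ) ≤ (1 + C') * (x / Real.log x ^ (A + 3)) := by
    have h1 : (h : ℝ) ≤ x / Real.log x ^ (A + 3) + 1 := by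
      rw [hh]; exact (Nat.ceil_lt_add_one (by positivity)).le
    have h2 : 1 ≤ C' * (x / Real.log x ^ (A + 3)) := by
      rw [← mul_div_assoc, le_div_iff₀ (by positivity), one_mul]
      have h3 : √x ≤ x := Real.sqrt_le_self_iff.mpr (Or.inr (by linarith))
      exact (H' x (by linarith)).trans (by gcongr)
    linarith
  have hJ : ((N / h + 1 : ℕ) : ℝ) ≤ 2 * Real.log x ^ (A + 3) := by
    have h1 : ((N / h : ℕ) : ℝ) ≤ Real.log x ^ (A + 3) := by
      refine Nat.cast_div_le.trans ?_
      rw [div_le_iff₀ (by exact_mod_cast hh0)]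
      rw [div_le_iff₀ (by positivity)] at hh1
      linarith
    have h2 := one_le_pow₀ hL (n := A + 3)
    push_cast
    linarith
  have h1 : ∀ j ∈ Finset.range (N / h + 1), ∑ q ∈ Finset.Icc 1 Q, ∑ l ∈ Finset.Icc 1 N,
      gam l * |apDiff q (h * j) ((a q : ZMod q) * (l : ZMod q))| ≤
        C * x ^ 2 / Real.log x ^ (2 * A + 3) := by
    intro j hj
    refine H x (h * j) N Q a hx (le_trans ?_ hN) hN (le_of_eq_of_le (by ring_nf) hQ) ha
    have : h * j ≤ N := by
      have h2 : j ≤ N / h := Nat.lt_succ_iff.mp (Finset.mem_range.mp hj)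
      exact (Nat.mul_le_mul_left h h2).trans (Nat.mul_div_le N h)
    exact_mod_cast this
  have h2 : ∑ l ∈ Finset.Icc 1 N, gam l ≤ 2 * x := (sum_gam_le N).trans (by linarith)
  have h3 := sum_inv_totient_le hx hQx
  calc _ ≤ ∑ q ∈ Finset.Icc 1 Q, (∑ j ∈ Finset.range (N / h + 1), ∑ l ∈ Finset.Icc 1 N,
          gam l * |apDiff q (h * j) ((a q : ZMod q) * (l : ZMod q))| +
          2 * x * (Real.log x * (2 * h * (q.totient : ℝ)⁻¹ + 1))) := by
        refine Finset.sum_le_sum fun q hq => ?_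
        have hq0 : q ≠ 0 := by have := (Finset.mem_Icc.mp hq).1; omega
        calc _ ≤ ∑ l ∈ Finset.Icc 1 N, (∑ j ∈ Finset.range (N / h + 1),
              gam l * |apDiff q (h * j) ((a q : ZMod q) * (l : ZMod q))| +
              gam l * (Real.log x * (2 * h * (q.totient : ℝ)⁻¹ + 1))) := by
              refine Finset.sum_le_sum fun l _ => ?_
              rw [← Finset.mul_sum, ← mul_add]
              exact mul_le_mul_of_nonneg_left
                (abs_apDiff_le_sum hx hq0 hh0 (hU q l) hN _) (gam_nonneg l)
          _ ≤ _ := by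
              rw [Finset.sum_add_distrib, Finset.sum_comm, ← Finset.sum_mul]
              gcongr
    _ = (∑ j ∈ Finset.range (N / h + 1), ∑ q ∈ Finset.Icc 1 Q, ∑ l ∈ Finset.Icc 1 N,
          gam l * |apDiff q (h * j) ((a q : ZMod q) * (l : ZMod q))|) +
        2 * x * Real.log x * (2 * h * (∑ q ∈ Finset.Icc 1 Q, (q.totient : ℝ)⁻¹) + Q) := by
        rw [Finset.sum_add_distrib, Finset.sum_comm, ← Finset.mul_sum, ← Finset.mul_sum,
          Finset.sum_add_distrib, ← Finset.mul_sum]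
        simp
        ring
    _ ≤ 2 * Real.log x ^ (A + 3) * (C * x ^ 2 / Real.log x ^ (2 * A + 3)) +
        2 * x * Real.log x * (2 * ((1 + C') * (x / Real.log x ^ (A + 3))) * (6 * Real.log x ^ 2) +
          x / Real.log x ^ (4 * A + 15)) := by
        refine add_le_add ?_ ?_
        · refine (Finset.sum_le_sum h1).trans ?_
          rw [Finset.sum_const, Finset.card_range, nsmul_eq_mul]
          gcongr
        · have : (Q : ℝ) ≤ x / Real.log x ^ (4 * A + 15) := by rwa [le_div_iff₀ (by positivity)]
          gcongr
    _ = 2 * C * x ^ 2 / Real.log x ^ A + 24 * (1 + C') * x ^ 2 / Real.log x ^ A +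
        2 * x ^ 2 / Real.log x ^ (4 * A + 14) := by
        field_simp
        ring
    _ ≤ 2 * C * x ^ 2 / Real.log x ^ A + 24 * (1 + C') * x ^ 2 / Real.log x ^ A +
        2 * x ^ 2 / Real.log x ^ A := by
        refine add_le_add le_rfl (div_le_div_of_nonneg_left (by positivity) (by positivity)
            (pow_le_pow_right₀ hL (by omega)))
    _ = _ := by ring

theorem norm_natCast_sub_le_of_mem_Icc {z : ℂ} {y : ℝ} {a b c : ℕ} (ha : ‖(a : ℂ) - z‖ ≤ y)
    (hb : ‖(b : ℂ) - z‖ ≤ y) (hac : a ≤ c) (hcb : c ≤ b) : ‖(c : ℂ) - z‖ ≤ y := by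
  have hac' : (a : ℝ) ≤ c := by exact_mod_cast hac
  have hcb' : (c : ℝ) ≤ b := by exact_mod_cast hcb
  rw [Complex.norm_eq_sqrt_sq_add_sq] at *
  simp only [Complex.sub_re, Complex.natCast_re, Complex.sub_im, Complex.natCast_im] at *
  rcases le_total (c : ℝ) z.re with h | h
  · exact (Real.sqrt_le_sqrt (by nlinarith)).trans ha
  · exact (Real.sqrt_le_sqrt (by nlinarith)).trans hb

theorem exists_filter_norm_sub_le_eq_Ioc (z : ℂ) (y : ℝ) (N : ℕ) : ∃ U V : ℕ, U ≤ V ∧ V ≤ N ∧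
    ((Finset.Icc 1 N).filter fun n : ℕ => ‖(n : ℂ) - z‖ ≤ y) = Finset.Ioc U V := by
  obtain ⟨s, hs⟩ : ∃ s, s = (Finset.Icc 1 N).filter fun n : ℕ => ‖(n : ℂ) - z‖ ≤ y := ⟨_, rfl⟩
  have hmem : ∀ n, n ∈ s ↔ (1 ≤ n ∧ n ≤ N) ∧ ‖(n : ℂ) - z‖ ≤ y := by simp [hs]
  rw [← hs]
  rcases s.eq_empty_or_nonempty with h | h
  · exact ⟨0, 0, le_rfl, Nat.zero_le _, by simpa using h⟩
  · have h1 := (hmem _).mp (s.min'_mem h)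
    have h2 := (hmem _).mp (s.max'_mem h)
    have h3 := s.min'_le _ (s.max'_mem h)
    refine ⟨s.min' h - 1, s.max' h, by omega, h2.1.2, ?_⟩
    ext n
    rw [Finset.mem_Ioc]
    constructor
    · intro hn
      have h4 := s.min'_le n hn
      have h5 := s.le_max' n hn
      omega
    · intro hn
      rw [hmem]
      refine ⟨by omega, norm_natCast_sub_le_of_mem_Icc h1.2 h2.2 (by omega) hn.2⟩

theorem exists_abs_sum_sum_sub_le (q N : ℕ) (a : ℤ) (z : ℂ) (y : ℝ) : ∃ U V : ℕ → ℕ,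
    (∀ l, U l ≤ N) ∧ (∀ l, V l ≤ N) ∧
    |(∑ l1 ∈ Finset.Icc 1 N, ∑ l2 ∈ Finset.Icc 1 N,
        if ‖(l1 : ℂ) - z * (l2 : ℂ)‖ ≤ y ∧ (l1 : ℤ) ≡ a * (l2 : ℤ) [ZMOD (q : ℤ)]
        then gam (l1 : ℤ) * gam (l2 : ℤ) else 0)
      - (q.totient : ℝ)⁻¹ * ∑ l1 ∈ Finset.Icc 1 N, ∑ l2 ∈ Finset.Icc 1 N,
        if ‖(l1 : ℂ) - z * (l2 : ℂ)‖ ≤ y then gam (l1 : ℤ) * gam (l2 : ℤ) else 0| ≤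
    ∑ l ∈ Finset.Icc 1 N, gam l * |apDiff q (U l) ((a : ZMod q) * (l : ZMod q))| +
    ∑ l ∈ Finset.Icc 1 N, gam l * |apDiff q (V l) ((a : ZMod q) * (l : ZMod q))| := by
  choose U V hUV hV hs using fun l : ℕ => exists_filter_norm_sub_le_eq_Ioc (z * (l : ℂ)) y N
  refine ⟨U, V, fun l => (hUV l).trans (hV l), hV, ?_⟩
  have h1 : ∀ l : ℕ, ∀ f : ℕ → ℝ, (∑ n ∈ Finset.Icc 1 N,
      if ‖(n : ℂ) - z * (l : ℂ)‖ ≤ y then f n else 0) = ∑ n ∈ Finset.Ioc (U l) (V l), f n := by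
    intro l f
    rw [← hs l, Finset.sum_filter]
  rw [Finset.sum_comm, Finset.sum_comm (s := Finset.Icc 1 N) (t := Finset.Icc 1 N)
    (f := fun l1 l2 : ℕ => if ‖(l1 : ℂ) - z * (l2 : ℂ)‖ ≤ y then gam (l1 : ℤ) * gam (l2 : ℤ) else 0),
    Finset.mul_sum, ← Finset.sum_sub_distrib, ← Finset.sum_add_distrib]
  refine (Finset.abs_sum_le_sum_abs _ _).trans (Finset.sum_le_sum fun l _ => ?_)
  simp only [ite_and]
  rw [h1, h1]
  have h2 : (∑ n ∈ Finset.Ioc (U l) (V l), if (n : ℤ) ≡ a * (l : ℤ) [ZMOD (q : ℤ)]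
      then gam (n : ℤ) * gam (l : ℤ) else 0) = gam l * ∑ n ∈ Finset.Ioc (U l) (V l),
        if (n : ZMod q) = (a : ZMod q) * (l : ZMod q) then gam n else 0 := by
    rw [Finset.mul_sum]
    refine Finset.sum_congr rfl fun n _ => ?_
    have h3 : (n : ℤ) ≡ a * (l : ℤ) [ZMOD (q : ℤ)] ↔
        (n : ZMod q) = (a : ZMod q) * (l : ZMod q) := by
      rw [← ZMod.intCast_eq_intCast_iff]
      push_cast
      rfl
    simp only [h3]
    split_ifs <;> ring
  rw [h2, ← Finset.sum_mul]
  have h4 := sum_Ioc_sub_eq_apDiff (hUV l) ((a : ZMod q) * (l : ZMod q))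
  have h5 : gam (l : ℤ) * (∑ n ∈ Finset.Ioc (U l) (V l),
        if (n : ZMod q) = (a : ZMod q) * (l : ZMod q) then gam n else 0) -
      (q.totient : ℝ)⁻¹ * ((∑ n ∈ Finset.Ioc (U l) (V l), gam n) * gam (l : ℤ)) =
      gam (l : ℤ) * (apDiff q (V l) ((a : ZMod q) * (l : ZMod q)) -
        apDiff q (U l) ((a : ZMod q) * (l : ZMod q))) := by
    rw [← h4]
    ring
  rw [h5, abs_mul, abs_of_nonneg (gam_nonneg l), ← mul_add]
  refine mul_le_mul_of_nonneg_left ((abs_sub _ _).trans (le_of_eq (add_comm _ _))) (gam_nonneg l)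

/-- Equidistribution of `γ_{ℓ₁} γ_{ℓ₂}` in residue classes (Proposition 20.9 of
Friedlander–Iwaniec): for every `A > 0` there are `B > 0` and `C` such that, with
`Q = x (log x)^{−B}`, for any assignment to each `q ≤ Q` of `a(q)` coprime to `q`,
`𝔞(q) ∈ ℂ` and `y(q) ∈ ℝ`,
`∑_{q ≤ Q} |∑∑_{ℓᵢ ≤ x, |ℓ₁ − 𝔞(q)ℓ₂| ≤ y(q), ℓ₁ ≡ a(q)ℓ₂ (q)} γ_{ℓ₁}γ_{ℓ₂}
  − φ(q)⁻¹ ∑∑_{ℓᵢ ≤ x, |ℓ₁ − 𝔞(q)ℓ₂| ≤ y(q)} γ_{ℓ₁}γ_{ℓ₂}| ≤ C x² (log x)^{−A}`. -/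
theorem equidistribution_gamma :
    ∀ A : ℝ, 0 < A → ∃ B : ℝ, 0 < B ∧ ∃ C : ℝ, ∀ x : ℝ, 3 ≤ x →
      ∀ a : ℕ → ℤ, ∀ fa : ℕ → ℂ, ∀ y : ℕ → ℝ,
        (∀ q : ℕ, 0 < q → (q : ℝ) ≤ x * Real.log x ^ (-B) → IsCoprime (a q) (q : ℤ)) →
        ∑ q ∈ Finset.Icc 1 (Nat.floor (x * Real.log x ^ (-B))),
          |(∑ l1 ∈ Finset.Icc 1 (Nat.floor x), ∑ l2 ∈ Finset.Icc 1 (Nat.floor x),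
              if ‖(l1 : ℂ) - fa q * (l2 : ℂ)‖ ≤ y q ∧ (l1 : ℤ) ≡ a q * (l2 : ℤ) [ZMOD (q : ℤ)]
              then gam (l1 : ℤ) * gam (l2 : ℤ) else 0)
            - (Nat.totient q : ℝ)⁻¹ *
              ∑ l1 ∈ Finset.Icc 1 (Nat.floor x), ∑ l2 ∈ Finset.Icc 1 (Nat.floor x),
                if ‖(l1 : ℂ) - fa q * (l2 : ℂ)‖ ≤ y q
                then gam (l1 : ℤ) * gam (l2 : ℤ) else 0|
          ≤ C * x ^ 2 * Real.log x ^ (-A) := by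
  intro A hA
  obtain ⟨C, hC, H⟩ := exists_sum_sum_gam_mul_abs_apDiff_cutoff_le ⌈A⌉₊
  refine ⟨((4 * ⌈A⌉₊ + 15 : ℕ) : ℝ), by positivity, 2 * C, fun x hx a fa y ha => ?_⟩
  have hL := one_le_log hx
  have hL0 : 0 < Real.log x := by linarith
  have hx0 : 0 < x := by linarith
  rw [Real.rpow_neg hL0.le, Real.rpow_natCast] at ha ⊢
  generalize hQ' : ⌊x * (Real.log x ^ (4 * ⌈A⌉₊ + 15))⁻¹⌋₊ = Q
  have hQ0 : (Q : ℝ) ≤ x * (Real.log x ^ (4 * ⌈A⌉₊ + 15))⁻¹ := by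
    rw [← hQ']
    exact Nat.floor_le (by positivity)
  have hQ : Q * Real.log x ^ (4 * ⌈A⌉₊ + 15) ≤ x := by
    rwa [← div_eq_mul_inv, le_div_iff₀ (by positivity)] at hQ0
  have hN : ((⌊x⌋₊ : ℕ) : ℝ) ≤ x := Nat.floor_le hx0.le
  have hu : ∀ q ∈ Finset.Icc 1 Q, IsUnit (a q : ZMod q) := by
    intro q hq
    rw [Finset.mem_Icc] at hq
    rw [ZMod.coe_int_isUnit_iff_isCoprime]
    exact (ha q hq.1 (le_trans (by exact_mod_cast hq.2) hQ0)).symm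
  choose U V hU hV hUV using fun q => exists_abs_sum_sum_sub_le q ⌊x⌋₊ (a q) (fa q) (y q)
  refine (Finset.sum_le_sum fun q _ => hUV q).trans ?_
  rw [Finset.sum_add_distrib]
  have h1 := H x ⌊x⌋₊ Q a U hx hN hQ hu hU
  have h2 := H x ⌊x⌋₊ Q a V hx hN hQ hu hV
  have h3 : C * x ^ 2 / Real.log x ^ ⌈A⌉₊ ≤ C * x ^ 2 * Real.log x ^ (-A) := by
    rw [div_eq_mul_inv, ← Real.rpow_natCast (Real.log x), ← Real.rpow_neg hL0.le]
    refine mul_le_mul_of_nonneg_left (Real.rpow_le_rpow_of_exponent_le hL ?_) (by positivity)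
    exact neg_le_neg (Nat.le_ceil A)
  calc _ ≤ C * x ^ 2 * Real.log x ^ (-A) + C * x ^ 2 * Real.log x ^ (-A) :=
        add_le_add (h1.trans h3) (h2.trans h3)
    _ = _ := by ring
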